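/- arXiv:2003.09919 — 2 statements merged into one kernel-verified Lean document; each statement's English description precedes it below -/
import Mathlib

section
/- Let U be a metric space and V a geodesic metric space, and let f : U → V be a 1-Lipschitz surjection satisfying the length-preserving lifting property. Suppose U satisfies the κ-comparison (quadruple) condition: for every p̂ ∈ U and all q̂₁, q̂₂, q̂₃ ∈ U \ {p̂} for which the κ-comparison angles are defined, ∠̃_κ p̂(q̂₁,q̂₂) + ∠̃_κ p̂(q̂₂,q̂₃) + ∠̃_κ p̂(q̂₃,q̂₁) ≤ 2π. Then V satisfies the same κ-comparison condition: for every p ∈ V and all q₁, q₂, q₃ ∈ V \ {p} for which the κ-comparison angles are defined, ∠̃_κ p(q₁,q₂) + ∠̃_κ p(q₂,q₃) + ∠̃_κ p(q₃,q₁) ≤ 2π. -/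
/-- The κ-comparison angle: the angle opposite the side of length `c` in the triangle with
side lengths `a`, `b`, `c` in the model plane of constant curvature `κ`. -/
noncomputable def compAngle (κ a b c : ℝ) : ℝ :=
  if κ = 0 then Real.arccos ((a ^ 2 + b ^ 2 - c ^ 2) / (2 * a * b))
  else if 0 < κ then
    Real.arccos ((Real.cos (Real.sqrt κ * c) -
      Real.cos (Real.sqrt κ * a) * Real.cos (Real.sqrt κ * b)) /
      (Real.sin (Real.sqrt κ * a) * Real.sin (Real.sqrt κ * b)))
  else
    Real.arccos ((Real.cosh (Real.sqrt (-κ) * a) * Real.cosh (Real.sqrt (-κ) * b) -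
      Real.cosh (Real.sqrt (-κ) * c)) /
      (Real.sinh (Real.sqrt (-κ) * a) * Real.sinh (Real.sqrt (-κ) * b)))

/-- Admissibility of side lengths for the κ-comparison angle. -/
def angleDefined (κ a b c : ℝ) : Prop :=
  0 < a ∧ 0 < b ∧ |a - b| ≤ c ∧ c ≤ a + b ∧
    (0 < κ → a + b + c < 2 * Real.pi / Real.sqrt κ)

/-- The κ-comparison angle `∠̃_κ p (x, y)`. -/
noncomputable def compAngleAt {Y : Type*} [MetricSpace Y] (κ : ℝ) (p x y : Y) : ℝ :=
  compAngle κ (dist p x) (dist p y) (dist x y)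

/-- The κ-comparison (quadruple) condition: for every vertex `p` and every three points,
the three κ-comparison angles at `p` sum to at most `2π` (whenever defined). -/
def SatisfiesKappaComparison (κ : ℝ) (Y : Type*) [MetricSpace Y] : Prop :=
  ∀ p q₁ q₂ q₃ : Y, q₁ ≠ p → q₂ ≠ p → q₃ ≠ p →
    angleDefined κ (dist p q₁) (dist p q₂) (dist q₁ q₂) →
    angleDefined κ (dist p q₂) (dist p q₃) (dist q₂ q₃) →
    angleDefined κ (dist p q₃) (dist p q₁) (dist q₃ q₁) →
    compAngleAt κ p q₁ q₂ + compAngleAt κ p q₂ q₃ + compAngleAt κ p q₃ q₁ ≤ 2 * Real.pi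

/-- `γ : [0,T] → Y` is a unit-speed geodesic. -/
def IsUnitSpeedOn {Y : Type*} [MetricSpace Y] (γ : ℝ → Y) (T : ℝ) : Prop :=
  ∀ s ∈ Set.Icc (0 : ℝ) T, ∀ t ∈ Set.Icc (0 : ℝ) T, dist (γ s) (γ t) = |s - t|

/-- `γ` is a (unit-speed) geodesic from `a` to `b`. -/
def IsGeodesicFromTo {Y : Type*} [MetricSpace Y] (a b : Y) (γ : ℝ → Y) : Prop :=
  γ 0 = a ∧ γ (dist a b) = b ∧ IsUnitSpeedOn γ (dist a b)

/-- A geodesic space: any two points are joined by a geodesic. -/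
def IsGeodesicSpace (Y : Type*) [MetricSpace Y] : Prop :=
  ∀ x y : Y, ∃ γ : ℝ → Y, IsGeodesicFromTo x y γ

/-- The length-preserving lifting property. -/
def LengthPreservingLifting {U V : Type*} [MetricSpace U] [MetricSpace V] (f : U → V) : Prop :=
  ∀ T : ℝ, 0 ≤ T → ∀ γ : ℝ → V, IsUnitSpeedOn γ T →
    ∀ phat : U, f phat = γ 0 →
      ∃ γhat : ℝ → U, ContinuousOn γhat (Set.Icc 0 T) ∧ γhat 0 = phat ∧
        (∀ t ∈ Set.Icc (0 : ℝ) T, f (γhat t) = γ t) ∧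
        (∀ t : ℝ, 0 < t → t ≤ T → eVariationOn γhat (Set.Icc 0 t) = ENNReal.ofReal t)

open Real Set in
lemma aux_sinusoid {k L : ℝ} (hk : 0 < k) (hL : 0 < L) (hkL : k * L < π) (h : ℝ → ℝ)
    (hc : ContinuousOn h (Icc 0 L))
    (hh : ∀ t ∈ Ioo 0 L, ∃ δ > 0, ∀ s, 0 < s → s < δ → s ≤ t → s ≤ L - t →
      2 * cos (k * s) * h t ≤ h (t + s) + h (t - s)) :
    ∀ t ∈ Icc 0 L, h t * sin (k * L) ≤ h 0 * sin (k * (L - t)) + h L * sin (k * t) := by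
  set u : ℝ → ℝ := fun t => h t * sin (k * L) - (h 0 * sin (k * (L - t)) + h L * sin (k * t))
    with hu
  obtain ⟨l, hl1, hl2⟩ : ∃ l, k < l ∧ l * L < π := by
    have : k < π / L := by rwa [lt_div_iff₀ hL]
    obtain ⟨l, h1, h2⟩ := exists_between this
    exact ⟨l, h1, by rwa [lt_div_iff₀ hL] at h2⟩
  have hl0 : 0 < l := hk.trans hl1
  set w : ℝ → ℝ := fun t => cos (l * (t - L / 2)) with hw
  have hwpos : ∀ t ∈ Icc 0 L, 0 < w t := by
    intro t ht
    apply cos_pos_of_mem_Ioo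
    constructor <;> nlinarith [ht.1, ht.2]
  have huc : ContinuousOn u (Icc 0 L) := by
    apply ContinuousOn.sub
    · exact hc.mul continuousOn_const
    · fun_prop
  have hwc : ContinuousOn w (Icc 0 L) := by fun_prop
  have hrc : ContinuousOn (fun t => u t / w t) (Icc 0 L) :=
    huc.div hwc (fun t ht => (hwpos t ht).ne')
  obtain ⟨t0, ht0, hmax⟩ := isCompact_Icc.exists_isMaxOn ⟨0, left_mem_Icc.2 hL.le⟩ hrc
  have hmax' : ∀ t ∈ Icc 0 L, u t / w t ≤ u t0 / w t0 := fun t ht => hmax ht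
  set M := u t0 / w t0 with hM
  have hle : ∀ t ∈ Icc 0 L, u t ≤ M * w t := by
    intro t ht
    have := hmax' t ht
    rwa [div_le_iff₀ (hwpos t ht)] at this
  have hut0 : u t0 = M * w t0 := by
    rw [hM]; field_simp [(hwpos t0 ht0).ne']
  have hu0 : u 0 = 0 := by simp [hu]
  have huL : u L = 0 := by simp [hu]
  have hMle : M ≤ 0 := by
    by_contra hMp
    push Not at hMp
    have hupos : 0 < u t0 := by rw [hut0]; exact mul_pos hMp (hwpos t0 ht0)
    have h1 : 0 < t0 := lt_of_le_of_ne ht0.1 (by rintro rfl; linarith)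
    have h2 : t0 < L := lt_of_le_of_ne ht0.2 (by rintro rfl; linarith)
    obtain ⟨δ, hδ, hs⟩ := hh t0 ⟨h1, h2⟩
    obtain ⟨s, s0, s1⟩ := exists_between (show 0 < min δ (min t0 (L - t0)) by
      simp only [lt_min_iff]; exact ⟨hδ, h1, by linarith⟩)
    simp only [lt_min_iff] at s1
    obtain ⟨s1, s2, s3⟩ := s1
    have key := hs s s0 s1 s2.le s3.le
    have hsinL : 0 < sin (k * L) := sin_pos_of_pos_of_lt_pi (by positivity) hkL
    have e1 : sin (k * (L - (t0 + s))) + sin (k * (L - (t0 - s)))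
        = 2 * cos (k * s) * sin (k * (L - t0)) := by
      rw [show k * (L - (t0 + s)) = k * (L - t0) - k * s by ring,
        show k * (L - (t0 - s)) = k * (L - t0) + k * s by ring, sin_sub, sin_add]; ring
    have e2 : sin (k * (t0 + s)) + sin (k * (t0 - s)) = 2 * cos (k * s) * sin (k * t0) := by
      rw [mul_add, mul_sub, sin_sub, sin_add]; ring
    have e3 : w (t0 + s) + w (t0 - s) = 2 * cos (l * s) * w t0 := by
      simp only [hw]
      rw [show l * (t0 + s - L / 2) = l * (t0 - L / 2) + l * s by ring,
        show l * (t0 - s - L / 2) = l * (t0 - L / 2) - l * s by ring, cos_sub, cos_add]; ring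
    have hu1 : 2 * cos (k * s) * u t0 ≤ u (t0 + s) + u (t0 - s) := by
      have := mul_le_mul_of_nonneg_right key hsinL.le
      simp only [hu]
      linear_combination this + h 0 * e1 + h L * e2
    have hu2 : u (t0 + s) + u (t0 - s) ≤ 2 * cos (l * s) * u t0 := by
      have a1 := hle (t0 + s) ⟨by linarith, by linarith⟩
      have a2 := hle (t0 - s) ⟨by linarith, by linarith⟩
      rw [hut0]
      linear_combination a1 + a2 + M * e3
    have hcos : cos (l * s) < cos (k * s) := by
      apply cos_lt_cos_of_nonneg_of_le_pi (by positivity)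
      · nlinarith
      · nlinarith
    nlinarith
  intro t ht
  have := hle t ht
  have h3 : u t ≤ 0 := this.trans (mul_nonpos_of_nonpos_of_nonneg hMle (hwpos t ht).le)
  simp only [hu] at h3
  linarith

lemma aux_lift {U V : Type*} [MetricSpace U] [MetricSpace V] (hV : IsGeodesicSpace V)
    (f : U → V) (hlip : LipschitzWith 1 f) (hlift : LengthPreservingLifting f)
    (p : U) (x : V) : ∃ y : U, f y = x ∧ dist p y = dist (f p) x := by
  obtain ⟨γ, h0, h1, h2⟩ := hV (f p) x
  rcases eq_or_ne (f p) x with h | h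
  · exact ⟨p, h, by simp [h]⟩
  have hT : 0 < dist (f p) x := dist_pos.2 h
  obtain ⟨g, -, g0, g1, g2⟩ := hlift _ hT.le γ h2 p h0.symm
  have hf : f (g (dist (f p) x)) = x := by rw [g1 _ ⟨hT.le, le_rfl⟩, h1]
  refine ⟨g (dist (f p) x), hf, le_antisymm ?_ ?_⟩
  · have := eVariationOn.edist_le g (s := Set.Icc 0 (dist (f p) x))
      (x := 0) (y := dist (f p) x) ⟨le_rfl, hT.le⟩ ⟨hT.le, le_rfl⟩
    rw [g2 _ hT le_rfl, g0, edist_dist] at this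
    exact (ENNReal.ofReal_le_ofReal_iff hT.le).1 this
  · have := hlip.dist_le_mul p (g (dist (f p) x))
    rw [hf] at this
    simpa using this

lemma aux_mono {κ a b c c' : ℝ} (ha : 0 < a) (hb : 0 < b) (hc : 0 ≤ c) (hcc : c ≤ c')
    (hκ : 0 < κ → a + b < Real.pi / √κ ∧ c' ≤ Real.pi / √κ) :
    compAngle κ a b c ≤ compAngle κ a b c' := by
  unfold compAngle
  split_ifs with h1 h2
  · apply Real.arccos_le_arccos
    gcongr
  · obtain ⟨h3, h4⟩ := hκ h2
    have hs : 0 < √κ := Real.sqrt_pos.2 h2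
    rw [lt_div_iff₀ hs] at h3
    rw [le_div_iff₀ hs] at h4
    have sa : 0 < √κ * a := by positivity
    have sb : 0 < √κ * b := by positivity
    have p1 := Real.sin_pos_of_pos_of_lt_pi sa (by nlinarith)
    have p2 := Real.sin_pos_of_pos_of_lt_pi sb (by nlinarith)
    apply Real.arccos_le_arccos
    apply div_le_div_of_nonneg_right _ (by positivity)
    have := Real.cos_le_cos_of_nonneg_of_le_pi (x := √κ * c) (y := √κ * c') (by positivity)
      (by linarith) (by gcongr)
    linarith
  · have hs : 0 < √(-κ) := Real.sqrt_pos.2 (by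
      rcases lt_trichotomy κ 0 with h | h | h
      · linarith
      · exact absurd h h1
      · exact absurd h h2)
    have p1 : 0 < Real.sinh (√(-κ) * a) := Real.sinh_pos_iff.2 (by positivity)
    have p2 : 0 < Real.sinh (√(-κ) * b) := Real.sinh_pos_iff.2 (by positivity)
    apply Real.arccos_le_arccos
    apply div_le_div_of_nonneg_right _ (by positivity)
    have : Real.cosh (√(-κ) * c) ≤ Real.cosh (√(-κ) * c') := by
      rw [Real.cosh_le_cosh, abs_of_nonneg (by positivity),
        abs_of_nonneg (mul_nonneg hs.le (hc.trans hcc))]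
      gcongr
    linarith

lemma aux_defined {Y : Type*} [MetricSpace Y] {κ : ℝ} {p x y : Y} (hx : x ≠ p) (hy : y ≠ p)
    (h : 0 < κ → dist p x + dist p y < Real.pi / √κ) :
    angleDefined κ (dist p x) (dist p y) (dist x y) := by
  have t : dist x y ≤ dist p x + dist p y := dist_triangle_left x y p
  refine ⟨dist_pos.2 hx.symm, dist_pos.2 hy.symm, ?_, t, ?_⟩
  · rw [abs_le]
    constructor
    · linarith [dist_triangle p x y]
    · linarith [dist_triangle_right p x y]
  · intro hk
    have := h hk
    rw [mul_div_assoc]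
    linarith

/-- The quadruple comparison in `V` for quadruples with small legs. -/
lemma aux_small {U V : Type*} [MetricSpace U] [MetricSpace V] {κ : ℝ} (hV : IsGeodesicSpace V)
    (f : U → V) (hsurj : Function.Surjective f) (hlip : LipschitzWith 1 f)
    (hlift : LengthPreservingLifting f) (hU : SatisfiesKappaComparison κ U)
    (p q₁ q₂ q₃ : V) (h1 : q₁ ≠ p) (h2 : q₂ ≠ p) (h3 : q₃ ≠ p)
    (h12 : 0 < κ → dist p q₁ + dist p q₂ < Real.pi / √κ)
    (h23 : 0 < κ → dist p q₂ + dist p q₃ < Real.pi / √κ)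
    (h31 : 0 < κ → dist p q₃ + dist p q₁ < Real.pi / √κ) :
    compAngleAt κ p q₁ q₂ + compAngleAt κ p q₂ q₃ + compAngleAt κ p q₃ q₁ ≤ 2 * Real.pi := by
  obtain ⟨P, rfl⟩ := hsurj p
  obtain ⟨Q₁, rfl, d1⟩ := aux_lift hV f hlip hlift P q₁
  obtain ⟨Q₂, rfl, d2⟩ := aux_lift hV f hlip hlift P q₂
  obtain ⟨Q₃, rfl, d3⟩ := aux_lift hV f hlip hlift P q₃
  have key : ∀ x y : U, f x ≠ f P → f y ≠ f P → dist P x = dist (f P) (f x) →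
      dist P y = dist (f P) (f y) →
      (0 < κ → dist (f P) (f x) + dist (f P) (f y) < Real.pi / √κ) →
      angleDefined κ (dist P x) (dist P y) (dist x y) ∧
      compAngleAt κ (f P) (f x) (f y) ≤ compAngleAt κ P x y := by
    intro x y hx hy dx dy h
    rw [← dx, ← dy] at h
    refine ⟨aux_defined (fun e => hx (by rw [e])) (fun e => hy (by rw [e])) h, ?_⟩
    unfold compAngleAt
    rw [← dx, ← dy]
    apply aux_mono (dx ▸ dist_pos.2 hx.symm) (dy ▸ dist_pos.2 hy.symm) dist_nonneg
    · simpa using hlip.dist_le_mul x y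
    · intro hk
      exact ⟨h hk, (dist_triangle_left x y P).trans (h hk).le⟩
  obtain ⟨a1, b1⟩ := key _ _ h1 h2 d1 d2 h12
  obtain ⟨a2, b2⟩ := key _ _ h2 h3 d2 d3 h23
  obtain ⟨a3, b3⟩ := key _ _ h3 h1 d3 d1 h31
  have := hU P Q₁ Q₂ Q₃ (fun e => h1 (by rw [e])) (fun e => h2 (by rw [e]))
    (fun e => h3 (by rw [e])) a1 a2 a3
  linarith

/-- The conclusion of `aux_small`. -/
def AuxSmall (κ : ℝ) (V : Type*) [MetricSpace V] : Prop :=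
  ∀ p q₁ q₂ q₃ : V, q₁ ≠ p → q₂ ≠ p → q₃ ≠ p →
    (0 < κ → dist p q₁ + dist p q₂ < Real.pi / √κ) →
    (0 < κ → dist p q₂ + dist p q₃ < Real.pi / √κ) →
    (0 < κ → dist p q₃ + dist p q₁ < Real.pi / √κ) →
    compAngleAt κ p q₁ q₂ + compAngleAt κ p q₂ q₃ + compAngleAt κ p q₃ q₁ ≤ 2 * Real.pi

lemma aux_arccos {A B : ℝ} (hA : -1 ≤ A) (hB : -1 ≤ B)
    (h : Real.arccos A + Real.arccos B ≤ Real.pi) : 0 ≤ A + B := by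
  by_contra hn
  push Not at hn
  have h1 : Real.arccos (-B) < Real.arccos A :=
    Real.arccos_lt_arccos hA (by linarith) (by linarith)
  rw [Real.arccos_neg] at h1
  linarith

lemma aux_mid {V : Type*} [MetricSpace V] {κ : ℝ} (hκ : 0 < κ) (hS : AuxSmall κ V)
    (z x y p : V) {s : ℝ} (hs : 0 < s) (hx : dist z x = s) (hy : dist z y = s)
    (hxy : dist x y = 2 * s) (h1 : s + dist z p < Real.pi / √κ) (h2 : 2 * s < Real.pi / √κ) :
    2 * Real.cos (√κ * s) * Real.cos (√κ * dist p z)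
      ≤ Real.cos (√κ * dist p y) + Real.cos (√κ * dist p x) := by
  have hk : 0 < √κ := Real.sqrt_pos.2 hκ
  rcases eq_or_ne p z with rfl | hpz
  · rw [hx, hy]; simp; linarith
  have hxz : x ≠ z := by rintro rfl; simp at hx; linarith
  have hyz : y ≠ z := by rintro rfl; simp at hy; linarith
  have key := hS z x y p hxz hyz hpz (fun _ => by rw [hx, hy]; linarith)
    (fun _ => by rw [hy]; exact h1) (fun _ => by rw [hx]; linarith)
  unfold compAngleAt compAngle at key
  simp only [hκ.ne', hκ, if_true, if_false, hx, hy, hxy] at key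
  rw [dist_comm p z]
  have tx := dist_triangle_left x p z
  have ty := dist_triangle_left y p z
  rw [hx] at tx
  rw [hy] at ty
  rw [dist_comm x p] at tx
  rw [dist_comm y p] at ty key
  have hr : 0 < dist z p := dist_pos.2 hpz.symm
  generalize dist z p = r at *
  generalize hX : dist p x = X at *
  generalize hY : dist p y = Y at *
  have hX0 : 0 ≤ X := hX ▸ dist_nonneg
  have hY0 : 0 ≤ Y := hY ▸ dist_nonneg
  rw [lt_div_iff₀ hk] at h1 h2
  generalize √κ = k at *
  have ks : 0 < k * s := by positivity
  have kr : 0 < k * r := by positivity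
  have ss := Real.sin_pos_of_pos_of_lt_pi ks (by nlinarith)
  have sr := Real.sin_pos_of_pos_of_lt_pi kr (by nlinarith)
  have e1 : (Real.cos (k * (2 * s)) - Real.cos (k * s) * Real.cos (k * s)) /
      (Real.sin (k * s) * Real.sin (k * s)) = -1 := by
    rw [show k * (2 * s) = k * s + k * s by ring, Real.cos_add]
    field_simp
    ring
  rw [e1, Real.arccos_neg_one] at key
  have cb : ∀ W, 0 ≤ W → W ≤ s + r → Real.cos (k * s) * Real.cos (k * r)
      - Real.sin (k * s) * Real.sin (k * r) ≤ Real.cos (k * W) := by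
    intro W hW0 hW
    rw [← Real.cos_add]
    apply Real.cos_le_cos_of_nonneg_of_le_pi (by positivity)
    · linarith
    · nlinarith
  have cx := cb X hX0 tx
  have cy := cb Y hY0 ty
  have pr : 0 < Real.sin (k * s) * Real.sin (k * r) := by positivity
  rw [mul_comm (Real.sin (k * r)), mul_comm (Real.cos (k * r))] at key
  have := aux_arccos (A := (Real.cos (k * Y) - Real.cos (k * s) * Real.cos (k * r)) /
      (Real.sin (k * s) * Real.sin (k * r)))
      (B := (Real.cos (k * X) - Real.cos (k * s) * Real.cos (k * r)) /
      (Real.sin (k * s) * Real.sin (k * r)))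
    (by rw [le_div_iff₀ pr]; linarith) (by rw [le_div_iff₀ pr]; linarith) (by linarith)
  rw [← add_div, le_div_iff₀ pr] at this
  linarith

lemma aux_angle_mono {V : Type*} [MetricSpace V] {κ : ℝ} (hκ : 0 < κ) (hS : AuxSmall κ V)
    {p x y : V} {γ : ℝ → V} (hγ : IsGeodesicFromTo p x γ) (hx : x ≠ p) (hy : y ≠ p)
    (hper : dist p x + dist p y + dist x y < 2 * Real.pi / √κ) {t : ℝ} (ht : 0 < t)
    (htL : t ≤ dist p x) :
    compAngleAt κ p x y ≤ compAngleAt κ p (γ t) y := by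
  have hk : 0 < √κ := Real.sqrt_pos.2 hκ
  obtain ⟨g0, g1, g2⟩ := hγ
  have hL : 0 < dist p x := dist_pos.2 hx.symm
  have hb : 0 < dist p y := dist_pos.2 hy.symm
  rw [mul_div_assoc] at hper
  have hLπ : dist p x < Real.pi / √κ := by linarith [dist_triangle_right p x y]
  have hbπ : dist p y < Real.pi / √κ := by linarith [dist_triangle p x y]
  have hp : ∀ t ∈ Set.Icc 0 (dist p x), dist p (γ t) = t := by
    intro t ht
    have := g2 0 ⟨le_rfl, hL.le⟩ t ht
    rwa [g0, zero_sub, abs_neg, abs_of_nonneg ht.1] at this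
  have hxx : ∀ t ∈ Set.Icc 0 (dist p x), dist (γ t) x = dist p x - t := by
    intro t ht
    have := g2 t ht _ ⟨hL.le, le_rfl⟩
    rwa [g1, abs_sub_comm, abs_of_nonneg (by linarith [ht.2])] at this
  have hyt : ∀ t ∈ Set.Icc 0 (dist p x), dist y (γ t) < Real.pi / √κ := by
    intro t ht
    have a1 := dist_triangle_left y (γ t) p
    have a2 := dist_triangle_left y (γ t) x
    rw [hp t ht] at a1
    rw [dist_comm x (γ t), hxx t ht] at a2
    linarith
  have hcont : ContinuousOn γ (Set.Icc 0 (dist p x)) := by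
    have : LipschitzOnWith 1 γ (Set.Icc 0 (dist p x)) :=
      LipschitzOnWith.of_dist_le_mul (fun a ha b hb => by
        rw [g2 a ha b hb, Real.dist_eq]; simp)
    exact this.continuousOn
  have key := aux_sinusoid hk hL (by rw [lt_div_iff₀ hk] at hLπ; linarith)
    (fun t => Real.cos (√κ * dist y (γ t)))
    (by fun_prop)
    (by
      intro τ hτ
      have hτ' : τ ∈ Set.Icc 0 (dist p x) := ⟨hτ.1.le, hτ.2.le⟩
      refine ⟨min (Real.pi / √κ - dist y (γ τ)) (Real.pi / √κ / 2), ?_, ?_⟩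
      · have := hyt τ hτ'
        have : 0 < Real.pi / √κ := by positivity
        apply lt_min <;> linarith
      · intro s s0 s1 s2 s3
        rw [lt_min_iff] at s1
        have m1 : τ + s ∈ Set.Icc 0 (dist p x) := ⟨by linarith [hτ.1], by linarith⟩
        have m2 : τ - s ∈ Set.Icc 0 (dist p x) := ⟨by linarith, by linarith [hτ.2]⟩
        apply aux_mid hκ hS (γ τ) (γ (τ - s)) (γ (τ + s)) y s0
        · rw [g2 _ hτ' _ m2, sub_sub_cancel, abs_of_pos s0]
        · rw [g2 _ hτ' _ m1, sub_add_cancel_left, abs_neg, abs_of_pos s0]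
        · rw [g2 _ m2 _ m1, abs_sub_comm, abs_of_nonneg] <;> linarith
        · rw [dist_comm]; linarith [s1.1]
        · linarith [s1.2])
    t ⟨ht.le, htL⟩
  simp only [g0, g1] at key
  unfold compAngleAt compAngle
  simp only [hκ.ne', hκ, if_true, if_false, hp t ⟨ht.le, htL⟩]
  rw [dist_comm (γ t) y, dist_comm x y]
  rw [dist_comm y p] at key
  rw [lt_div_iff₀ hk] at hLπ hbπ
  generalize dist y (γ t) = T at *
  generalize dist p x = L at *
  generalize dist p y = b at *
  generalize dist y x = c at *
  generalize √κ = k at *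
  have sL : 0 < Real.sin (k * L) := Real.sin_pos_of_pos_of_lt_pi (by positivity) (by linarith)
  have sb : 0 < Real.sin (k * b) := Real.sin_pos_of_pos_of_lt_pi (by positivity) (by linarith)
  have st : 0 < Real.sin (k * t) := Real.sin_pos_of_pos_of_lt_pi (by positivity) (by nlinarith)
  apply Real.arccos_le_arccos
  rw [div_le_div_iff₀ (by positivity) (by positivity)]
  rw [mul_sub k L t, Real.sin_sub] at key
  have := mul_le_mul_of_nonneg_right key sb.le
  linear_combination this

lemma compAngle_swap (κ a b c : ℝ) : compAngle κ a b c = compAngle κ b a c := by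
  unfold compAngle
  rw [mul_comm (Real.cos (√κ * a)), mul_comm (Real.sin (√κ * a)),
    mul_comm (Real.cosh (√(-κ) * a)), mul_comm (Real.sinh (√(-κ) * a)), add_comm (a ^ 2),
    mul_right_comm 2 a b]

lemma compAngleAt_swap {V : Type*} [MetricSpace V] (κ : ℝ) (p x y : V) :
    compAngleAt κ p x y = compAngleAt κ p y x := by
  unfold compAngleAt
  rw [compAngle_swap, dist_comm x y]

lemma aux_pair {V : Type*} [MetricSpace V] {κ : ℝ} (hκ : 0 < κ) (hS : AuxSmall κ V)
    {p x y : V} {γ σ : ℝ → V} (hγ : IsGeodesicFromTo p x γ) (hσ : IsGeodesicFromTo p y σ)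
    (hx : x ≠ p) (hy : y ≠ p)
    (hper : angleDefined κ (dist p x) (dist p y) (dist x y)) {t : ℝ} (ht : 0 < t)
    (htx : t ≤ dist p x) (hty : t ≤ dist p y) :
    compAngleAt κ p x y ≤ compAngleAt κ p (γ t) (σ t) := by
  have hper := hper.2.2.2.2 hκ
  refine (aux_angle_mono hκ hS hγ hx hy hper ht htx).trans ?_
  rw [compAngleAt_swap κ p (γ t) y, compAngleAt_swap κ p (γ t) (σ t)]
  obtain ⟨g0, g1, g2⟩ := hγ
  have m0 : (0 : ℝ) ∈ Set.Icc 0 (dist p x) := ⟨le_rfl, dist_nonneg⟩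
  have m1 : dist p x ∈ Set.Icc 0 (dist p x) := ⟨dist_nonneg, le_rfl⟩
  have mt : t ∈ Set.Icc 0 (dist p x) := ⟨ht.le, htx⟩
  have e1 := g2 0 m0 t mt
  rw [g0, zero_sub, abs_neg, abs_of_pos ht] at e1
  have e2 := g2 _ m1 t mt
  rw [g1, abs_of_nonneg (by linarith)] at e2
  have hne : γ t ≠ p := by
    intro e; rw [e, dist_self] at e1; linarith
  apply aux_angle_mono hκ hS hσ hy hne _ ht hty
  have := dist_triangle y x (γ t)
  rw [dist_comm y x] at this
  linarith

/-- The length-preserving lifting property transports lower curvature bounds: if `U`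
satisfies the κ-comparison condition and `f : U → V` is a 1-Lipschitz surjection with the
length-preserving lifting property onto a geodesic space, then `V` satisfies it too. -/
theorem kappaComparison_of_lengthPreservingLifting {U V : Type*}
    [MetricSpace U] [MetricSpace V] (κ : ℝ) (hV : IsGeodesicSpace V)
    (f : U → V) (hsurj : Function.Surjective f) (hlip : LipschitzWith 1 f)
    (hlift : LengthPreservingLifting f)
    (hU : SatisfiesKappaComparison κ U) :
    SatisfiesKappaComparison κ V := by
  have hS : AuxSmall κ V := fun p q₁ q₂ q₃ => aux_small hV f hsurj hlip hlift hU p q₁ q₂ q₃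
  intro p q₁ q₂ q₃ h1 h2 h3 d12 d23 d31
  by_cases hκ : 0 < κ
  · have hk : 0 < Real.pi / √κ := div_pos Real.pi_pos (Real.sqrt_pos.2 hκ)
    obtain ⟨t, t0, t1⟩ := exists_between (show 0 < min (Real.pi / √κ / 2)
      (min (dist p q₁) (min (dist p q₂) (dist p q₃))) by
        simp only [lt_min_iff]
        exact ⟨by linarith, dist_pos.2 h1.symm, dist_pos.2 h2.symm, dist_pos.2 h3.symm⟩)
    simp only [lt_min_iff] at t1
    obtain ⟨tk, t1, t2, t3⟩ := t1
    obtain ⟨γ₁, H1⟩ := hV p q₁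
    obtain ⟨γ₂, H2⟩ := hV p q₂
    obtain ⟨γ₃, H3⟩ := hV p q₃
    have hd : ∀ (q : V) (γ : ℝ → V), IsGeodesicFromTo p q γ → t < dist p q →
        dist p (γ t) = t ∧ γ t ≠ p := by
      intro q γ H hq
      have e1 := H.2.2 0 ⟨le_rfl, dist_nonneg⟩ t ⟨t0.le, hq.le⟩
      rw [H.1, zero_sub, abs_neg, abs_of_pos t0] at e1
      exact ⟨e1, fun e => by rw [e, dist_self] at e1; linarith⟩
    obtain ⟨e1, n1⟩ := hd _ _ H1 t1
    obtain ⟨e2, n2⟩ := hd _ _ H2 t2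
    obtain ⟨e3, n3⟩ := hd _ _ H3 t3
    have := hS p (γ₁ t) (γ₂ t) (γ₃ t) n1 n2 n3 (fun _ => by rw [e1, e2]; linarith)
      (fun _ => by rw [e2, e3]; linarith) (fun _ => by rw [e3, e1]; linarith)
    have a1 := aux_pair hκ hS H1 H2 h1 h2 d12 t0 t1.le t2.le
    have a2 := aux_pair hκ hS H2 H3 h2 h3 d23 t0 t2.le t3.le
    have a3 := aux_pair hκ hS H3 H1 h3 h1 d31 t0 t3.le t1.le
    linarith
  · exact hS p q₁ q₂ q₃ h1 h2 h3 (fun h => absurd h hκ) (fun h => absurd h hκ)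
      (fun h => absurd h hκ)
end

section
/- Let n be a natural number and κ ∈ ℝ. Let Y be a complete, proper, geodesic length space whose Hausdorff dimension equals n. Let A ⊆ Y be a subset such that: (1) every point of Y \ A has an open neighborhood in Y that is a κ-domain; (2) A is discrete, i.e. every point a ∈ A has r > 0 with B_r(a) ∩ A = {a}; and (3) every point of A is a convex point of Y. Then Y satisfies the global κ-comparison (quadruple) condition: for every p ∈ Y and all q₁, q₂, q₃ ∈ Y \ {p} for which the κ-comparison angles are defined, ∠̃_κ p(q₁,q₂) + ∠̃_κ p(q₂,q₃) + ∠̃_κ p(q₃,q₁) ≤ 2π; that is, Y is an n-dimensional Alexandrov space with curvature bounded below by κ. -/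
/-- The upper angle `∠_p(γ, σ)` between two curves emanating from `p`: the upper limit
of comparison angles as `(t, s) → (0⁺, 0⁺)` (independent of the model curvature, so we
take `κ = 0`). -/
noncomputable def upperAngle {Y : Type*} [MetricSpace Y] (p : Y) (γ σ : ℝ → Y) : ℝ :=
  Filter.limsup (fun ts : ℝ × ℝ => compAngleAt 0 p (γ ts.1) (σ ts.2))
    ((nhdsWithin 0 (Set.Ioi 0)) ×ˢ (nhdsWithin 0 (Set.Ioi 0)))

/-- The length (total variation) of a curve `σ : [0,1] → Y`. -/
noncomputable def curveLength {Y : Type*} [MetricSpace Y] (σ : ℝ → Y) : ENNReal :=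
  eVariationOn σ (Set.Icc 0 1)

/-- A length space: distance equals the infimum of lengths of connecting continuous curves. -/
def IsLengthSpace (Y : Type*) [MetricSpace Y] : Prop :=
  ∀ x y : Y, ENNReal.ofReal (dist x y) =
    ⨅ σ : {σ : ℝ → Y // ContinuousOn σ (Set.Icc 0 1) ∧ σ 0 = x ∧ σ 1 = y},
      curveLength σ.1

/-- An open set `U` is a κ-domain: three κ-comparison angles at any vertex of a triangle
with vertices in `U` sum to at most `2π` (whenever defined). -/
def IsKappaDomain {Y : Type*} [MetricSpace Y] (κ : ℝ) (U : Set Y) : Prop :=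
  IsOpen U ∧ ∀ p ∈ U, ∀ q₁ ∈ U, ∀ q₂ ∈ U, ∀ q₃ ∈ U,
    q₁ ≠ p → q₂ ≠ p → q₃ ≠ p →
    angleDefined κ (dist p q₁) (dist p q₂) (dist q₁ q₂) →
    angleDefined κ (dist p q₂) (dist p q₃) (dist q₂ q₃) →
    angleDefined κ (dist p q₃) (dist p q₁) (dist q₃ q₁) →
    compAngleAt κ p q₁ q₂ + compAngleAt κ p q₂ q₃ + compAngleAt κ p q₃ q₁ ≤ 2 * Real.pi

/-- A point `p` is convex: for every geodesic from `x` to `y` having `p` as an interior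
point, every `z ≠ p`, and every geodesic from `p` to `z`, the upper angles at `p` of the
geodesic to `z` with the two halves of the geodesic through `p` sum to at most `π`. -/
def IsConvexPoint {Y : Type*} [MetricSpace Y] (p : Y) : Prop :=
  ∀ x y : Y, ∀ g : ℝ → Y, IsGeodesicFromTo x y g →
    ∀ t₀ ∈ Set.Ioo (0 : ℝ) (dist x y), g t₀ = p →
    ∀ z : Y, z ≠ p → ∀ h : ℝ → Y, IsGeodesicFromTo p z h →
      upperAngle p h (fun t => g (t₀ - t)) + upperAngle p h (fun t => g (t₀ + t)) ≤ Real.pi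


/-! ### Model functions -/

/-- generalized sine -/
noncomputable def sn (κ t : ℝ) : ℝ :=
  if κ = 0 then t else if 0 < κ then Real.sin (Real.sqrt κ * t) / Real.sqrt κ
  else Real.sinh (Real.sqrt (-κ) * t) / Real.sqrt (-κ)

/-- modified distance function -/
noncomputable def md (κ t : ℝ) : ℝ :=
  if κ = 0 then t ^ 2 / 2 else if 0 < κ then (1 - Real.cos (Real.sqrt κ * t)) / κ
  else (1 - Real.cosh (Real.sqrt (-κ) * t)) / κ

/-- generalized cosine -/
noncomputable def cs (κ t : ℝ) : ℝ := 1 - κ * md κ t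

/-- `t` is less than the diameter of the model space -/
def Adm (κ t : ℝ) : Prop := 0 < κ → Real.sqrt κ * t < Real.pi

lemma kappa_cases (κ : ℝ) : κ = 0 ∨ (0 < κ ∧ κ ≠ 0 ∧ 0 < Real.sqrt κ ∧ κ = Real.sqrt κ ^ 2) ∨
    (¬ 0 < κ ∧ κ ≠ 0 ∧ 0 < Real.sqrt (-κ) ∧ κ = - Real.sqrt (-κ) ^ 2) := by
  rcases lt_trichotomy κ 0 with h | h | h
  · refine Or.inr (Or.inr ⟨by linarith, h.ne, Real.sqrt_pos.2 (by linarith), ?_⟩)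
    rw [Real.sq_sqrt (by linarith)]; ring
  · exact Or.inl h
  · exact Or.inr (Or.inl ⟨h, h.ne', Real.sqrt_pos.2 h, (Real.sq_sqrt h.le).symm⟩)

lemma sn_add (κ a b : ℝ) : sn κ (a + b) = sn κ a * cs κ b + cs κ a * sn κ b := by
  rcases kappa_cases κ with h | ⟨h, h0, hs, hk⟩ | ⟨h, h0, hs, hk⟩
  · simp [sn, cs, h]
  · simp only [sn, cs, md, h, h0, if_true, if_false, mul_add, Real.sin_add]
    field_simp; ring
  · simp only [sn, cs, md, h, h0, if_false, mul_add, Real.sinh_add]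
    field_simp; ring

lemma md_add (κ a b : ℝ) :
    md κ (a + b) = md κ a + md κ b - κ * md κ a * md κ b + sn κ a * sn κ b := by
  rcases kappa_cases κ with h | ⟨h, h0, hs, hk⟩ | ⟨h, h0, hs, hk⟩
  · simp [sn, md, h]; ring
  · simp only [sn, md, h, h0, if_true, if_false, mul_add, Real.cos_add]
    generalize Real.sqrt κ = r at *
    subst hk; field_simp; ring
  · simp only [sn, md, h, h0, if_false, mul_add, Real.cosh_add]
    generalize Real.sqrt (-κ) = r at *
    subst hk; field_simp; ring

lemma sn_sq (κ a : ℝ) : sn κ a ^ 2 = 2 * md κ a - κ * md κ a ^ 2 := by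
  rcases kappa_cases κ with h | ⟨h, h0, hs, hk⟩ | ⟨h, h0, hs, hk⟩
  · simp [sn, md, h]; ring
  · simp only [sn, md, h, h0, if_true, if_false, div_pow, Real.sin_sq]
    generalize Real.sqrt κ = r at *
    subst hk; field_simp; ring
  · simp only [sn, md, h, h0, if_false, div_pow, Real.sinh_sq]
    generalize Real.sqrt (-κ) = r at *
    subst hk; field_simp; ring

@[simp] lemma sn_zero (κ : ℝ) : sn κ 0 = 0 := by simp [sn]
@[simp] lemma md_zero (κ : ℝ) : md κ 0 = 0 := by simp [md]
@[simp] lemma cs_zero (κ : ℝ) : cs κ 0 = 1 := by simp [cs]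
@[simp] lemma sn_neg (κ t : ℝ) : sn κ (-t) = - sn κ t := by
  simp only [sn]; split_ifs <;> simp [neg_div]
@[simp] lemma md_neg (κ t : ℝ) : md κ (-t) = md κ t := by
  simp only [md]; split_ifs <;> simp
@[simp] lemma cs_neg (κ t : ℝ) : cs κ (-t) = cs κ t := by simp [cs]
lemma md_abs (κ t : ℝ) : md κ |t| = md κ t := by
  rcases abs_choice t with h | h <;> simp [h]

lemma sn_sub (κ a b : ℝ) : sn κ (a - b) = sn κ a * cs κ b - cs κ a * sn κ b := by
  rw [sub_eq_add_neg, sn_add]; simp; ring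
lemma md_sub (κ a b : ℝ) :
    md κ (a - b) = md κ a + md κ b - κ * md κ a * md κ b - sn κ a * sn κ b := by
  rw [sub_eq_add_neg, md_add]; simp; ring

lemma hasDerivAt_md (κ t : ℝ) : HasDerivAt (md κ) (sn κ t) t := by
  rcases kappa_cases κ with h | ⟨h, h0, hs, hk⟩ | ⟨h, h0, hs, hk⟩
  · have : md κ = fun t => t ^ 2 / 2 := by funext; simp [md, h]
    rw [this]
    have := (hasDerivAt_pow 2 t).div_const 2
    refine this.congr_deriv ?_
    simp [sn, h]
  · have : md κ = fun t => (1 - Real.cos (Real.sqrt κ * t)) / κ := by funext; simp [md, h, h0]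
    rw [this]
    have := ((((hasDerivAt_id t).const_mul (Real.sqrt κ)).cos).const_sub 1).div_const κ
    refine this.congr_deriv ?_
    simp only [sn, h, h0, if_true, if_false, id]
    rw [div_eq_div_iff h0 hs.ne']
    linear_combination (-Real.sin (Real.sqrt κ * t)) * hk
  · have : md κ = fun t => (1 - Real.cosh (Real.sqrt (-κ) * t)) / κ := by funext; simp [md, h, h0]
    rw [this]
    have := ((((hasDerivAt_id t).const_mul (Real.sqrt (-κ))).cosh).const_sub 1).div_const κ
    refine this.congr_deriv ?_
    simp only [sn, h, h0, if_false, id]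
    rw [div_eq_div_iff h0 hs.ne']
    linear_combination (-Real.sinh (Real.sqrt (-κ) * t)) * hk

lemma hasDerivAt_cs (κ t : ℝ) : HasDerivAt (cs κ) (-(κ * sn κ t)) t := by
  have := ((hasDerivAt_md κ t).const_mul κ).const_sub 1
  exact this

lemma hasDerivAt_sn (κ t : ℝ) : HasDerivAt (sn κ) (cs κ t) t := by
  rcases kappa_cases κ with h | ⟨h, h0, hs, hk⟩ | ⟨h, h0, hs, hk⟩
  · have : sn κ = fun t => t := by funext; simp [sn, h]
    rw [this]
    refine (hasDerivAt_id t).congr_deriv ?_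
    simp [cs, h]
  · have : sn κ = fun t => Real.sin (Real.sqrt κ * t) / Real.sqrt κ := by
      funext; simp [sn, h, h0]
    rw [this]
    have := (((hasDerivAt_id t).const_mul (Real.sqrt κ)).sin).div_const (Real.sqrt κ)
    refine this.congr_deriv ?_
    simp only [cs, md, h, h0, if_true, if_false, id]
    field_simp; ring
  · have : sn κ = fun t => Real.sinh (Real.sqrt (-κ) * t) / Real.sqrt (-κ) := by
      funext; simp [sn, h, h0]
    rw [this]
    have := (((hasDerivAt_id t).const_mul (Real.sqrt (-κ))).sinh).div_const (Real.sqrt (-κ))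
    refine this.congr_deriv ?_
    simp only [cs, md, h, h0, if_false, id]
    field_simp; ring

lemma continuous_md (κ : ℝ) : Continuous (md κ) :=
  continuous_iff_continuousAt.2 fun t => (hasDerivAt_md κ t).continuousAt
lemma continuous_sn (κ : ℝ) : Continuous (sn κ) :=
  continuous_iff_continuousAt.2 fun t => (hasDerivAt_sn κ t).continuousAt
lemma continuous_cs (κ : ℝ) : Continuous (cs κ) :=
  continuous_iff_continuousAt.2 fun t => (hasDerivAt_cs κ t).continuousAt

lemma Adm.mono {κ a b : ℝ} (h : Adm κ b) (hab : a ≤ b) : Adm κ a := fun hk =>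
  lt_of_le_of_lt (mul_le_mul_of_nonneg_left hab (Real.sqrt_nonneg _)) (h hk)

lemma exists_adm (κ : ℝ) : ∃ r : ℝ, 0 < r ∧ Adm κ r := by
  refine ⟨1 / (Real.sqrt κ + 1), by positivity, fun h => ?_⟩
  have h1 : Real.sqrt κ * (1 / (Real.sqrt κ + 1)) < 1 := by
    rw [mul_one_div, div_lt_one (by positivity)]; linarith
  linarith [Real.pi_gt_three]

lemma sn_pos {κ t : ℝ} (ht : 0 < t) (h : Adm κ t) : 0 < sn κ t := by
  rcases kappa_cases κ with h1 | ⟨h1, h0, hs, hk⟩ | ⟨h1, h0, hs, hk⟩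
  · simpa [sn, h1]
  · simp only [sn, h1, h0, if_true, if_false]
    exact div_pos (Real.sin_pos_of_pos_of_lt_pi (by positivity) (h h1)) hs
  · simp only [sn, h1, h0, if_false]
    exact div_pos (Real.sinh_pos_iff.2 (by positivity)) hs

lemma sn_nonneg {κ t : ℝ} (ht : 0 ≤ t) (h : Adm κ t) : 0 ≤ sn κ t := by
  rcases ht.eq_or_lt with rfl | h1
  · simp
  · exact (sn_pos h1 h).le

/-- positivity of the generalized cosine up to half of the diameter -/
lemma cs_pos {κ t : ℝ} (h : Adm κ (2 * |t|)) : 0 < cs κ t := by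
  rcases kappa_cases κ with h1 | ⟨h1, h0, hs, hk⟩ | ⟨h1, h0, hs, hk⟩
  · simp [cs, h1]
  · have : cs κ t = Real.cos (Real.sqrt κ * t) := by
      simp only [cs, md, h1, h0, if_true, if_false]; field_simp; ring
    rw [this]
    have h2 := h h1
    have h3 : |Real.sqrt κ * t| < Real.pi / 2 := by
      rw [abs_mul, abs_of_pos hs]; linarith
    rw [abs_lt] at h3
    exact Real.cos_pos_of_mem_Ioo ⟨by linarith, h3.2⟩
  · have : cs κ t = Real.cosh (Real.sqrt (-κ) * t) := by
      simp only [cs, md, h1, h0, if_false]; field_simp; ring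
    rw [this]; exact Real.cosh_pos _

lemma md_diff (κ a b : ℝ) : md κ b - md κ a = 2 * sn κ ((a + b) / 2) * sn κ ((b - a) / 2) := by
  have h1 := md_add κ ((a + b) / 2) ((b - a) / 2)
  have h2 := md_sub κ ((a + b) / 2) ((b - a) / 2)
  rw [show (a + b) / 2 + (b - a) / 2 = b by ring] at h1
  rw [show (a + b) / 2 - (b - a) / 2 = a by ring] at h2
  rw [h1, h2]; ring

/-- monotonicity, in the form adapted to perimeters -/
lemma md_lt {κ a b : ℝ} (ha : 0 ≤ a) (hab : a < b) (h : Adm κ ((a + b) / 2)) :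
    md κ a < md κ b := by
  have h1 := md_diff κ a b
  have h2 : 0 < sn κ ((a + b) / 2) := sn_pos (by linarith) h
  have h3 : 0 < sn κ ((b - a) / 2) := sn_pos (by linarith) (h.mono (by linarith))
  have := mul_pos h2 h3
  nlinarith

lemma md_le {κ a b : ℝ} (ha : 0 ≤ a) (hab : a ≤ b) (h : Adm κ ((a + b) / 2)) :
    md κ a ≤ md κ b := by
  rcases hab.eq_or_lt with rfl | h1
  · exact le_rfl
  · exact (md_lt ha h1 h).le

lemma md_nonneg {κ a : ℝ} (ha : 0 ≤ a) (h : Adm κ a) : 0 ≤ md κ a := by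
  have := md_le le_rfl ha (h.mono (by linarith))
  simpa using this

lemma md_pos {κ a : ℝ} (ha : 0 < a) (h : Adm κ a) : 0 < md κ a := by
  have := md_lt le_rfl ha (h.mono (by linarith))
  simpa using this


/-! ### Cosine of comparison angles and the point-on-side inequality -/

/-- cosine of the comparison angle -/
noncomputable def CC (κ a b c : ℝ) : ℝ :=
  (md κ a + md κ b - κ * md κ a * md κ b - md κ c) / (sn κ a * sn κ b)

lemma CC_comm (κ a b c : ℝ) : CC κ a b c = CC κ b a c := by
  unfold CC; congr 1 <;> ring

lemma compAngle_eq (κ a b c : ℝ) : compAngle κ a b c = Real.arccos (CC κ a b c) := by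
  rcases kappa_cases κ with h | ⟨h, h0, hs, hk⟩ | ⟨h, h0, hs, hk⟩
  · simp only [compAngle, CC, md, sn, h, if_true]
    congr 1
    rw [show (a ^ 2 / 2 + b ^ 2 / 2 - 0 * (a ^ 2 / 2) * (b ^ 2 / 2) - c ^ 2 / 2)
      = (a ^ 2 + b ^ 2 - c ^ 2) / 2 by ring, div_div, mul_assoc]
  · simp only [compAngle, CC, md, sn, h, h0, if_true, if_false]
    congr 1
    generalize Real.cos (Real.sqrt κ * c) = x, Real.cos (Real.sqrt κ * a) = y,
      Real.cos (Real.sqrt κ * b) = z, Real.sin (Real.sqrt κ * a) = u,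
      Real.sin (Real.sqrt κ * b) = v
    rw [show (1 - y) / κ + (1 - z) / κ - κ * ((1 - y) / κ) * ((1 - z) / κ) - (1 - x) / κ
      = (x - y * z) / κ by field_simp; ring,
      show u / Real.sqrt κ * (v / Real.sqrt κ) = u * v / κ by
        rw [div_mul_div_comm]; congr 1; rw [← sq]; exact hk.symm,
      div_div_div_cancel_right₀ h0]
  · simp only [compAngle, CC, md, sn, h, h0, if_false]
    congr 1
    generalize Real.cosh (Real.sqrt (-κ) * c) = x, Real.cosh (Real.sqrt (-κ) * a) = y,
      Real.cosh (Real.sqrt (-κ) * b) = z, Real.sinh (Real.sqrt (-κ) * a) = u,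
      Real.sinh (Real.sqrt (-κ) * b) = v
    rw [show (1 - y) / κ + (1 - z) / κ - κ * ((1 - y) / κ) * ((1 - z) / κ) - (1 - x) / κ
      = (y * z - x) / (-κ) by field_simp; ring,
      show u / Real.sqrt (-κ) * (v / Real.sqrt (-κ)) = u * v / (-κ) by
        rw [div_mul_div_comm]; congr 1; rw [← sq]; linarith,
      div_div_div_cancel_right₀ (neg_ne_zero.2 h0)]

lemma CC_mul {κ a b c : ℝ} (ha : 0 < sn κ a) (hb : 0 < sn κ b) :
    CC κ a b c * (sn κ a * sn κ b) = md κ a + md κ b - κ * md κ a * md κ b - md κ c := by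
  unfold CC; rw [div_mul_cancel₀ _ (mul_pos ha hb).ne']

lemma CC_le_one {κ a b c : ℝ} (ha : 0 < a) (hb : 0 < b) (h1 : |a - b| ≤ c)
    (h3 : Adm κ ((a + b + c) / 2)) : CC κ a b c ≤ 1 := by
  have h4 := abs_le.1 h1
  have sa : 0 < sn κ a := sn_pos ha (h3.mono (by linarith))
  have sb : 0 < sn κ b := sn_pos hb (h3.mono (by linarith))
  unfold CC
  rw [div_le_one (mul_pos sa sb)]
  have := md_le (abs_nonneg _) h1 (h3.mono (by linarith [abs_sub_le a 0 b, abs_of_pos ha, abs_of_pos hb, abs_sub a b]))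
  rw [md_abs, md_sub] at this
  linarith

lemma neg_one_le_CC {κ a b c : ℝ} (ha : 0 < a) (hb : 0 < b) (h1 : |a - b| ≤ c) (h2 : c ≤ a + b)
    (h3 : Adm κ ((a + b + c) / 2)) : -1 ≤ CC κ a b c := by
  have h4 := abs_le.1 h1
  have sa : 0 < sn κ a := sn_pos ha (h3.mono (by linarith))
  have sb : 0 < sn κ b := sn_pos hb (h3.mono (by linarith))
  unfold CC
  rw [le_div_iff₀ (mul_pos sa sb)]
  have := md_le ((abs_nonneg _).trans h1) h2 (h3.mono (by linarith))
  rw [md_add] at this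
  linarith

/-- The point-on-side inequality -/
def Pos (κ a b U V W : ℝ) : Prop :=
  sn κ b * U + sn κ a * W ≤ sn κ (a + b) * V + sn κ b * md κ a + sn κ a * md κ b

lemma pos_line (κ a b c : ℝ) : sn κ b * md κ (c - a) + sn κ a * md κ (c + b)
    = sn κ (a + b) * md κ c + sn κ b * md κ a + sn κ a * md κ b := by
  rw [md_sub, md_add, sn_add]; unfold cs; ring

lemma Pos.symm {κ a b U V W : ℝ} (h : Pos κ a b U V W) : Pos κ b a W V U := by
  unfold Pos at *; rw [add_comm b a]; linarith

lemma pos_iff_sum {κ a b u h w : ℝ} (ha : 0 < sn κ a) (hb : 0 < sn κ b) (hh : 0 < sn κ h) :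
    Pos κ a b (md κ u) (md κ h) (md κ w) ↔ 0 ≤ CC κ a h u + CC κ b h w := by
  have e : CC κ a h u + CC κ b h w = (sn κ (a + b) * md κ h + sn κ b * md κ a + sn κ a * md κ b
      - (sn κ b * md κ u + sn κ a * md κ w)) / (sn κ a * sn κ b * sn κ h) := by
    unfold CC; rw [sn_add]; unfold cs; field_simp; ring
  rw [e, le_div_iff₀ (by positivity), zero_mul, sub_nonneg, Pos]

lemma pos_iff_mono {κ a b u h w : ℝ} (ha : 0 < sn κ a) (hab : 0 < sn κ (a + b)) (hu : 0 < sn κ u) :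
    Pos κ a b (md κ u) (md κ h) (md κ w) ↔ CC κ a u h ≤ CC κ (a + b) u w := by
  have e : CC κ (a + b) u w - CC κ a u h = (sn κ (a + b) * md κ h + sn κ b * md κ a
      + sn κ a * md κ b - (sn κ b * md κ u + sn κ a * md κ w)) / (sn κ a * sn κ (a + b) * sn κ u) := by
    have e1 : (md κ (a + b) + md κ u - κ * md κ (a + b) * md κ u - md κ w) * sn κ a
        - (md κ a + md κ u - κ * md κ a * md κ u - md κ h) * sn κ (a + b)
        = sn κ (a + b) * md κ h + sn κ b * md κ a
      + sn κ a * md κ b - (sn κ b * md κ u + sn κ a * md κ w) := by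
      rw [sn_add, md_add]; unfold cs
      linear_combination (sn κ b * (1 - κ * md κ u)) * sn_sq κ a
    rw [← e1]
    unfold CC
    field_simp
  rw [← sub_nonneg (b := CC κ a u h), e, le_div_iff₀ (by positivity), zero_mul, sub_nonneg, Pos]

/-- `S` satisfies the point-on-side comparison. -/
def PosDom {Y : Type*} [MetricSpace Y] (κ : ℝ) (S : Set Y) : Prop :=
  ∀ x ∈ S, ∀ m ∈ S, ∀ p ∈ S, ∀ q ∈ S, dist x m + dist m p = dist x p →
    Pos κ (dist x m) (dist m p) (md κ (dist x q)) (md κ (dist m q)) (md κ (dist p q))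

lemma adm_of_angleDefined {κ a b c : ℝ} : (0 < κ → a + b + c < 2 * Real.pi / Real.sqrt κ) ↔
    Adm κ ((a + b + c) / 2) := by
  refine forall_congr' fun h => ?_
  have := Real.sqrt_pos.2 h
  rw [lt_div_iff₀ this]
  constructor <;> intro h1 <;> linarith

lemma angleDefined_dist {Y : Type*} [MetricSpace Y] {κ : ℝ} {p x y : Y} (hx : x ≠ p) (hy : y ≠ p)
    (h : Adm κ ((dist p x + dist p y + dist x y) / 2)) :
    angleDefined κ (dist p x) (dist p y) (dist x y) := by
  refine ⟨dist_pos.2 hx.symm, dist_pos.2 hy.symm, ?_, ?_, adm_of_angleDefined.2 h⟩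
  · rw [dist_comm p x, dist_comm p y]; exact abs_dist_sub_le x y p
  · rw [dist_comm p x]; exact dist_triangle _ _ _

lemma CC_mem {Y : Type*} [MetricSpace Y] {κ : ℝ} {p x y : Y} (hx : x ≠ p) (hy : y ≠ p)
    (h : Adm κ ((dist p x + dist p y + dist x y) / 2)) :
    -1 ≤ CC κ (dist p x) (dist p y) (dist x y) ∧ CC κ (dist p x) (dist p y) (dist x y) ≤ 1 := by
  obtain ⟨h1, h2, h3, h4, h5⟩ := angleDefined_dist hx hy h
  exact ⟨neg_one_le_CC h1 h2 h3 h4 h, CC_le_one h1 h2 h3 h⟩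

/-- a small subset of a κ-domain satisfies the point-on-side comparison -/
lemma IsKappaDomain.posDom {Y : Type*} [MetricSpace Y] {κ : ℝ} {U S : Set Y}
    (hU : IsKappaDomain κ U) (hS : S ⊆ U) (r : ℝ) (hr : Adm κ (3 * r))
    (hd : ∀ x ∈ S, ∀ y ∈ S, dist x y ≤ 2 * r) : PosDom κ S := by
  intro x hx m hm p hp q hq hb
  by_cases hxm : x = m
  · subst hxm; simp [Pos]
  by_cases hpm : p = m
  · subst hpm; simp [Pos]
  by_cases hqm : q = m
  · subst hqm
    have := pos_line κ (dist x q) (dist q p) 0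
    simp only [Pos, dist_self, md_zero]
    rw [dist_comm p q]
    simp at this ⊢
  have ad : ∀ u ∈ S, ∀ v ∈ S, ∀ w ∈ S, Adm κ ((dist u v + dist u w + dist v w) / 2) :=
    fun u hu v hv w hw => hr.mono (by linarith [hd u hu v hv, hd u hu w hw, hd v hv w hw])
  have key := hU.2 m (hS hm) x (hS hx) p (hS hp) q (hS hq) hxm hpm hqm
    (angleDefined_dist hxm hpm (ad _ hm _ hx _ hp)) (angleDefined_dist hpm hqm (ad _ hm _ hp _ hq))
    (angleDefined_dist hqm hxm (ad _ hm _ hq _ hx))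
  have spos : ∀ u ∈ S, u ≠ m → 0 < sn κ (dist m u) := fun u hu hne =>
    sn_pos (dist_pos.2 hne.symm) ((ad _ hm _ hu _ hu).mono (by simp))
  simp only [compAngleAt, compAngle_eq] at key
  have c1 : CC κ (dist m x) (dist m p) (dist x p) = -1 := by
    unfold CC
    rw [div_eq_iff (mul_pos (spos x hx hxm) (spos p hp hpm)).ne', ← hb, dist_comm x m, md_add]
    ring
  rw [c1, Real.arccos_neg_one] at key
  obtain ⟨r1, r2⟩ := CC_mem hpm hqm (ad _ hm _ hp _ hq)
  obtain ⟨r3, r4⟩ := CC_mem hqm hxm (ad _ hm _ hq _ hx)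
  have key2 : Real.arccos (CC κ (dist m p) (dist m q) (dist p q)) ≤
      Real.arccos (-CC κ (dist m q) (dist m x) (dist q x)) := by
    rw [Real.arccos_neg]; linarith
  have key3 := Real.cos_le_cos_of_nonneg_of_le_pi (Real.arccos_nonneg _) (Real.arccos_le_pi _) key2
  rw [Real.cos_arccos r1 r2, Real.cos_arccos (by linarith) (by linarith)] at key3
  rw [dist_comm x m, pos_iff_sum (spos x hx hxm) (spos p hp hpm) (spos q hq hqm),
    CC_comm κ (dist m x), dist_comm x q]
  linarith


/-! ### Hinges -/
section hinges
variable {Y : Type*} [MetricSpace Y] {κ : ℝ}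

/-- point-on-side comparison for a point `m` between `x` and `p`, viewed from `q` -/
def PosAt (κ : ℝ) (x m p q : Y) : Prop :=
  Pos κ (dist x m) (dist m p) (md κ (dist x q)) (md κ (dist m q)) (md κ (dist p q))

/-- cosine of the comparison angle at `x` -/
noncomputable def CA (κ : ℝ) (x p q : Y) : ℝ := CC κ (dist x p) (dist x q) (dist p q)

lemma CA_comm (x p q : Y) : CA κ x p q = CA κ x q p := by
  unfold CA; rw [CC_comm, dist_comm p q]

lemma PosAt.symm {x m p q : Y} (h : PosAt κ x m p q) : PosAt κ p m x q := by
  unfold PosAt at *; rw [dist_comm p m, dist_comm m x]; exact Pos.symm h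

lemma posAt_iff_mono {x m p q : Y} (hb : dist x m + dist m p = dist x p) (hxm : m ≠ x)
    (hxq : q ≠ x) (h1 : Adm κ (dist x p)) (h2 : Adm κ (dist x q)) :
    PosAt κ x m p q ↔ CA κ x m q ≤ CA κ x p q := by
  have d1 := dist_pos.2 hxm.symm
  have d2 := dist_pos.2 hxq.symm
  have d3 := dist_nonneg (x := m) (y := p)
  unfold PosAt CA
  rw [pos_iff_mono (sn_pos d1 (h1.mono (by linarith))) (sn_pos (by linarith) (by rwa [hb]))
    (sn_pos d2 h2), hb]

lemma posAt_iff_sum {x m p q : Y} (hxm : x ≠ m) (hpm : p ≠ m) (hqm : q ≠ m)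
    (h1 : Adm κ (dist m x)) (h2 : Adm κ (dist m p)) (h3 : Adm κ (dist m q)) :
    PosAt κ x m p q ↔ 0 ≤ CA κ m x q + CA κ m p q := by
  unfold PosAt CA
  rw [dist_comm x m, pos_iff_sum (sn_pos (dist_pos.2 hxm.symm) h1) (sn_pos (dist_pos.2 hpm.symm) h2)
    (sn_pos (dist_pos.2 hqm.symm) h3)]

lemma posAt_self (x m p : Y) (hb : dist x m + dist m p = dist x p) (t : ℝ) (q : Y)
    (h1 : dist x q = |t - dist x m|) (h2 : dist m q = |t|) (h3 : dist p q = |t + dist m p|) :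
    PosAt κ x m p q := by
  unfold PosAt Pos
  rw [h1, h2, h3, md_abs, md_abs, md_abs, pos_line]

/-- lower bound for the cosine of the angle between two curves -/
def CosGE (κ : ℝ) (γ σ : ℝ → Y) (k : ℝ) : Prop :=
  ∀ k1 < k, ∃ T > 0, ∀ t s : ℝ, 0 < t → t < T → 0 < s → s < T → k1 < CC κ t s (dist (γ t) (σ s))

lemma CosGE.symm {γ σ : ℝ → Y} {k : ℝ} (h : CosGE κ γ σ k) : CosGE κ σ γ k := by
  intro k1 hk
  obtain ⟨T, hT, h1⟩ := h k1 hk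
  exact ⟨T, hT, fun t s a b c d => by rw [CC_comm, dist_comm]; exact h1 s t c d a b⟩

/-- hinge comparison -/
def HF (κ : ℝ) (γ σ : ℝ → Y) (x p q : Y) : Prop := ∀ k, CosGE κ γ σ k → k ≤ CA κ x p q

lemma HF.symm {γ σ : ℝ → Y} {x p q : Y} (h : HF κ γ σ x p q) : HF κ σ γ x q p := by
  intro k hk; rw [CA_comm]; exact h k hk.symm

lemma IsUnitSpeedOn.dist_zero {γ : ℝ → Y} {T : ℝ} (h : IsUnitSpeedOn γ T) {x : Y} (h0 : γ 0 = x)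
    {t : ℝ} (h1 : 0 ≤ t) (h2 : t ≤ T) : dist x (γ t) = t := by
  rw [← h0, h 0 ⟨le_rfl, by linarith⟩ t ⟨h1, h2⟩, zero_sub, abs_neg, abs_of_nonneg h1]

lemma IsUnitSpeedOn.dist_le {γ : ℝ → Y} {T : ℝ} (h : IsUnitSpeedOn γ T)
    {s t : ℝ} (h1 : 0 ≤ s) (h3 : s ≤ t) (h2 : t ≤ T) : dist (γ s) (γ t) = t - s := by
  rw [h s ⟨h1, by linarith⟩ t ⟨by linarith, h2⟩, abs_sub_comm, abs_of_nonneg (by linarith)]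

lemma local_mono1 {S : Set Y} (hS : PosDom κ S) {γ : ℝ → Y} {x q : Y} {a : ℝ}
    (hγ : IsUnitSpeedOn γ a) (h0 : γ 0 = x) (hm : ∀ t ∈ Set.Icc 0 a, γ t ∈ S) (ha : Adm κ a)
    (hq : q ∈ S) (hqx : q ≠ x) (hq2 : Adm κ (dist x q)) {t t' : ℝ} (h1 : 0 < t) (h2 : t ≤ t')
    (h3 : t' ≤ a) : CC κ t (dist x q) (dist (γ t) q) ≤ CC κ t' (dist x q) (dist (γ t') q) := by
  have e1 : dist x (γ t) = t := hγ.dist_zero h0 h1.le (by linarith)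
  have e2 : dist x (γ t') = t' := hγ.dist_zero h0 (by linarith) h3
  have e3 : dist (γ t) (γ t') = t' - t := hγ.dist_le h1.le h2 h3
  have hb : dist x (γ t) + dist (γ t) (γ t') = dist x (γ t') := by rw [e1, e2, e3]; ring
  have := (posAt_iff_mono (κ := κ) (q := q) hb (by intro h; rw [h, dist_self] at e1; linarith) hqx
    (by rw [e2]; exact ha.mono h3) hq2).1
    (hS x (h0 ▸ hm 0 ⟨le_rfl, by linarith⟩) _ (hm t ⟨h1.le, by linarith⟩) _
      (hm t' ⟨by linarith, h3⟩) q hq hb)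
  unfold CA at this
  rwa [e1, e2] at this

lemma local_mono {S : Set Y} (hS : PosDom κ S) {γ σ : ℝ → Y} {x : Y} {a b : ℝ}
    (hγ : IsUnitSpeedOn γ a) (h0 : γ 0 = x) (hm : ∀ t ∈ Set.Icc 0 a, γ t ∈ S) (ha : Adm κ a)
    (hσ : IsUnitSpeedOn σ b) (h0' : σ 0 = x) (hm' : ∀ t ∈ Set.Icc 0 b, σ t ∈ S) (hb : Adm κ b)
    {t t' s s' : ℝ} (h1 : 0 < t) (h2 : t ≤ t')
    (h3 : t' ≤ a) (g1 : 0 < s) (g2 : s ≤ s') (g3 : s' ≤ b) :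
    CC κ t s (dist (γ t) (σ s)) ≤ CC κ t' s' (dist (γ t') (σ s')) := by
  have e1 : dist x (σ s) = s := hσ.dist_zero h0' g1.le (by linarith)
  have e2 : dist x (γ t') = t' := hγ.dist_zero h0 (by linarith) h3
  have n1 : σ s ≠ x := by intro h; rw [h, dist_self] at e1; linarith
  have n2 : γ t' ≠ x := by intro h; rw [h, dist_self] at e2; linarith
  have l1 := local_mono1 hS hγ h0 hm ha (hm' s ⟨g1.le, by linarith⟩) n1
    (by rw [e1]; exact hb.mono (by linarith)) h1 h2 h3
  have l2 := local_mono1 hS hσ h0' hm' hb (hm t' ⟨by linarith, h3⟩) n2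
    (by rw [e2]; exact ha.mono (by linarith)) g1 g2 g3
  rw [e1] at l1; rw [e2] at l2
  rw [CC_comm, dist_comm] at l2
  refine l1.trans (l2.trans (le_of_eq ?_))
  rw [CC_comm, dist_comm]

lemma geod_ball {γ : ℝ → Y} {x : Y} {a r : ℝ} (hγ : IsUnitSpeedOn γ a) (h0 : γ 0 = x) (har : a < r) :
    ∀ t ∈ Set.Icc 0 a, γ t ∈ Metric.ball x r := by
  intro t ht
  rw [Metric.mem_ball', hγ.dist_zero h0 ht.1 ht.2]; linarith [ht.2]

lemma local_HF {S : Set Y} (hS : PosDom κ S) {γ σ : ℝ → Y} {x p q : Y}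
    (hγ : IsGeodesicFromTo x p γ) (hσ : IsGeodesicFromTo x q σ)
    (hm : ∀ t ∈ Set.Icc 0 (dist x p), γ t ∈ S) (hm' : ∀ t ∈ Set.Icc 0 (dist x q), σ t ∈ S)
    (ha : Adm κ (dist x p)) (hb : Adm κ (dist x q))
    (hp : p ≠ x) (hq : q ≠ x) : HF κ γ σ x p q := by
  intro k hk
  by_contra! hlt
  have d1 := dist_pos.2 hp.symm
  have d2 := dist_pos.2 hq.symm
  obtain ⟨T, hT, h⟩ := hk _ hlt
  have m0 : 0 < min (T / 2) (min (dist x p) (dist x q)) := by positivity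
  set t := min (T / 2) (min (dist x p) (dist x q)) with ht
  have m1 : t ≤ T / 2 := min_le_left _ _
  have m2 : t ≤ dist x p := (min_le_right _ _).trans (min_le_left _ _)
  have m3 : t ≤ dist x q := (min_le_right _ _).trans (min_le_right _ _)
  have l1 := h t t m0 (by linarith) m0 (by linarith)
  have l2 := local_mono hS hγ.2.2 hγ.1 hm ha hσ.2.2 hσ.1 hm' hb m0 m2 le_rfl m0 m3 le_rfl
  rw [hγ.2.1, hσ.2.1] at l2
  unfold CA at l1
  linarith

lemma local_HF_ball {r : ℝ} {γ σ : ℝ → Y} {x p q : Y} (hS : PosDom κ (Metric.ball x r))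
    (hγ : IsGeodesicFromTo x p γ) (hσ : IsGeodesicFromTo x q σ) (hr : Adm κ r)
    (hpr : dist x p < r) (hqr : dist x q < r)
    (hp : p ≠ x) (hq : q ≠ x) : HF κ γ σ x p q :=
  local_HF hS hγ hσ (geod_ball hγ.2.2 hγ.1 hpr) (geod_ball hσ.2.2 hσ.1 hqr)
    (hr.mono hpr.le) (hr.mono hqr.le) hp hq

/-- passing to the adjacent angle -/
lemma opp {r a' : ℝ} {γ σ γ' : ℝ → Y} {x p q : Y} (hr0 : 0 < r) (hr : Adm κ r)
    (hS : PosDom κ (Metric.ball x r)) (hγ : IsGeodesicFromTo x p γ) (hσ : IsGeodesicFromTo x q σ)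
    (hp : p ≠ x) (hq : q ≠ x) (ha' : 0 < a') (hγ' : ∀ t ∈ Set.Icc 0 a', dist x (γ' t) = t)
    (hopp : ∀ t ∈ Set.Icc 0 (dist x p), ∀ s ∈ Set.Icc 0 a', dist (γ t) (γ' s) = t + s)
    (hHF : HF κ γ σ x p q) : CosGE κ γ' σ (-CA κ x p q) := by
  intro k1 hk1
  have d1 := dist_pos.2 hp.symm
  have d2 := dist_pos.2 hq.symm
  have hn : ¬ CosGE κ γ σ (-k1) := fun h => by have := hHF _ h; linarith
  unfold CosGE at hn
  push Not at hn
  obtain ⟨k2, hk2, h2⟩ := hn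
  obtain ⟨t0, s0, ht0, ht0', hs0, hs0', hle⟩ := h2
    (min (min (dist x p) (dist x q)) (min (r / 2) a')) (by positivity)
  simp only [lt_min_iff] at ht0' hs0'
  obtain ⟨⟨q1, q2⟩, q3, q4⟩ := ht0'
  obtain ⟨⟨w1, w2⟩, w3, w4⟩ := hs0'
  have uγ : IsUnitSpeedOn γ t0 := fun s hs t ht =>
    hγ.2.2 s ⟨hs.1, by linarith [hs.2]⟩ t ⟨ht.1, by linarith [ht.2]⟩
  have uσ : IsUnitSpeedOn σ s0 := fun s hs t ht =>
    hσ.2.2 s ⟨hs.1, by linarith [hs.2]⟩ t ⟨ht.1, by linarith [ht.2]⟩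
  have bγ := geod_ball (r := r) uγ hγ.1 (by linarith)
  have bσ := geod_ball (r := r) uσ hσ.1 (by linarith)
  refine ⟨min t0 s0, by positivity, fun t s ht htT hs hsT => ?_⟩
  rw [lt_min_iff] at htT hsT
  have l1 := local_mono hS uγ hγ.1 bγ (hr.mono (by linarith)) uσ hσ.1 bσ (hr.mono (by linarith))
    ht htT.1.le le_rfl hs hsT.2.le le_rfl
  have e1 : dist x (γ t) = t := uγ.dist_zero hγ.1 ht.le htT.1.le
  have e2 : dist x (σ s) = s := uσ.dist_zero hσ.1 hs.le hsT.2.le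
  have e3 : dist x (γ' t) = t := hγ' t ⟨ht.le, by linarith⟩
  have e4 : dist (γ t) (γ' t) = t + t := hopp t ⟨ht.le, by linarith⟩ t ⟨ht.le, by linarith⟩
  have ne : ∀ y : Y, ∀ c : ℝ, 0 < c → dist x y = c → y ≠ x := by
    intro y c hc h1 h; rw [h, dist_self] at h1; linarith
  have P := hS (γ t) (by rw [Metric.mem_ball', e1]; linarith) x (Metric.mem_ball_self hr0) (γ' t)
    (by rw [Metric.mem_ball', e3]; linarith) (σ s) (by rw [Metric.mem_ball', e2]; linarith)
    (by rw [dist_comm, e1, e3, e4])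
  have P2 := (posAt_iff_sum (κ := κ) (ne _ _ ht e1) (ne _ _ ht e3) (ne _ _ hs e2)
    (hr.mono (by rw [e1]; linarith)) (hr.mono (by rw [e3]; linarith))
    (hr.mono (by rw [e2]; linarith))).1 P
  unfold CA at P2
  rw [e1, e2, e3] at P2
  linarith

end hinges


/-! ### The thin hinge theorem -/
section thin
variable {Y : Type*} [MetricSpace Y] {κ : ℝ}

/-- the chain through `p, x, q` (in either order) from `X` to `P` has length at most `D` -/
def Chain (X P : Y) (D : ℝ) (p x q : Y) : Prop :=
  dist X p + dist p x + dist x q + dist q P ≤ D ∨ dist X q + dist q x + dist x p + dist p P ≤ D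

lemma Chain.symm {X P : Y} {D : ℝ} {p x q : Y} (h : Chain X P D p x q) : Chain X P D q x p :=
  Or.symm h

lemma Chain.mono {X P : Y} {D D' : ℝ} {p x q : Y} (h : Chain X P D p x q) (hD : D ≤ D') :
    Chain X P D' p x q := h.imp (fun h => h.trans hD) (fun h => h.trans hD)

lemma Chain.mid {X P : Y} {D : ℝ} {p x q : Y} (h : Chain X P D p x q) :
    dist X x + dist x P ≤ D := by
  have h1 := dist_triangle X p x
  have h2 := dist_triangle x q P
  have h3 := dist_triangle X q x
  have h4 := dist_triangle x p P
  rcases h with h | h <;> linarith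

/-- hinge comparison for thin hinges with total length `< ℓ` -/
def KK (κ : ℝ) (X P : Y) (ℓ D : ℝ) : Prop :=
  ∀ (x p q : Y) (γ σ : ℝ → Y), p ≠ x → q ≠ x → Chain X P D p x q → dist p x + dist x q < ℓ →
    IsGeodesicFromTo x p γ → IsGeodesicFromTo x q σ → HF κ γ σ x p q

/-- the squared side (modified) of the model hinge -/
noncomputable def mh (κ a b k : ℝ) : ℝ := md κ a + md κ b - κ * md κ a * md κ b - k * (sn κ a * sn κ b)

lemma geod_sub {x p : Y} {γ : ℝ → Y} (h : IsGeodesicFromTo x p γ) {t : ℝ} (h0 : 0 ≤ t)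
    (h1 : t ≤ dist x p) : IsGeodesicFromTo x (γ t) γ := by
  have e := h.2.2.dist_zero h.1 h0 h1
  refine ⟨h.1, by rw [e], fun s hs u hu => ?_⟩
  rw [e] at hs hu
  exact h.2.2 s ⟨hs.1, hs.2.trans h1⟩ u ⟨hu.1, hu.2.trans h1⟩

lemma geod_tail {x p : Y} {γ : ℝ → Y} (h : IsGeodesicFromTo x p γ) {t : ℝ} (h0 : 0 ≤ t)
    (h1 : t ≤ dist x p) : IsGeodesicFromTo (γ t) p (fun s => γ (t + s)) := by
  have e : dist (γ t) p = dist x p - t := by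
    rw [← h.2.2.dist_le h0 h1 le_rfl, h.2.1]
  refine ⟨by simp, by rw [e]; simp [h.2.1], fun s hs u hu => ?_⟩
  rw [e] at hs hu
  rw [h.2.2 (t + s) ⟨by linarith [hs.1], by linarith [hs.2]⟩ (t + u)
    ⟨by linarith [hu.1], by linarith [hu.2]⟩]
  congr 1; ring

lemma geod_rev {x p : Y} {γ : ℝ → Y} (h : IsGeodesicFromTo x p γ) {t : ℝ} (h0 : 0 ≤ t)
    (h1 : t ≤ dist x p) : IsGeodesicFromTo (γ t) x (fun s => γ (t - s)) := by
  have e : dist (γ t) x = t := by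
    rw [dist_comm]; exact h.2.2.dist_zero h.1 h0 h1
  refine ⟨by simp, by rw [e]; simp [h.1], fun s hs u hu => ?_⟩
  rw [e] at hs hu
  rw [h.2.2 (t - s) ⟨by linarith [hs.2], by linarith [hs.1]⟩ (t - u)
    ⟨by linarith [hu.2], by linarith [hu.1]⟩, abs_sub_comm]
  congr 1; ring

lemma geod_opp {x p : Y} {γ : ℝ → Y} (h : IsGeodesicFromTo x p γ) {t s u : ℝ}
    (h0 : 0 ≤ s) (h1 : s ≤ t) (h2 : 0 ≤ u) (h3 : t + u ≤ dist x p) :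
    dist (γ (t - s)) (γ (t + u)) = s + u := by
  rw [h.2.2.dist_le (by linarith) (by linarith) h3]; ring

lemma mh_step {κ a' e b b' k : ℝ} (se : 0 < sn κ e) (sb : 0 < sn κ b) (sb' : 0 < sn κ b')
    (sa : 0 ≤ sn κ (a' + e)) (hk : k ≤ CC κ e b b') :
    mh κ a' b' (-CC κ e b' b) ≤ mh κ (a' + e) b k := by
  have h1 := CC_mul (c := b) se sb'
  have h2 := CC_mul (c := b') se sb
  have h3 : k * (sn κ (a' + e) * sn κ b) ≤ CC κ e b b' * (sn κ (a' + e) * sn κ b) :=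
    mul_le_mul_of_nonneg_right hk (mul_nonneg sa sb.le)
  have h4 : mh κ a' b' (-CC κ e b' b) * sn κ e = mh κ (a' + e) b (CC κ e b b') * sn κ e := by
    unfold mh
    have e1 : CC κ e b' b * (sn κ a' * sn κ b') * sn κ e
      = sn κ a' * (md κ e + md κ b' - κ * md κ e * md κ b' - md κ b) := by rw [← h1]; ring
    have e2 : CC κ e b b' * (sn κ (a' + e) * sn κ b) * sn κ e
      = sn κ (a' + e) * (md κ e + md κ b - κ * md κ e * md κ b - md κ b') := by rw [← h2]; ring
    have l : (md κ a' + md κ b' - κ * md κ a' * md κ b' - -CC κ e b' b * (sn κ a' * sn κ b')) * sn κ e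
       = (md κ a' + md κ b' - κ * md κ a' * md κ b') * sn κ e
        + sn κ a' * (md κ e + md κ b' - κ * md κ e * md κ b' - md κ b) := by rw [← e1]; ring
    have l2 : (md κ (a' + e) + md κ b - κ * md κ (a' + e) * md κ b - CC κ e b b' * (sn κ (a' + e) * sn κ b)) * sn κ e
       = (md κ (a' + e) + md κ b - κ * md κ (a' + e) * md κ b) * sn κ e
        - sn κ (a' + e) * (md κ e + md κ b - κ * md κ e * md κ b - md κ b') := by rw [← e2]; ring
    rw [l, l2, sn_add, md_add]; unfold cs
    linear_combination (sn κ a' * (κ * md κ b - 1)) * sn_sq κ e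
  have h5 := mul_right_cancel₀ se.ne' h4
  unfold mh at *
  linarith

lemma mh_bound {κ a e b b' k : ℝ} (se : 0 < sn κ e) (sb : 0 < sn κ b)
    (sa : 0 ≤ sn κ a) (hk : k ≤ CC κ e b b') :
    md κ (a + b) - sn κ a / sn κ e * (md κ (e + b) - md κ b') ≤ mh κ a b k := by
  have h2 := CC_mul (c := b') se sb
  have h3 : k * (sn κ a * sn κ b) ≤ CC κ e b b' * (sn κ a * sn κ b) :=
    mul_le_mul_of_nonneg_right hk (mul_nonneg sa sb.le)
  have h4 : sn κ a / sn κ e * (md κ (e + b) - md κ b') = (1 + CC κ e b b') * (sn κ a * sn κ b) := by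
    have : md κ (e + b) - md κ b' = (1 + CC κ e b b') * (sn κ e * sn κ b) := by
      rw [md_add, add_mul, h2]; ring
    rw [this]; field_simp
  rw [h4, md_add]; unfold mh; linarith

end thin


section thin2
variable {Y : Type*} [MetricSpace Y] {κ : ℝ}

lemma ne_of_dist_eq {x y : Y} {c : ℝ} (h : dist x y = c) (hc : 0 < c) : y ≠ x := by
  intro h1; rw [h1, dist_self] at h; linarith

lemma CC_sum_le {κ a b u w : ℝ} (sa : 0 < sn κ a) (sb : 0 < sn κ b)
    (h : 0 ≤ CC κ a b u + CC κ a b w) : md κ u + md κ w ≤ md κ (a + b) + md κ (b - a) := by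
  have h1 := CC_mul (c := u) sa sb
  have h2 := CC_mul (c := w) sa sb
  have h3 : 0 ≤ (CC κ a b u + CC κ a b w) * (sn κ a * sn κ b) := by positivity
  rw [md_add, md_sub]
  linarith

lemma typeII (hgeo : IsGeodesicSpace Y) {X P : Y} {e ℓ δ δ' : ℝ} (he : 0 < e)
    (hadm : Adm κ (20 * e))
    (hreg : ∀ z, dist X z + dist z P ≤ dist X P + δ → PosDom κ (Metric.ball z (20 * e)))
    (hK : KK κ X P ℓ (dist X P + δ)) (hℓ : 20 * e ≤ ℓ) (hδ' : 0 < δ') (hδδ : δ' ≤ δ / 2)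
    (hδe : δ ≤ e)
    (hsmall : md κ (4 * e) - md κ (4 * e - δ') < md κ (2 * e + δ / 2) - md κ (2 * e))
    {x p q : Y} {γ σ' : ℝ → Y} (hγ : IsGeodesicFromTo x p γ) (hq : q ≠ x)
    (hch : Chain X P (dist X P + δ') p x q) (hle : dist x q ≤ dist x p)
    (hs1 : ℓ ≤ dist p x + dist x q) (hs2 : dist p x + dist x q < ℓ + e)
    (hadms : Adm κ (dist p x + dist x q)) (hne : q ≠ γ e)
    (hσ : IsGeodesicFromTo (γ e) q σ') : HF κ (fun t => γ (e - t)) σ' (γ e) x q := by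
  have hxp : 10 * e ≤ dist x p := by rw [dist_comm p x] at hs1; linarith
  have ex' : dist x (γ e) = e := hγ.2.2.dist_zero hγ.1 he.le (by linarith)
  have ex'p : dist (γ e) p = dist x p - e := by
    have := hγ.2.2.dist_le he.le (by linarith : e ≤ dist x p) le_rfl
    rwa [hγ.2.1] at this
  set x' := γ e with hx'
  have hxx' : x ≠ x' := (ne_of_dist_eq ex' he).symm
  have regx' : PosDom κ (Metric.ball x' (20 * e)) := by
    apply hreg
    have t1 := dist_triangle X p x'
    have t2 := dist_triangle x' x P
    have t3 := dist_triangle x q P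
    have t4 := dist_triangle X x x'
    have t5 := dist_triangle X q x
    have t6 := dist_triangle x' p P
    rcases hch with h | h
    · rw [dist_comm p x'] at t1
      rw [dist_comm x' x] at t2
      rw [dist_comm p x] at h
      linarith
    · linarith
  have hrev : IsGeodesicFromTo x' x (fun t => γ (e - t)) := geod_rev hγ he.le (by linarith)
  have trq : dist x' q ≤ e + dist x q := by
    have := dist_triangle x' x q; rw [dist_comm x' x, ex'] at this; exact this
  by_cases hcase : dist x q < 5 * e
  · exact local_HF_ball regx' hrev hσ hadm (by rw [dist_comm, ex']; linarith) (by linarith) hxx' hne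
  push Not at hcase
  have hx'q : 4 * e ≤ dist x' q := by
    have := dist_triangle x x' q; linarith
  -- the auxiliary point q1
  have eq1 : dist x' (σ' (3 * e)) = 3 * e := hσ.2.2.dist_zero hσ.1 (by linarith) (by linarith)
  have eq1q : dist (σ' (3 * e)) q = dist x' q - 3 * e := by
    have := hσ.2.2.dist_le (by linarith : 0 ≤ 3 * e) (by linarith : 3 * e ≤ dist x' q) le_rfl
    rwa [hσ.2.1] at this
  have tailq := geod_tail hσ (by linarith : 0 ≤ 3 * e) (by linarith : 3 * e ≤ dist x' q)
  have revq := geod_rev hσ (by linarith : 0 ≤ 3 * e) (by linarith : 3 * e ≤ dist x' q)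
  have subq := geod_sub hσ (by linarith : 0 ≤ 3 * e) (by linarith : 3 * e ≤ dist x' q)
  have oppq : ∀ t ∈ Set.Icc 0 (dist (σ' (3 * e)) q), ∀ s ∈ Set.Icc 0 (3 * e),
      dist (σ' (3 * e + t)) (σ' (3 * e - s)) = t + s := by
    intro t ht s hs
    rw [dist_comm, geod_opp hσ hs.1 hs.2 ht.1 (by linarith [ht.2])]; ring
  set q1 := σ' (3 * e) with hq1
  have ep1 : dist x' (γ (e + e)) = e := by
    rw [hx', hγ.2.2.dist_le he.le (by linarith) (by linarith)]; ring
  have exp1 : dist x (γ (e + e)) = e + e := hγ.2.2.dist_zero hγ.1 (by linarith) (by linarith)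
  have ep1p : dist (γ (e + e)) p = dist x p - (e + e) := by
    have := hγ.2.2.dist_le (by linarith : 0 ≤ e + e) (by linarith : e + e ≤ dist x p) le_rfl
    rwa [hγ.2.1] at this
  set p1 := γ (e + e) with hp1
  have hexc : 4 * e - δ' ≤ dist p1 q1 := by
    have t1 := dist_triangle X p p1
    have t2 := dist_triangle p1 q1 P
    have t3 := dist_triangle X p1 P
    have t4 := dist_triangle q1 q P
    have t5 := dist_triangle X q q1
    have t6 := dist_triangle X q1 p1
    have t7 := dist_triangle p1 p P
    rw [dist_comm p p1] at t1
    rcases hch with h | h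
    · rw [dist_comm p x] at h
      linarith
    · rw [dist_comm q q1] at t5
      rw [dist_comm q1 p1] at t6
      rw [dist_comm q x] at h
      linarith
  have hexc2 : dist p1 q1 ≤ 4 * e := by
    have := dist_triangle p1 x' q1
    rw [dist_comm p1 x'] at this; linarith
  have txq1 : 2 * e ≤ dist x q1 := by
    have := dist_triangle x' x q1; rw [dist_comm x' x] at this; linarith
  have txq2 : dist x q1 ≤ 4 * e := by
    have := dist_triangle x x' q1; linarith
  have pos1 : PosAt κ p1 x' x q1 := by
    refine regx' p1 ?_ x' ?_ x ?_ q1 ?_ ?_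
    · rw [Metric.mem_ball']; linarith
    · exact Metric.mem_ball_self (by linarith)
    · rw [Metric.mem_ball', dist_comm]; linarith
    · rw [Metric.mem_ball']; linarith
    · rw [dist_comm p1, dist_comm x' x, dist_comm p1 x]; linarith
  have s1 := (posAt_iff_sum (κ := κ) (ne_of_dist_eq ep1 he) hxx'
    (ne_of_dist_eq eq1 (by linarith)) (hadm.mono (by linarith))
    (hadm.mono (by rw [dist_comm]; linarith)) (hadm.mono (by linarith))).1 pos1
  unfold CA at s1
  rw [dist_comm x' x, ex', ep1, eq1] at s1
  have s2 := CC_sum_le (sn_pos he (hadm.mono (by linarith)))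
    (sn_pos (by linarith) (hadm.mono (by linarith))) s1
  rw [show e + 3 * e = 4 * e by ring, show 3 * e - e = 2 * e by ring] at s2
  have s3 := md_le (by linarith : 0 ≤ 4 * e - δ') hexc (hadm.mono (by linarith))
  have hw : dist x q1 < 2 * e + δ / 2 := by
    by_contra! hcon
    have := md_le (by linarith : 0 ≤ 2 * e + δ / 2) hcon (hadm.mono (by linarith))
    linarith
  have chq1 : Chain X P (dist X P + δ) x q1 q := by
    have t1 := dist_triangle X p x
    have t2 := dist_triangle x p P
    rcases hch with h | h
    · left; linarith
    · right
      rw [dist_comm q q1, dist_comm q1 x]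
      rw [dist_comm q x] at h
      linarith
  have regq1 := hreg q1 chq1.mid
  obtain ⟨τ, hτ⟩ := hgeo q1 x
  have nqq1 : q ≠ q1 := (ne_of_dist_eq eq1q (by linarith))
  have nxq1 : x ≠ q1 := (ne_of_dist_eq (x := q1) (y := x) rfl (by rw [dist_comm]; linarith))
  have nx'q1 : x' ≠ q1 := (ne_of_dist_eq eq1 (by linarith)).symm
  have hx0 : 0 < dist q1 x := dist_pos.2 nxq1.symm
  have H1 := hK q1 q x _ τ nqq1 nxq1 chq1.symm
    (by rw [dist_comm q q1, dist_comm q1 x]; rw [dist_comm p x] at hs2; linarith) tailq hτ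
  have H2 := opp (by linarith) hadm regq1 tailq hτ nqq1 nxq1 (by linarith : 0 < 3 * e)
    (γ' := fun s => σ' (3 * e - s))
    (fun t ht => by
      have : dist q1 x' = 3 * e := by rw [dist_comm]; exact eq1
      exact revq.2.2.dist_zero revq.1 ht.1 (by linarith [ht.2])) oppq H1
  have H3 := local_HF_ball regq1 revq hτ hadm (by rw [dist_comm]; linarith)
    (by rw [dist_comm]; linarith) nx'q1 nxq1 _ H2
  have aq1q : Adm κ (dist x' q) := hadms.mono (by rw [dist_comm p x]; linarith)
  have pos2 : PosAt κ x' q1 q x := by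
    refine (posAt_iff_sum nx'q1 nqq1 nxq1 (hadm.mono (by rw [dist_comm]; linarith))
      (aq1q.mono (by linarith)) (hadm.mono (by rw [dist_comm]; linarith))).2 (by linarith)
  have H4 := (posAt_iff_mono (by linarith) nx'q1.symm hxx' aq1q
    (hadm.mono (by rw [dist_comm]; linarith))).1 pos2
  intro k hk
  have H5 := local_HF_ball regx' hrev subq hadm (by rw [dist_comm]; linarith)
    (by linarith) hxx' nx'q1.symm k hk
  rw [CA_comm] at H5 ⊢
  exact H5.trans H4

/-- admissible states of the telescoping procedure, with total length `s` -/
def St (κ : ℝ) (X P : Y) (D ℓ' : ℝ) (p q : Y) (m s : ℝ) : Prop :=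
  ∃ (x : Y) (γ σ : ℝ → Y) (k : ℝ), p ≠ x ∧ q ≠ x ∧ Chain X P D p x q ∧ IsGeodesicFromTo x p γ ∧
    IsGeodesicFromTo x q σ ∧ CosGE κ γ σ k ∧ mh κ (dist x p) (dist x q) k ≤ m ∧
    dist x p + dist x q = s ∧ s < ℓ'

lemma mh_comm (κ a b k : ℝ) : mh κ a b k = mh κ b a k := by unfold mh; ring

lemma St.symm {X P : Y} {D ℓ' : ℝ} {p q : Y} {m s : ℝ} (h : St κ X P D ℓ' p q m s) :
    St κ X P D ℓ' q p m s := by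
  obtain ⟨x, γ, σ, k, h1, h2, h3, h4, h5, h6, h7, h8, h9⟩ := h
  exact ⟨x, σ, γ, k, h2, h1, h3.symm, h5, h4, h6.symm, by rwa [mh_comm], by rwa [add_comm], h9⟩

lemma succ_state1 (hgeo : IsGeodesicSpace Y) {X P : Y} {e ℓ δ δ' ℓ' : ℝ} (he : 0 < e)
    (hadm : Adm κ (20 * e))
    (hreg : ∀ z, dist X z + dist z P ≤ dist X P + δ → PosDom κ (Metric.ball z (20 * e)))
    (hK : KK κ X P ℓ (dist X P + δ)) (hℓ : 20 * e ≤ ℓ) (hδ' : 0 < δ') (hδδ : δ' ≤ δ / 2)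
    (hδe : δ ≤ e) (hℓ' : ℓ' ≤ ℓ + e) (hadml : ∀ s < ℓ', Adm κ s)
    (hsmall : md κ (4 * e) - md κ (4 * e - δ') < md κ (2 * e + δ / 2) - md κ (2 * e))
    {x p q : Y} {γ σ : ℝ → Y} {k m s : ℝ} (hp : p ≠ x) (hq : q ≠ x)
    (hch : Chain X P (dist X P + δ') p x q) (hγ : IsGeodesicFromTo x p γ)
    (hσ : IsGeodesicFromTo x q σ) (hk : CosGE κ γ σ k)
    (hm : mh κ (dist x p) (dist x q) k ≤ m) (hs : dist x p + dist x q = s)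
    (hsℓ' : s < ℓ') (hsℓ : ℓ ≤ s) (hle : dist x q ≤ dist x p) :
    md κ (dist p q) ≤ m ∨ ∃ s', St κ X P (dist X P + δ') ℓ' p q m s' ∧ ∃ a b b', 0 ≤ a ∧ a ≤ ℓ' ∧
      0 ≤ b ∧ b ≤ ℓ' ∧ 0 ≤ b' ∧ b' ≤ e + b ∧ s - s' = e + b - b' ∧
      md κ (dist p q) ≤ m + sn κ a / sn κ e * (md κ (e + b) - md κ b') := by
  have hxp : 10 * e ≤ dist x p := by linarith
  have dq := dist_pos.2 hq.symm
  have ex' : dist x (γ e) = e := hγ.2.2.dist_zero hγ.1 he.le (by linarith)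
  have ex'p : dist (γ e) p = dist x p - e := by
    have := hγ.2.2.dist_le he.le (by linarith : e ≤ dist x p) le_rfl
    rwa [hγ.2.1] at this
  have as := hadml s hsℓ'
  have sube := geod_sub hγ he.le (by linarith)
  have taile := geod_tail hγ he.le (by linarith)
  have reve := geod_rev hγ he.le (by linarith)
  have oppe : ∀ t ∈ Set.Icc 0 e, ∀ u ∈ Set.Icc 0 (dist x p - e),
      dist (γ (e - t)) (γ (e + u)) = t + u := by
    intro t ht u hu
    exact geod_opp hγ ht.1 ht.2 hu.1 (by linarith [hu.2])
  have tII := fun σ' => typeII (σ' := σ') hgeo he hadm hreg hK hℓ hδ' hδδ hδe hsmall hγ hq hch hle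
    (by rw [dist_comm p x]; linarith) (by rw [dist_comm p x]; linarith)
    (as.mono (by rw [dist_comm p x]; linarith))
  set x' := γ e with hx'
  have hxx' : x' ≠ x := ne_of_dist_eq ex' he
  have chx : Chain X P (dist X P + δ) x' x q := by
    have t1 := dist_triangle X p x'
    have t2 := dist_triangle x' p P
    rw [dist_comm p x'] at t1
    rcases hch with h | h
    · left
      rw [dist_comm x' x]; rw [dist_comm p x] at h
      linarith
    · right
      linarith
  have hk1 := hK x x' q γ σ hxx' hq chx (by rw [dist_comm x' x]; linarith) sube hσ k hk
  unfold CA at hk1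
  rw [ex'] at hk1
  have se : 0 < sn κ e := sn_pos he (hadm.mono (by linarith))
  have sb : 0 < sn κ (dist x q) := sn_pos dq (as.mono (by linarith))
  have sa : 0 < sn κ (dist x p) := sn_pos (by linarith) (as.mono (by linarith))
  have bd := mh_bound se sb sa.le hk1
  have mdl : md κ (dist p q) ≤ md κ (dist x p + dist x q) := by
    have := dist_triangle p x q
    rw [dist_comm p x] at this
    exact md_le dist_nonneg this (as.mono (by linarith))
  have trq : dist x' q ≤ e + dist x q := by
    have := dist_triangle x' x q; rw [dist_comm x' x, ex'] at this; exact this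
  by_cases hne : q = x'
  · left
    rw [← hne] at ex' ex'p hk1
    rw [ex', dist_self] at hk1
    have : CC κ e e 0 = 1 := by
      unfold CC; rw [md_zero, div_eq_one_iff_eq (by positivity)]; linear_combination - sn_sq κ e
    rw [this] at hk1
    have h3 : k * (sn κ (dist x p) * sn κ (dist x q)) ≤ 1 * (sn κ (dist x p) * sn κ (dist x q)) :=
      mul_le_mul_of_nonneg_right hk1 (mul_nonneg sa.le sb.le)
    rw [dist_comm p q, ex'p, ← ex', md_sub]
    unfold mh at hm
    linarith
  right
  obtain ⟨σ', hσ'⟩ := hgeo x' q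
  have H := tII σ' hne hσ'
  have regx' : PosDom κ (Metric.ball x' (20 * e)) := hreg _ (by
    have t0 := dist_triangle X x x'
    have t1 := dist_triangle x' p P
    have t2 := dist_triangle X p x'
    have t3 := dist_triangle x' x P
    have t4 := dist_triangle x q P
    have t5 := dist_triangle X q x
    rcases hch with h | h
    · rw [dist_comm p x'] at t2
      rw [dist_comm x' x] at t3
      rw [dist_comm p x] at h
      linarith
    · linarith)
  have ce := opp (by linarith) hadm regx' reve hσ' hxx'.symm hne
    (by linarith : 0 < dist x p - e) (γ' := fun t => γ (e + t))
    (fun t ht => taile.2.2.dist_zero taile.1 ht.1 (by linarith [ht.2]))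
    (fun t ht u hu => oppe t ⟨ht.1, by linarith [ht.2, dist_comm x' x]⟩ u hu) H
  unfold CA at ce
  rw [dist_comm x' x, ex'] at ce
  have dx'q := dist_pos.2 (Ne.symm hne)
  have trs : dist x' q < ℓ' := by linarith
  have ms := mh_step (a' := dist x' p) se sb (sn_pos dx'q (as.mono (by linarith)))
    (by rw [ex'p, sub_add_cancel]; exact sa.le) hk1
  rw [ex'p, sub_add_cancel, ← ex'p] at ms
  refine ⟨dist x' p + dist x' q, ⟨x', _, σ', _, ?_, hne, ?_, taile, hσ', ce, ms.trans hm, rfl, ?_⟩,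
    dist x p, dist x q, dist x' q, dist_nonneg, by linarith, dq.le, by linarith, dist_nonneg, trq,
    by rw [ex'p]; linarith, by linarith⟩
  · exact (ne_of_dist_eq ex'p (by linarith))
  · rcases hch with h | h
    · left
      rw [dist_comm p x']; rw [dist_comm p x] at h
      linarith
    · right
      rw [dist_comm q x']; rw [dist_comm q x] at h
      linarith
  · linarith

lemma succ_state (hgeo : IsGeodesicSpace Y) {X P : Y} {e ℓ δ δ' ℓ' : ℝ} (he : 0 < e)
    (hadm : Adm κ (20 * e))
    (hreg : ∀ z, dist X z + dist z P ≤ dist X P + δ → PosDom κ (Metric.ball z (20 * e)))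
    (hK : KK κ X P ℓ (dist X P + δ)) (hℓ : 20 * e ≤ ℓ) (hδ' : 0 < δ') (hδδ : δ' ≤ δ / 2)
    (hδe : δ ≤ e) (hℓ' : ℓ' ≤ ℓ + e) (hadml : ∀ s < ℓ', Adm κ s)
    (hsmall : md κ (4 * e) - md κ (4 * e - δ') < md κ (2 * e + δ / 2) - md κ (2 * e))
    {p q : Y} {m s : ℝ} (hSt : St κ X P (dist X P + δ') ℓ' p q m s) :
    md κ (dist p q) ≤ m ∨ ∃ s', St κ X P (dist X P + δ') ℓ' p q m s' ∧ ∃ a b b', 0 ≤ a ∧ a ≤ ℓ' ∧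
      0 ≤ b ∧ b ≤ ℓ' ∧ 0 ≤ b' ∧ b' ≤ e + b ∧ s - s' = e + b - b' ∧
      md κ (dist p q) ≤ m + sn κ a / sn κ e * (md κ (e + b) - md κ b') := by
  obtain ⟨x, γ, σ, k, hp, hq, hch, hγ, hσ, hk, hm, hs, hsℓ'⟩ := hSt
  by_cases hsℓ : ℓ ≤ s
  · rcases le_total (dist x q) (dist x p) with hle | hle
    · exact succ_state1 hgeo he hadm hreg hK hℓ hδ' hδδ hδe hℓ' hadml hsmall hp hq hch hγ hσ hk hm
        hs hsℓ' hsℓ hle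
    · rcases succ_state1 hgeo he hadm hreg hK hℓ hδ' hδδ hδe hℓ' hadml hsmall hq hp hch.symm hσ hγ
        hk.symm (m := m) (s := s) (by rwa [mh_comm]) (by rwa [add_comm]) hsℓ' hsℓ hle with h | ⟨s', h1, h2⟩
      · left; rwa [dist_comm]
      · right
        rw [dist_comm q p] at h2
        exact ⟨s', h1.symm, h2⟩
  · left
    push Not at hsℓ
    have h1 := hK x p q γ σ hp hq (hch.mono (by linarith)) (by rw [dist_comm p x]; linarith) hγ hσ k hk
    have as := hadml s hsℓ'
    have d1 := dist_pos.2 hp.symm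
    have d2 := dist_pos.2 hq.symm
    have sa : 0 < sn κ (dist x p) := sn_pos d1 (as.mono (by linarith))
    have sb : 0 < sn κ (dist x q) := sn_pos d2 (as.mono (by linarith))
    have h2 := CC_mul (c := dist p q) sa sb
    have h3 : k * (sn κ (dist x p) * sn κ (dist x q)) ≤ _ :=
      mul_le_mul_of_nonneg_right h1 (mul_nonneg sa.le sb.le)
    unfold CA at h3
    rw [h2] at h3
    unfold mh at hm
    linarith

lemma St.goal (hgeo : IsGeodesicSpace Y) {X P : Y} {e ℓ δ δ' ℓ' : ℝ} (he : 0 < e)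
    (hadm : Adm κ (20 * e))
    (hreg : ∀ z, dist X z + dist z P ≤ dist X P + δ → PosDom κ (Metric.ball z (20 * e)))
    (hK : KK κ X P ℓ (dist X P + δ)) (hℓ : 20 * e ≤ ℓ) (hδ' : 0 < δ') (hδδ : δ' ≤ δ / 2)
    (hδe : δ ≤ e) (hℓ' : ℓ' ≤ ℓ + e) (hadml : ∀ s < ℓ', Adm κ s)
    (hsmall : md κ (4 * e) - md κ (4 * e - δ') < md κ (2 * e + δ / 2) - md κ (2 * e))
    {p q : Y} {m s : ℝ} (hSt : St κ X P (dist X P + δ') ℓ' p q m s) :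
    md κ (dist p q) ≤ m := by
  by_contra! hcon
  have se : 0 < sn κ e := sn_pos he (hadm.mono (by linarith))
  -- bound for sn
  obtain ⟨C, hC⟩ := (isCompact_Icc (a := (0:ℝ)) (b := ℓ')).exists_bound_of_continuousOn
    (continuous_sn κ).continuousOn
  have uc := (isCompact_Icc (a := (0:ℝ)) (b := e + ℓ')).uniformContinuousOn_of_continuous
    (continuous_md κ).continuousOn
  rw [Metric.uniformContinuousOn_iff] at uc
  set ε := (md κ (dist p q) - m) / ((|C| + 1) / sn κ e) with hε
  have hε0 : 0 < ε := by
    have : 0 < md κ (dist p q) - m := by linarith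
    positivity
  obtain ⟨η, hη, huc⟩ := uc ε hε0
  set S := {s | St κ X P (dist X P + δ') ℓ' p q m s} with hS
  have hbdd : BddBelow S := by
    refine ⟨0, ?_⟩
    rintro s ⟨x, γ, σ, k, _, _, _, _, _, _, _, hs, _⟩
    rw [← hs]; positivity
  obtain ⟨s1, hs1, hlt⟩ := exists_lt_of_csInf_lt (s := S) ⟨s, hSt⟩
    (lt_add_of_pos_right (sInf S) hη)
  rcases succ_state hgeo he hadm hreg hK hℓ hδ' hδδ hδe hℓ' hadml hsmall hs1 with h |
    ⟨s', h1, a, b, b', ha0, ha, hb0, hb, hb'0, hb', hss, hmd⟩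
  · linarith
  have h2 : sInf S ≤ s' := csInf_le hbdd h1
  have h3 := huc (e + b) ⟨by linarith, by linarith⟩ b' ⟨hb'0, by linarith⟩
    (by rw [Real.dist_eq, abs_of_nonneg (by linarith)]; linarith)
  rw [Real.dist_eq] at h3
  have h4 := hC a ⟨ha0, ha⟩
  rw [Real.norm_eq_abs] at h4
  have h5 : sn κ a / sn κ e * (md κ (e + b) - md κ b') < (|C| + 1) / sn κ e * ε := by
    calc _ ≤ |sn κ a / sn κ e * (md κ (e + b) - md κ b')| := le_abs_self _
      _ = |sn κ a| / sn κ e * |md κ (e + b) - md κ b'| := by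
        rw [abs_mul, abs_div, abs_of_pos se]
      _ ≤ (|C| + 1) / sn κ e * |md κ (e + b) - md κ b'| := by
        gcongr; linarith [le_abs_self C]
      _ < _ := by gcongr
  have h6 : (|C| + 1) / sn κ e * ε = md κ (dist p q) - m := by
    rw [hε]; exact mul_div_cancel₀ _ (by positivity)
  linarith

lemma KK.step (hgeo : IsGeodesicSpace Y) {X P : Y} {e ℓ δ ℓ' : ℝ} (he : 0 < e)
    (hadm : Adm κ (20 * e)) (hδ0 : 0 < δ)
    (hreg : ∀ z, dist X z + dist z P ≤ dist X P + δ → PosDom κ (Metric.ball z (20 * e)))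
    (hK : KK κ X P ℓ (dist X P + δ)) (hℓ : 20 * e ≤ ℓ)
    (hℓ' : ℓ' ≤ ℓ + e) (hadml : ∀ s < ℓ', Adm κ s) :
    ∃ δ' > 0, δ' ≤ δ ∧ KK κ X P ℓ' (dist X P + δ') := by
  -- shrink δ
  wlog hδe : δ ≤ e generalizing δ with Hw
  · obtain ⟨δ', h1, h2, h3⟩ := Hw (δ := min δ e) (lt_min hδ0 he)
      (fun z hz => hreg z (hz.trans (by gcongr; exact min_le_left _ _)))
      (fun x p q γ σ a b c => hK x p q γ σ a b (c.mono (by gcongr; exact min_le_left _ _)))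
      (min_le_right _ _)
    exact ⟨δ', h1, h2.trans (min_le_left _ _), h3⟩
  have hpos : 0 < md κ (2 * e + δ / 2) - md κ (2 * e) := by
    have := md_lt (κ := κ) (by linarith : 0 ≤ 2 * e) (by linarith : 2 * e < 2 * e + δ / 2)
      (hadm.mono (by linarith))
    linarith
  have hc : Filter.Tendsto (fun d : ℝ => md κ (4 * e) - md κ (4 * e - d)) (nhds 0) (nhds 0) := by
    have : Continuous (fun d : ℝ => md κ (4 * e) - md κ (4 * e - d)) :=
      continuous_const.sub ((continuous_md κ).comp (by fun_prop))
    have h := this.tendsto 0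
    simpa using h
  obtain ⟨d, hd0, hd⟩ := Metric.eventually_nhds_iff.1 (hc.eventually (gt_mem_nhds hpos))
  have hm : 0 < min (d / 2) (δ / 2) := by positivity
  have hsmall := hd (y := min (d / 2) (δ / 2)) (by
    rw [Real.dist_eq, sub_zero, abs_of_pos hm]; linarith [min_le_left (d / 2) (δ / 2)])
  refine ⟨min (d / 2) (δ / 2), hm, by linarith [min_le_right (d / 2) (δ / 2)], ?_⟩
  intro x p q γ σ hp hq hch hs hγ hσ k hk
  rw [dist_comm p x] at hs
  have g := St.goal hgeo he hadm hreg hK hℓ hm (min_le_right _ _) hδe hℓ' hadml hsmall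
    (s := dist x p + dist x q)
    ⟨x, γ, σ, k, hp, hq, hch, hγ, hσ, hk, le_rfl, rfl, hs⟩
  have as := hadml _ hs
  have d1 := dist_pos.2 hp.symm
  have d2 := dist_pos.2 hq.symm
  have sa : 0 < sn κ (dist x p) := sn_pos d1 (as.mono (by linarith))
  have sb : 0 < sn κ (dist x q) := sn_pos d2 (as.mono (by linarith))
  unfold CA CC
  rw [le_div_iff₀ (by positivity)]
  unfold mh at g
  linarith

/-- thin hinge theorem -/
lemma KK.all (hgeo : IsGeodesicSpace Y) {X P : Y} {e δ : ℝ} (he : 0 < e)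
    (hadm : Adm κ (20 * e)) (hδ0 : 0 < δ)
    (hreg : ∀ z, dist X z + dist z P ≤ dist X P + δ → PosDom κ (Metric.ball z (20 * e)))
    (ℓ : ℝ) (hadml : ∀ s < ℓ, Adm κ s) :
    ∃ δ' > 0, KK κ X P ℓ (dist X P + δ') := by
  have main : ∀ n : ℕ, ∀ ℓ : ℝ, ℓ ≤ 20 * e + n * e → (∀ s < ℓ, Adm κ s) →
      ∃ δ' > 0, δ' ≤ δ ∧ KK κ X P ℓ (dist X P + δ') := by
    intro n
    induction n with
    | zero =>
      intro ℓ hℓ _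
      refine ⟨δ, hδ0, le_rfl, ?_⟩
      intro x p q γ σ hp hq hch hs hγ hσ
      simp at hℓ
      rw [dist_comm p x] at hs
      have d1 := dist_pos.2 hp.symm
      have d2 := dist_pos.2 hq.symm
      exact local_HF_ball (hreg x hch.mid) hγ hσ hadm (by linarith) (by linarith) hp hq
    | succ n ih =>
      intro ℓ hℓ hadml
      push_cast at hℓ
      by_cases hc : ℓ ≤ 20 * e + n * e
      · exact ih ℓ hc hadml
      push Not at hc
      have hn : (0:ℝ) ≤ n * e := by positivity
      obtain ⟨δ1, h1, h2, h3⟩ := ih (20 * e + n * e) le_rfl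
        (fun s hs => hadml s (by linarith))
      obtain ⟨δ2, g1, g2, g3⟩ := KK.step hgeo he hadm h1
        (fun z hz => hreg z (hz.trans (by linarith))) h3 (by linarith) (ℓ' := ℓ) (by linarith) hadml
      exact ⟨δ2, g1, g2.trans h2, g3⟩
  obtain ⟨n, hn⟩ := exists_nat_gt (ℓ / e)
  rw [div_lt_iff₀ he] at hn
  obtain ⟨δ', h1, _, h3⟩ := main n ℓ (by linarith) hadml
  exact ⟨δ', h1, h3⟩

end thin2


open Filter Topology

/-! ### Barrier lemma -/

lemma symm_o {S : ℝ → ℝ} {S' t : ℝ} (h : HasDerivAt S S' t) {ε : ℝ} (hε : 0 < ε) :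
    ∀ᶠ s in 𝓝[>] (0:ℝ), |S (t + s) + S (t - s) - 2 * S t| ≤ ε * s := by
  rw [hasDerivAt_iff_isLittleO] at h
  have h1 := h.def (half_pos hε)
  have c1 : Tendsto (fun s : ℝ => t + s) (𝓝[>] 0) (𝓝 t) := by
    have : Tendsto (fun s : ℝ => t + s) (𝓝 0) (𝓝 (t + 0)) := (continuous_const.add continuous_id).tendsto 0
    rw [add_zero] at this
    exact this.mono_left nhdsWithin_le_nhds
  have c2 : Tendsto (fun s : ℝ => t - s) (𝓝[>] 0) (𝓝 t) := by
    have : Tendsto (fun s : ℝ => t - s) (𝓝 0) (𝓝 (t - 0)) := (continuous_const.sub continuous_id).tendsto 0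
    rw [sub_zero] at this
    exact this.mono_left nhdsWithin_le_nhds
  filter_upwards [c1.eventually h1, c2.eventually h1, self_mem_nhdsWithin] with s g1 g2 hs
  simp only [Real.norm_eq_abs, smul_eq_mul, add_sub_cancel_left] at g1 g2
  have hs' : 0 < s := hs
  rw [abs_of_pos hs'] at g1
  rw [show t - s - t = -s by ring, abs_neg, abs_of_pos hs'] at g2
  rw [abs_le] at g1 g2 ⊢
  constructor <;> linarith [g1.1, g1.2, g2.1, g2.2]

lemma deriv_zero_of_small {S : ℝ → ℝ} {S' t : ℝ} (h : HasDerivAt S S' t) (h0 : S t = 0)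
    (hs : ∀ ε > 0, ∀ᶠ s in 𝓝[>] (0:ℝ), |S (t + s)| ≤ ε * s) : S' = 0 := by
  by_contra hne
  have hpos : 0 < |S'| / 4 := by positivity
  rw [hasDerivAt_iff_isLittleO] at h
  have h1 := h.def hpos
  have c1 : Tendsto (fun s : ℝ => t + s) (𝓝[>] 0) (𝓝 t) := by
    have : Tendsto (fun s : ℝ => t + s) (𝓝 0) (𝓝 (t + 0)) := (continuous_const.add continuous_id).tendsto 0
    rw [add_zero] at this
    exact this.mono_left nhdsWithin_le_nhds
  obtain ⟨s, g1, g2, hs0⟩ := ((c1.eventually h1).and ((hs _ hpos).and self_mem_nhdsWithin)).exists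
  have hs' : 0 < s := hs0
  simp only [Real.norm_eq_abs, smul_eq_mul, add_sub_cancel_left, h0, sub_zero] at g1
  rw [abs_of_pos hs'] at g1
  have e : |s * S'| ≤ |S (t + s)| + |S (t + s) - s * S'| := by
    calc _ = |S (t + s) - (S (t + s) - s * S')| := by congr 1; ring
      _ ≤ _ := abs_sub _ _
  rw [abs_mul, abs_of_pos hs'] at e
  have : 0 < s * |S'| := by positivity
  nlinarith

lemma cs_add (κ a b : ℝ) : cs κ (a + b) = cs κ a * cs κ b - κ * sn κ a * sn κ b := by
  unfold cs; rw [md_add]; ring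
lemma cs_sub (κ a b : ℝ) : cs κ (a - b) = cs κ a * cs κ b + κ * sn κ a * sn κ b := by
  unfold cs; rw [md_sub]; ring
lemma cs_sq (κ a : ℝ) : cs κ a ^ 2 + κ * sn κ a ^ 2 = 1 := by
  rw [sn_sq]; unfold cs; ring

/-- second order condition at `t` -/
def SO2 (κ : ℝ) (u : ℝ → ℝ) (t : ℝ) : Prop :=
  ∀ᶠ s in 𝓝[>] (0:ℝ), u (t + s) + u (t - s) ≤ 2 * cs κ s * u t + 2 * md κ s

/-- first order condition at `t` -/
def FO1 (u : ℝ → ℝ) (t : ℝ) : Prop :=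
  ∀ ε > 0, ∀ᶠ s in 𝓝[>] (0:ℝ), u (t + s) + u (t - s) - 2 * u t ≤ ε * s

lemma barrier0 {κ L : ℝ} (hL : 0 < L) (hadm : Adm κ L) {w : ℝ → ℝ}
    (hw : ContinuousOn w (Set.Icc 0 L)) (w0 : w 0 = 0) (wL : w L = 0) {E : Set ℝ} (hE : E.Countable)
    (hSO : ∀ t ∈ Set.Ioo 0 L, t ∉ E →
      ∀ᶠ s in 𝓝[>] (0:ℝ), w (t + s) + w (t - s) ≤ 2 * cs κ s * w t)
    (hFO : ∀ t ∈ Set.Ioo 0 L, t ∈ E → FO1 w t) :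
    ∀ t ∈ Set.Icc 0 L, 0 ≤ w t := by
  by_contra! hcon
  obtain ⟨ts, hts, hneg⟩ := hcon
  set φ : ℝ → ℝ := fun t => cs κ (t - L / 2) with hφ
  have φc : Continuous φ := (continuous_cs κ).comp (by fun_prop)
  have φd : ∀ t, HasDerivAt φ (-(κ * sn κ (t - L / 2))) t := by
    intro t
    have := (hasDerivAt_cs κ (t - L / 2)).comp t ((hasDerivAt_id t).sub_const (L / 2))
    rw [mul_one] at this
    exact this
  have φpos : ∀ t ∈ Set.Icc 0 L, 0 < φ t := by
    intro t ht
    apply cs_pos (hadm.mono _)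
    have : |t - L / 2| ≤ L / 2 := abs_le.2 ⟨by linarith [ht.1], by linarith [ht.2]⟩
    linarith
  -- choice of B
  have Wc : Continuous (fun t => sn κ t * φ t + md κ t * (κ * sn κ (t - L / 2))) := by
    have h1 := continuous_sn κ
    have h2 := continuous_md κ
    have h3 : Continuous (fun t => sn κ (t - L / 2)) := h1.comp (by fun_prop)
    fun_prop
  obtain ⟨C, hC⟩ := (isCompact_Icc (a := (0:ℝ)) (b := L)).exists_bound_of_continuousOn
    Wc.continuousOn
  have φ0 : 0 < cs κ (L / 2) := by
    have := φpos L ⟨hL.le, le_rfl⟩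
    simp only [hφ] at this
    rwa [show L - L / 2 = L / 2 by ring] at this
  set B := (|C| + 1) / cs κ (L / 2) with hB
  set G : ℝ → ℝ := fun t => - md κ t + B * sn κ t with hG
  have Gc : Continuous G := by
    have h1 := continuous_sn κ
    have h2 := continuous_md κ
    fun_prop
  have Gd : ∀ t, HasDerivAt G (- sn κ t + B * cs κ t) t := fun t =>
    (hasDerivAt_md κ t).neg.add ((hasDerivAt_sn κ t).const_mul B)
  have Wr : ∀ t ∈ Set.Icc 0 L, (- sn κ t + B * cs κ t) * φ t - G t * (-(κ * sn κ (t - L / 2))) ≠ 0 := by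
    intro t ht
    have h1 := hC t ht
    rw [Real.norm_eq_abs] at h1
    have h2 := (abs_le.1 h1).2
    have e : (- sn κ t + B * cs κ t) * φ t - G t * (-(κ * sn κ (t - L / 2)))
      = B * cs κ (L / 2) - (sn κ t * φ t + md κ t * (κ * sn κ (t - L / 2))) := by
      simp only [hφ, hG, cs_sub, sn_sub]
      linear_combination (B * cs κ (L / 2)) * cs_sq κ t
    have e2 : B * cs κ (L / 2) = |C| + 1 := by rw [hB]; field_simp
    rw [e, e2]
    have := le_abs_self C
    linarith
  -- bound for G/φ
  have hGφ : ContinuousOn (fun t => G t / φ t) (Set.Icc 0 L) :=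
    Gc.continuousOn.div φc.continuousOn (fun t ht => (φpos t ht).ne')
  obtain ⟨M, hM⟩ := (isCompact_Icc (a := (0:ℝ)) (b := L)).exists_bound_of_continuousOn hGφ
  set c := - (w ts / φ ts) with hc
  have hc0 : 0 < c := by
    have := div_neg_of_neg_of_pos hneg (φpos ts hts)
    linarith
  set η0 := c / (4 * (|M| + 1)) with hη0
  have hη0p : 0 < η0 := by positivity
  -- minimum points
  have key : ∀ η ∈ Set.Ioo 0 η0, ∃ t ∈ Set.Ioo 0 L, ∃ m, (w t + η * G t - m * φ t = 0) ∧
      ∀ y ∈ Set.Icc 0 L, 0 ≤ w y + η * G y - m * φ y := by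
    intro η hη
    have hcont : ContinuousOn (fun t => (w t + η * G t) / φ t) (Set.Icc 0 L) :=
      (hw.add (continuousOn_const.mul Gc.continuousOn)).div φc.continuousOn
        (fun t ht => (φpos t ht).ne')
    obtain ⟨t, ht, hmin⟩ := isCompact_Icc.exists_isMinOn ⟨0, le_rfl, hL.le⟩ hcont
    have bd : ∀ y ∈ Set.Icc 0 L, |η * (G y / φ y)| ≤ c / 4 := by
      intro y hy
      have h1 := hM y hy
      rw [Real.norm_eq_abs] at h1
      rw [abs_mul, abs_of_pos hη.1]
      have h2 : η * |G y / φ y| ≤ η0 * (|M| + 1) := by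
        apply mul_le_mul hη.2.le _ (abs_nonneg _) hη0p.le
        linarith [le_abs_self M]
      have h3 : η0 * (|M| + 1) = c / 4 := by rw [hη0]; field_simp
      linarith
    have sp : ∀ y, (w y + η * G y) / φ y = w y / φ y + η * (G y / φ y) := fun y => by ring
    have hts' := hmin hts
    simp only [Set.mem_ofPred_eq] at hts'
    rw [sp ts] at hts'
    have b1 := abs_le.1 (bd ts hts)
    have b2 := abs_le.1 (bd t ht)
    have hwt : w t ≠ 0 := by
      intro h
      rw [sp t, h, zero_div] at hts'
      linarith
    refine ⟨t, ⟨?_, ?_⟩, (w t + η * G t) / φ t, ?_, ?_⟩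
    · rcases ht.1.eq_or_lt with h | h
      · rw [← h] at hwt; exact absurd w0 hwt
      · exact h
    · rcases ht.2.eq_or_lt with h | h
      · rw [h] at hwt; exact absurd wL hwt
      · exact h
    · rw [div_mul_cancel₀ _ (φpos t ht).ne', sub_self]
    · intro y hy
      have h1 := hmin hy
      simp only [Set.mem_ofPred_eq] at h1
      rw [le_div_iff₀ (φpos y hy)] at h1
      linarith
  choose! T hT m hm0 hm using key
  have evI : ∀ t ∈ Set.Ioo 0 L, ∀ᶠ s in 𝓝[>] (0:ℝ), t + s ∈ Set.Icc 0 L ∧ t - s ∈ Set.Icc 0 L := by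
    intro t ht
    have : 0 < min t (L - t) := lt_min ht.1 (by linarith [ht.2])
    filter_upwards [Ioo_mem_nhdsGT this] with s hs
    have h1 := lt_min_iff.1 hs.2
    exact ⟨⟨by linarith [ht.1, hs.1], by linarith⟩, ⟨by linarith [ht.1, hs.1], by linarith [hs.1, ht.2]⟩⟩
  have TE : ∀ η ∈ Set.Ioo 0 η0, T η ∈ E := by
    intro η hη
    by_contra hnE
    have ht := hT η hη
    have h1 := hSO (T η) ht hnE
    obtain ⟨s, h1, ⟨h2, h3⟩, h4⟩ := (h1.and ((evI _ ht).and (Ioo_mem_nhdsGT hL))).exists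
    have p1 := hm η hη _ h2
    have p2 := hm η hη _ h3
    have p0 := hm0 η hη
    set t := T η
    have eφ : φ (t + s) + φ (t - s) = 2 * cs κ s * φ t := by
      simp only [hφ]
      rw [show t + s - L / 2 = (t - L / 2) + s by ring, show t - s - L / 2 = (t - L / 2) - s by ring,
        cs_add κ (t - L / 2), cs_sub κ (t - L / 2) s]; ring
    have eG : G (t + s) + G (t - s) = 2 * cs κ s * G t - 2 * md κ s := by
      simp only [hG]
      rw [md_add, md_sub, sn_add, sn_sub]; unfold cs; ring
    have : 0 < md κ s := md_pos h4.1 (hadm.mono h4.2.le)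
    have h5 : 0 < η * md κ s := mul_pos hη.1 this
    have h6 : w (t + s) + η * G (t + s) - m η * φ (t + s) + (w (t - s) + η * G (t - s) - m η * φ (t - s))
      = w (t + s) + w (t - s) + η * (2 * cs κ s * G t - 2 * md κ s) - m η * (2 * cs κ s * φ t) := by
      rw [← eφ, ← eG]; ring
    have h7 : 2 * cs κ s * (w t + η * G t - m η * φ t) = 0 := by rw [p0, mul_zero]
    nlinarith
  have hni : ¬ Set.InjOn T (Set.Ioo 0 η0) := by
    intro hinj
    have h1 : (T '' Set.Ioo 0 η0).Countable := hE.mono (by rintro _ ⟨η, hη, rfl⟩; exact TE η hη)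
    have h2 := Set.countable_of_injective_of_countable_image hinj h1
    exact (Cardinal.Real.Ioo_countable_iff.1 h2).not_gt hη0p
  unfold Set.InjOn at hni
  push Not at hni
  obtain ⟨η1, hη1, η2, hη2, hTT, hne⟩ := hni
  have ht := hT η1 hη1
  have htI : T η1 ∈ Set.Icc 0 L := Set.Ioo_subset_Icc_self ht
  -- each touching function is small
  have small : ∀ η ∈ Set.Ioo 0 η0, ∀ ε > 0, ∀ᶠ s in 𝓝[>] (0:ℝ),
      0 ≤ w (T η + s) + η * G (T η + s) - m η * φ (T η + s) ∧
      w (T η + s) + η * G (T η + s) - m η * φ (T η + s) ≤ ε * s := by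
    intro η hη ε hε
    have d : HasDerivAt (fun y => η * G y - m η * φ y) _ (T η) :=
      ((Gd (T η)).const_mul η).sub ((φd (T η)).const_mul (m η))
    filter_upwards [hFO _ (hT η hη) (TE η hη) (ε / 2) (half_pos hε), symm_o d (half_pos hε),
      evI _ (hT η hη)] with s g1 g2 g3
    have p1 := hm η hη _ g3.1
    have p2 := hm η hη _ g3.2
    have p0 := hm0 η hη
    refine ⟨p1, ?_⟩
    have := (abs_le.1 g2).2
    linarith
  set t := T η1 with htdef
  have dD : HasDerivAt (fun y => (η1 - η2) * G y - (m η1 - m η2) * φ y) _ t :=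
    ((Gd t).const_mul (η1 - η2)).sub ((φd t).const_mul (m η1 - m η2))
  have p1 := hm0 η1 hη1
  have p2 := hm0 η2 hη2
  rw [← hTT] at p2
  have z0 : (η1 - η2) * G t - (m η1 - m η2) * φ t = 0 := by linarith
  have z1 := deriv_zero_of_small dD z0 (by
    intro ε hε
    have s1 := small η1 hη1 ε hε
    have s2 := small η2 hη2 ε hε
    rw [← hTT] at s2
    filter_upwards [s1, s2] with s g1 g2
    rw [abs_le]
    constructor <;> linarith [g1.1, g1.2, g2.1, g2.2])
  apply Wr t htI
  have hsub : η1 - η2 ≠ 0 := sub_ne_zero.2 hne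
  apply mul_left_cancel₀ hsub
  linear_combination (φ t) * z1 - (-(κ * sn κ (t - L / 2))) * z0

/-- barrier lemma -/
lemma barrier {κ L : ℝ} (hL : 0 < L) (hadm : Adm κ L) {u : ℝ → ℝ}
    (hu : ContinuousOn u (Set.Icc 0 L)) {E : Set ℝ} (hE : E.Countable)
    (hSO : ∀ t ∈ Set.Ioo 0 L, t ∉ E → SO2 κ u t)
    (hFO : ∀ t ∈ Set.Ioo 0 L, t ∈ E → FO1 u t) :
    ∀ t ∈ Set.Icc 0 L, Pos κ t (L - t) (u 0) (u t) (u L) := by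
  have sL : 0 < sn κ L := sn_pos hL hadm
  set a := (u L - md κ L - u 0 * cs κ L) / sn κ L with ha
  have ha' : a * sn κ L = u L - md κ L - u 0 * cs κ L := by rw [ha]; field_simp
  set v : ℝ → ℝ := fun t => md κ t + a * sn κ t + u 0 * cs κ t with hv
  have vd : ∀ t, HasDerivAt v (sn κ t + a * cs κ t + u 0 * (-(κ * sn κ t))) t := fun t =>
    ((hasDerivAt_md κ t).add ((hasDerivAt_sn κ t).const_mul a)).add
      ((hasDerivAt_cs κ t).const_mul (u 0))
  have vc : Continuous v := continuous_iff_continuousAt.2 fun t => (vd t).continuousAt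
  have h := barrier0 hL hadm (w := fun t => u t - v t) (hu.sub vc.continuousOn) (by simp [hv])
    (by simp only [hv]; linarith) hE (by
      intro t ht htE
      filter_upwards [hSO t ht htE] with s hs
      have e : v (t + s) + v (t - s) = 2 * cs κ s * v t + 2 * md κ s := by
        simp only [hv]
        rw [md_add, md_sub, sn_add, sn_sub, cs_add, cs_sub]; unfold cs; ring
      linarith) (by
      intro t ht htE ε hε
      filter_upwards [hFO t ht htE (ε / 2) (half_pos hε), symm_o (vd t) (half_pos hε)] with s g1 g2
      have := (abs_le.1 g2).1
      linarith)
  intro t ht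
  have h1 := h t ht
  have h2 : 0 ≤ sn κ L * (u t - v t) := mul_nonneg sL.le h1
  unfold Pos
  rw [show t + (L - t) = L by ring]
  have e : sn κ L * v t + sn κ (L - t) * md κ t + sn κ t * md κ (L - t)
    = sn κ (L - t) * u 0 + sn κ t * u L := by
    have : sn κ L * v t = sn κ L * md κ t + (u L - md κ L - u 0 * cs κ L) * sn κ t + u 0 * cs κ t * sn κ L := by
      rw [← ha']; simp only [hv]; ring
    rw [this, sn_sub, md_sub]; unfold cs
    linear_combination (-sn κ L) * sn_sq κ t
  linarith

open Filter Topology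

section second_order
variable {Y : Type*} [MetricSpace Y] {κ : ℝ}

/-- regular points -/
def Reg (κ : ℝ) (y : Y) : Prop := ∃ r > 0, PosDom κ (Metric.ball y r)

lemma PosDom.mono {S T : Set Y} (h : PosDom κ T) (hST : S ⊆ T) : PosDom κ S :=
  fun x hx m hm p hp q hq => h x (hST hx) m (hST hm) p (hST hp) q (hST hq)

lemma Adm.exists_gt {a : ℝ} (h : Adm κ a) : ∃ b > a, Adm κ b := by
  by_cases hk : 0 < κ
  · have h1 := h hk
    have hs := Real.sqrt_pos.2 hk
    have h2 : a < Real.pi / Real.sqrt κ := by rw [lt_div_iff₀ hs]; linarith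
    obtain ⟨b, h3, h4⟩ := exists_between h2
    refine ⟨b, h3, fun _ => ?_⟩
    rw [lt_div_iff₀ hs] at h4; linarith
  · exact ⟨a + 1, by linarith, fun h => absurd h hk⟩

lemma uniform_reg [ProperSpace Y] {x p : Y}
    (hseg : ∀ z, dist x z + dist z p = dist x p → Reg κ z) :
    ∃ ρ > 0, ∀ z, dist x z + dist z p ≤ dist x p + ρ → PosDom κ (Metric.ball z ρ) := by
  by_contra! hcon
  have : Nonempty Y := ⟨x⟩
  choose! z hz1 hz2 using hcon
  have hz1' : ∀ n : ℕ, dist x (z (1 / ((n:ℝ) + 1))) + dist (z (1 / ((n:ℝ) + 1))) p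
      ≤ dist x p + 1 / ((n:ℝ) + 1) := fun n => hz1 _ (by positivity)
  have hz2' : ∀ n : ℕ, ¬ PosDom κ (Metric.ball (z (1 / ((n:ℝ) + 1))) (1 / ((n:ℝ) + 1))) :=
    fun n => hz2 _ (by positivity)
  set y : ℕ → Y := fun n => z (1 / ((n:ℝ) + 1)) with hy
  have hb : ∀ n, y n ∈ Metric.closedBall x (dist x p + 1) := by
    intro n
    rw [Metric.mem_closedBall']
    have h1 := hz1' n
    have h2 : 1 / ((n:ℝ) + 1) ≤ 1 := by
      rw [div_le_one (by positivity)]; linarith [(Nat.cast_nonneg n : (0:ℝ) ≤ n)]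
    have h3 := dist_nonneg (x := y n) (y := p)
    simp only [hy] at h3 ⊢
    linarith
  obtain ⟨w, _, f, hf, hlim⟩ := (isCompact_closedBall x (dist x p + 1)).tendsto_subseq hb
  have hinv : Tendsto (fun n => 1 / (((f n : ℕ) : ℝ) + 1)) atTop (𝓝 0) :=
    tendsto_one_div_add_atTop_nhds_zero_nat.comp hf.tendsto_atTop
  have hw : dist x w + dist w p ≤ dist x p + 0 := by
    refine le_of_tendsto_of_tendsto
      ((tendsto_const_nhds.dist hlim).add (hlim.dist tendsto_const_nhds))
      (tendsto_const_nhds.add hinv) (Eventually.of_forall fun n => ?_)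
    exact hz1' (f n)
  obtain ⟨r, hr, hP⟩ := hseg w (le_antisymm (by linarith) (dist_triangle _ _ _))
  have e1 : ∀ᶠ n in atTop, dist (y (f n)) w < r / 2 :=
    (tendsto_iff_dist_tendsto_zero.1 hlim).eventually (gt_mem_nhds (half_pos hr))
  have e2 : ∀ᶠ n in atTop, 1 / (((f n : ℕ) : ℝ) + 1) < r / 2 :=
    hinv.eventually (gt_mem_nhds (half_pos hr))
  obtain ⟨n, g1, g2⟩ := (e1.and e2).exists
  apply hz2' (f n)
  apply hP.mono
  apply Metric.ball_subset_ball'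
  simp only [hy] at g1
  linarith

/-- second order comparison along regular segments -/
lemma second_order [ProperSpace Y] (hgeo : IsGeodesicSpace Y) {x p : Y} (hxp : p ≠ x)
    (hadm : Adm κ (dist x p)) (hseg : ∀ z, dist x z + dist z p = dist x p → Reg κ z) :
    ∃ δ > 0, ∀ y y' : Y, y ≠ x → y' ≠ x → dist y x + dist x y' = dist y y' → dist x y < δ →
      dist x y' < δ → PosAt κ y x y' p := by
  obtain ⟨ρ, hρ, hreg⟩ := uniform_reg hseg
  obtain ⟨r1, hr1, har1⟩ := exists_adm κ
  obtain ⟨ℓ, hℓ, haℓ⟩ := hadm.exists_gt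
  have hm0 : 0 < min ρ r1 := lt_min hρ hr1
  have h20 : 20 * (min ρ r1 / 20) = min ρ r1 := by ring
  obtain ⟨δ', hδ', hK⟩ := KK.all hgeo (X := x) (P := p) (e := min ρ r1 / 20) (by positivity)
    (by rw [h20]; exact har1.mono (min_le_right _ _)) hρ
    (fun z hz => by
      rw [h20]; exact (hreg z hz).mono (Metric.ball_subset_ball (min_le_left _ _)))
    ℓ (fun s hs => haℓ.mono hs.le)
  refine ⟨min (δ' / 2) (min (ℓ - dist x p) (min ρ r1)), ?_, ?_⟩
  · have : 0 < ℓ - dist x p := by linarith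
    positivity
  intro y y' hy hy' hb hd hd'
  simp only [lt_min_iff] at hd hd'
  obtain ⟨γ, hγ⟩ := hgeo x y
  obtain ⟨γ', hγ'⟩ := hgeo x y'
  obtain ⟨τ, hτ⟩ := hgeo x p
  have d0 := dist_pos.2 hy.symm
  have d0' := dist_pos.2 hy'.symm
  have ch : ∀ v : Y, dist x v < δ' / 2 → Chain x p (dist x p + δ') v x p := by
    intro v hv
    left; rw [dist_self, dist_comm v x]; linarith
  have H1 := hK x y' p γ' τ hy' hxp (ch _ hd'.1) (by rw [dist_comm y' x]; linarith) hγ' hτ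
  have regx : PosDom κ (Metric.ball x (min ρ r1)) :=
    (hreg x (by simp [hρ.le])).mono (Metric.ball_subset_ball (min_le_left _ _))
  have H2 := opp hm0 (har1.mono (min_le_right _ _)) regx hγ' hτ hy' hxp d0 (γ' := γ)
    (fun t ht => hγ.2.2.dist_zero hγ.1 ht.1 ht.2) (fun t ht s hs => by
      have a1 : dist x (γ s) = s := hγ.2.2.dist_zero hγ.1 hs.1 hs.2
      have a2 : dist x (γ' t) = t := hγ'.2.2.dist_zero hγ'.1 ht.1 ht.2
      have a3 : dist (γ s) y = dist x y - s := by
        have := hγ.2.2.dist_le hs.1 hs.2 le_rfl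
        rwa [hγ.2.1] at this
      have a4 : dist (γ' t) y' = dist x y' - t := by
        have := hγ'.2.2.dist_le ht.1 ht.2 le_rfl
        rwa [hγ'.2.1] at this
      have t1 := dist_triangle (γ' t) x (γ s)
      have t2 := dist_triangle y (γ s) y'
      have t3 := dist_triangle (γ s) (γ' t) y'
      rw [dist_comm (γ' t) x] at t1
      rw [dist_comm y (γ s)] at t2
      rw [dist_comm (γ s) (γ' t)] at t3
      rw [dist_comm y x] at hb
      linarith) H1
  have H3 := hK x y p γ τ hy hxp (ch _ hd.1) (by rw [dist_comm y x]; linarith) hγ hτ _ H2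
  exact (posAt_iff_sum hy hy' hxp (haℓ.mono (by linarith [dist_nonneg (x := x) (y := p)])) (haℓ.mono (by linarith [dist_nonneg (x := x) (y := p)]))
    hadm).2 (by linarith)

/-- `SO2` along a geodesic -/
lemma so2_of_posAt {g : ℝ → Y} {t0 a b : ℝ} {p : Y} (ht : t0 ∈ Set.Ioo a b)
    (hg : ∀ s ∈ Set.Icc a b, ∀ t ∈ Set.Icc a b, dist (g s) (g t) = |s - t|)
    (h : ∃ δ > 0, ∀ y y' : Y, y ≠ g t0 → y' ≠ g t0 → dist y (g t0) + dist (g t0) y' = dist y y' →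
      dist (g t0) y < δ → dist (g t0) y' < δ → PosAt κ y (g t0) y' p) :
    SO2 κ (fun t => md κ (dist p (g t))) t0 := by
  obtain ⟨δ, hδ, h⟩ := h
  obtain ⟨r1, hr1, har1⟩ := exists_adm κ
  have hm : 0 < min (min δ r1) (min (t0 - a) (b - t0)) := by
    have := ht.1; have := ht.2
    refine lt_min (lt_min hδ hr1) (lt_min (by linarith) (by linarith))
  filter_upwards [Ioo_mem_nhdsGT hm] with s hs
  obtain ⟨hs0, hs1⟩ := hs
  simp only [lt_min_iff] at hs1
  obtain ⟨⟨h1, h2⟩, h3, h4⟩ := hs1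
  have i0 : t0 ∈ Set.Icc a b := Set.Ioo_subset_Icc_self ht
  have i1 : t0 - s ∈ Set.Icc a b := ⟨by linarith, by linarith [ht.2]⟩
  have i2 : t0 + s ∈ Set.Icc a b := ⟨by linarith [ht.1], by linarith⟩
  have e1 : dist (g t0) (g (t0 - s)) = s := by
    rw [hg _ i0 _ i1, show t0 - (t0 - s) = s by ring, abs_of_pos hs0]
  have e2 : dist (g t0) (g (t0 + s)) = s := by
    rw [hg _ i0 _ i2, show t0 - (t0 + s) = -s by ring, abs_neg, abs_of_pos hs0]
  have e3 : dist (g (t0 - s)) (g (t0 + s)) = s + s := by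
    rw [hg _ i1 _ i2, show t0 - s - (t0 + s) = -(s + s) by ring, abs_neg, abs_of_pos (by linarith)]
  have P := h (g (t0 - s)) (g (t0 + s)) (ne_of_dist_eq e1 hs0) (ne_of_dist_eq e2 hs0)
    (by rw [dist_comm, e1, e2, e3]) (by linarith) (by linarith)
  unfold PosAt Pos at P
  rw [dist_comm (g (t0 - s)) (g t0), e1, e2, sn_add] at P
  have ss : 0 < sn κ s := sn_pos hs0 (har1.mono h2.le)
  rw [dist_comm p, dist_comm p, dist_comm p]
  apply le_of_mul_le_mul_left _ ss
  linarith

end second_order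

open Filter Topology

section first_order
variable {Y : Type*} [MetricSpace Y] {κ : ℝ}

lemma SO2.fo1 {u : ℝ → ℝ} {t : ℝ} (h : SO2 κ u t) : FO1 u t := by
  intro ε hε
  have d : HasDerivAt (fun s => 2 * cs κ s * u t + 2 * md κ s - 2 * u t) 0 0 := by
    have := ((((hasDerivAt_cs κ 0).const_mul 2).mul_const (u t)).add
      ((hasDerivAt_md κ 0).const_mul 2)).sub_const (2 * u t)
    simpa using this
  rw [hasDerivAt_iff_isLittleO] at d
  have d1 := (d.def hε).filter_mono (nhdsWithin_le_nhds (s := Set.Ioi 0))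
  filter_upwards [h, d1, self_mem_nhdsWithin] with s g1 g2 hs
  have hs' : 0 < s := hs
  simp only [Real.norm_eq_abs, cs_zero, md_zero, sub_zero, smul_zero, abs_of_pos hs'] at g2
  have := le_abs_self (2 * cs κ s * u t + 2 * md κ s - 2 * u t - (2 * 1 * u t + 2 * 0 - 2 * u t))
  linarith

lemma fo_compare {f H : ℝ → ℝ} {t H' : ℝ} (hH : HasDerivAt H H' (f t))
    (hl : ∀ᶠ s in 𝓝[>] (0:ℝ), |f (t + s) - f t| ≤ s ∧ |f (t - s) - f t| ≤ s) {ε : ℝ} (hε : 0 < ε) :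
    ∀ᶠ s in 𝓝[>] (0:ℝ), |H (f (t + s)) - H (f t) - H' * (f (t + s) - f t)| ≤ ε * s ∧
      |H (f (t - s)) - H (f t) - H' * (f (t - s) - f t)| ≤ ε * s := by
  rw [hasDerivAt_iff_isLittleO] at hH
  obtain ⟨δ, hδ, h1⟩ := Metric.eventually_nhds_iff.1 (hH.def hε)
  filter_upwards [hl, Ioo_mem_nhdsGT hδ] with s ⟨g1, g2⟩ hs
  have a1 := h1 (y := f (t + s)) (by rw [Real.dist_eq]; linarith [hs.2])
  have a2 := h1 (y := f (t - s)) (by rw [Real.dist_eq]; linarith [hs.2])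
  simp only [Real.norm_eq_abs, smul_eq_mul] at a1 a2
  rw [mul_comm H', mul_comm H']
  exact ⟨a1.trans (by gcongr), a2.trans (by gcongr)⟩

lemma FO1.comp {f H : ℝ → ℝ} {t H' : ℝ} (hf : FO1 f t) (hH : HasDerivAt H H' (f t)) (hH' : 0 ≤ H')
    (hl : ∀ᶠ s in 𝓝[>] (0:ℝ), |f (t + s) - f t| ≤ s ∧ |f (t - s) - f t| ≤ s) :
    FO1 (fun y => H (f y)) t := by
  intro ε hε
  have e1 : 0 < ε / 2 / (H' + 1) := by positivity
  filter_upwards [hf _ e1, fo_compare hH hl (by positivity : 0 < ε / 4), self_mem_nhdsWithin]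
    with s g1 ⟨g2, g3⟩ hs
  have hs' : 0 < s := hs
  have a2 := (abs_le.1 g2).2
  have a3 := (abs_le.1 g3).2
  have h1 : H' * (f (t + s) + f (t - s) - 2 * f t) ≤ H' * (ε / 2 / (H' + 1) * s) :=
    mul_le_mul_of_nonneg_left g1 hH'
  have h2 : H' * (ε / 2 / (H' + 1) * s) ≤ ε / 2 * s := by
    have : H' * (ε / 2 / (H' + 1) * s) = (H' / (H' + 1)) * (ε / 2 * s) := by field_simp
    rw [this]
    have : H' / (H' + 1) ≤ 1 := by rw [div_le_one (by positivity)]; linarith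
    have h0 : 0 < ε / 2 * s := by positivity
    nlinarith
  linarith

lemma FO1.of_comp {f H : ℝ → ℝ} {t H' : ℝ} (hf : FO1 (fun y => H (f y)) t)
    (hH : HasDerivAt H H' (f t)) (hH' : 0 < H')
    (hl : ∀ᶠ s in 𝓝[>] (0:ℝ), |f (t + s) - f t| ≤ s ∧ |f (t - s) - f t| ≤ s) :
    FO1 f t := by
  intro ε hε
  filter_upwards [hf (ε * H' / 2) (by positivity),
    fo_compare hH hl (by positivity : 0 < ε * H' / 4), self_mem_nhdsWithin]
    with s g1 ⟨g2, g3⟩ hs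
  have hs' : 0 < s := hs
  have a2 := (abs_le.1 g2).1
  have a3 := (abs_le.1 g3).1
  apply le_of_mul_le_mul_left _ hH'
  linarith

/-- unit speed on `[a,b]` -/
def US (g : ℝ → Y) (a b : ℝ) : Prop :=
  ∀ s ∈ Set.Icc a b, ∀ t ∈ Set.Icc a b, dist (g s) (g t) = |s - t|

lemma US.mono {g : ℝ → Y} {a b a' b' : ℝ} (h : US g a b) (ha : a ≤ a') (hb : b' ≤ b) : US g a' b' :=
  fun s hs t ht => h s ⟨ha.trans hs.1, hs.2.trans hb⟩ t ⟨ha.trans ht.1, ht.2.trans hb⟩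

lemma US.near {g : ℝ → Y} {a b t0 : ℝ} (hg : US g a b) (ht : t0 ∈ Set.Ioo a b) :
    ∀ᶠ s in 𝓝[>] (0:ℝ), dist (g t0) (g (t0 + s)) = s ∧ dist (g t0) (g (t0 - s)) = s := by
  have hm : 0 < min (t0 - a) (b - t0) := by
    have := ht.1; have := ht.2
    exact lt_min (by linarith) (by linarith)
  filter_upwards [Ioo_mem_nhdsGT hm] with s hs
  obtain ⟨hs0, hs1⟩ := hs
  obtain ⟨h1, h2⟩ := lt_min_iff.1 hs1
  have i0 : t0 ∈ Set.Icc a b := Set.Ioo_subset_Icc_self ht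
  constructor
  · rw [hg _ i0 _ ⟨by linarith [ht.1], by linarith⟩, show t0 - (t0 + s) = -s by ring, abs_neg,
      abs_of_pos hs0]
  · rw [hg _ i0 _ ⟨by linarith, by linarith [ht.2]⟩, show t0 - (t0 - s) = s by ring, abs_of_pos hs0]

lemma US.lip {g : ℝ → Y} {a b t0 : ℝ} (hg : US g a b) (ht : t0 ∈ Set.Ioo a b) (z : Y) :
    ∀ᶠ s in 𝓝[>] (0:ℝ), |dist z (g (t0 + s)) - dist z (g t0)| ≤ s ∧
      |dist z (g (t0 - s)) - dist z (g t0)| ≤ s := by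
  filter_upwards [hg.near ht] with s ⟨h1, h2⟩
  constructor
  · have := abs_dist_sub_le (g (t0 + s)) (g t0) z
    rw [dist_comm (g (t0 + s)) z, dist_comm (g t0) z, dist_comm (g (t0 + s)) (g t0), h1] at this
    exact this
  · have := abs_dist_sub_le (g (t0 - s)) (g t0) z
    rw [dist_comm (g (t0 - s)) z, dist_comm (g t0) z, dist_comm (g (t0 - s)) (g t0), h2] at this
    exact this

lemma fo_regular (hgeo : IsGeodesicSpace Y) {g : ℝ → Y} {a b t0 : ℝ} (hg : US g a b)
    (ht : t0 ∈ Set.Ioo a b) {z : Y} (hz : z ≠ g t0) (hreg : Reg κ (g t0)) :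
    FO1 (fun t => dist z (g t)) t0 := by
  obtain ⟨r, hr, hS⟩ := hreg
  obtain ⟨r1, hr1, har1⟩ := exists_adm κ
  obtain ⟨h, hh⟩ := hgeo (g t0) z
  have d0 := dist_pos.2 hz.symm
  set c := min (dist (g t0) z) (min (r / 2) r1) with hc
  have hc0 : 0 < c := by positivity
  have hc1 : c ≤ dist (g t0) z := min_le_left _ _
  have hc2 : c ≤ r / 2 := (min_le_right _ _).trans (min_le_left _ _)
  have hc3 : c ≤ r1 := (min_le_right _ _).trans (min_le_right _ _)
  have e1 : dist (g t0) (h c) = c := hh.2.2.dist_zero hh.1 hc0.le hc1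
  have e2 : dist (h c) z = dist (g t0) z - c := by
    have := hh.2.2.dist_le hc0.le hc1 le_rfl
    rwa [hh.2.1] at this
  have so : SO2 κ (fun t => md κ (dist (h c) (g t))) t0 := by
    refine so2_of_posAt ht hg ⟨r, hr, fun y y' _ _ hb h1 h2 => ?_⟩
    exact hS y (by rwa [Metric.mem_ball']) _ (Metric.mem_ball_self hr) y' (by rwa [Metric.mem_ball'])
      (h c) (by rw [Metric.mem_ball']; linarith) hb
  have fo : FO1 (fun t => dist (h c) (g t)) t0 :=
    FO1.of_comp (H := md κ) so.fo1 (hasDerivAt_md κ _)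
      (by rw [dist_comm, e1]; exact sn_pos hc0 (har1.mono hc3)) (hg.lip ht _)
  intro ε hε
  filter_upwards [fo ε hε] with s hs
  have t1 := dist_triangle z (h c) (g (t0 + s))
  have t2 := dist_triangle z (h c) (g (t0 - s))
  rw [dist_comm z (h c)] at t1 t2
  rw [dist_comm (h c) (g t0)] at hs
  rw [dist_comm z (g t0)]
  linarith

lemma upper_aux {x : Y} (h g : ℝ → Y) : 0 ≤ upperAngle x h g ∧ ∀ η > 0, ∃ T > 0, ∀ t s : ℝ,
    0 < t → t < T → 0 < s → s < T → compAngleAt 0 x (h t) (g s) < upperAngle x h g + η := by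
  have b0 : ∀ y z : Y, 0 ≤ compAngleAt 0 x y z := fun y z => by
    rw [compAngleAt, compAngle_eq]; exact Real.arccos_nonneg _
  have b1 : ∀ y z : Y, compAngleAt 0 x y z ≤ Real.pi := fun y z => by
    rw [compAngleAt, compAngle_eq]; exact Real.arccos_le_pi _
  have bu : IsBoundedUnder (· ≤ ·) ((𝓝[>] (0:ℝ)) ×ˢ (𝓝[>] (0:ℝ)))
      (fun ts : ℝ × ℝ => compAngleAt 0 x (h ts.1) (g ts.2)) :=
    ⟨Real.pi, eventually_map.2 (Eventually.of_forall fun ts => b1 _ _)⟩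
  constructor
  · unfold upperAngle
    exact le_limsup_of_frequently_le (Eventually.of_forall fun ts => b0 _ _).frequently bu
  · intro η hη
    have hlt : limsup (fun ts : ℝ × ℝ => compAngleAt 0 x (h ts.1) (g ts.2))
        ((𝓝[>] (0:ℝ)) ×ˢ (𝓝[>] (0:ℝ))) < upperAngle x h g + η := by
      unfold upperAngle; linarith
    have ev := eventually_lt_of_limsup_lt hlt bu
    obtain ⟨pa, ha, pb, hb, hab⟩ := eventually_prod_iff.1 ev
    obtain ⟨T1, hT1, h1⟩ := mem_nhdsGT_iff_exists_Ioo_subset.1 ha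
    obtain ⟨T2, hT2, h2⟩ := mem_nhdsGT_iff_exists_Ioo_subset.1 hb
    refine ⟨min T1 T2, lt_min hT1 hT2, fun t s ht htT hs hsT => ?_⟩
    exact hab (h1 ⟨ht, htT.trans_le (min_le_left _ _)⟩) (h2 ⟨hs, hsT.trans_le (min_le_right _ _)⟩)

lemma cos_lower {θ α η : ℝ} (h0 : 0 ≤ θ) (hα : α ≤ Real.pi) (hη : 0 ≤ η) (h : θ < α + η) :
    Real.cos α - η ≤ Real.cos θ := by
  rcases le_total θ α with h1 | h1
  · have := Real.cos_le_cos_of_nonneg_of_le_pi h0 hα h1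
    linarith
  · have := Real.abs_cos_sub_cos_le θ α
    have h2 := (abs_le.1 this).1
    rw [abs_of_nonneg (by linarith)] at h2
    linarith

lemma side_bound {x z y : Y} {h : ℝ → Y} (hh : IsGeodesicFromTo x z h) {N s c : ℝ}
    (hN : 1 ≤ N) (hs : 0 < s) (hNs : N * s ≤ dist x z) (hy : dist x y = s) (hc : c ≤ 1)
    (hcos : c ≤ CC 0 (N * s) s (dist (h (N * s)) y)) :
    dist z y ≤ dist x z - s * c + s / (2 * N) := by
  have hNs0 : 0 < N * s := by positivity
  have hq := CC_mul (κ := 0) (a := N * s) (b := s) (c := dist (h (N * s)) y)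
    (by simpa [sn] using hNs0) (by simpa [sn] using hs)
  have h1 : c * (N * s * s) ≤ CC 0 (N * s) s (dist (h (N * s)) y) * (N * s * s) := by gcongr
  simp [sn, md] at hq
  rw [hq] at h1
  have h2 : dist (h (N * s)) y ^ 2 ≤ (s * (N - c + 1 / (2 * N))) ^ 2 := by
    have e : (s * (N - c + 1 / (2 * N))) ^ 2 = (N * s) ^ 2 + s ^ 2 - 2 * c * (N * s * s)
      + s ^ 2 * (c - 1 / (2 * N)) ^ 2 := by field_simp; ring
    rw [e]
    have : 0 ≤ s ^ 2 * (c - 1 / (2 * N)) ^ 2 := by positivity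
    linarith
  have h3 : dist (h (N * s)) y ≤ s * (N - c + 1 / (2 * N)) := by
    apply le_of_sq_le_sq h2
    have : 0 ≤ 1 / (2 * N) := by positivity
    exact mul_nonneg hs.le (by linarith)
  have h4 : dist (h (N * s)) z = dist x z - N * s := by
    have := hh.2.2.dist_le hNs0.le hNs le_rfl
    rwa [hh.2.1] at this
  have h5 := dist_triangle z (h (N * s)) y
  rw [dist_comm z (h (N * s))] at h5
  have h6 : s * (N - c + 1 / (2 * N)) = N * s - s * c + s / (2 * N) := by field_simp
  linarith

lemma fo_convex (hgeo : IsGeodesicSpace Y) {g : ℝ → Y} {a b t0 : ℝ} (hg : US g a b)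
    (ht : t0 ∈ Set.Ioo a b) {z : Y} (hz : z ≠ g t0) (hconv : IsConvexPoint (g t0)) :
    FO1 (fun t => dist z (g t)) t0 := by
  obtain ⟨h, hh⟩ := hgeo (g t0) z
  have hab : a ≤ b := by linarith [ht.1, ht.2]
  have dab : dist (g a) (g b) = b - a := by
    rw [hg _ ⟨le_rfl, hab⟩ _ ⟨hab, le_rfl⟩, abs_sub_comm, abs_of_nonneg (by linarith)]
  have H := hconv (g a) (g b) (fun t => g (a + t)) ⟨by simp, by rw [dab]; simp, by
    intro s hs t ht
    rw [dab] at hs ht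
    rw [hg _ ⟨by linarith [hs.1], by linarith [hs.2]⟩ _ ⟨by linarith [ht.1], by linarith [ht.2]⟩]
    congr 1; ring⟩ (t0 - a) ⟨by linarith [ht.1], by rw [dab]; linarith [ht.2]⟩ (by simp) z hz h hh
  have r1 : (fun t => g (a + (t0 - a - t))) = fun t => g (t0 - t) := by funext t; congr 1; ring
  have r2 : (fun t => g (a + (t0 - a + t))) = fun t => g (t0 + t) := by funext t; congr 1; ring
  simp only [r1, r2] at H
  set x := g t0 with hx
  have d0 := dist_pos.2 hz.symm
  obtain ⟨p1, p2⟩ := upper_aux (x := x) h (fun t => g (t0 - t))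
  obtain ⟨q1, q2⟩ := upper_aux (x := x) h (fun t => g (t0 + t))
  set α := upperAngle x h (fun t => g (t0 - t))
  set β := upperAngle x h (fun t => g (t0 + t))
  have hcos : 0 ≤ Real.cos α + Real.cos β := by
    have := Real.cos_le_cos_of_nonneg_of_le_pi p1 (by linarith : Real.pi - β ≤ Real.pi)
      (by linarith : α ≤ Real.pi - β)
    rw [Real.cos_pi_sub] at this
    linarith
  intro ε hε
  obtain ⟨T1, hT1, g1⟩ := p2 (ε / 4) (by positivity)
  obtain ⟨T2, hT2, g2⟩ := q2 (ε / 4) (by positivity)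
  set N := 1 + 2 / ε with hN
  have hN1 : 1 ≤ N := by rw [hN]; linarith [(by positivity : 0 < 2 / ε)]
  have hN2 : 1 / N ≤ ε / 2 := by
    rw [div_le_iff₀ (by linarith)]
    have : ε / 2 * N = ε / 2 + 1 := by rw [hN]; field_simp
    linarith
  have hm : 0 < min (dist x z) (min T1 T2) / N := by positivity
  filter_upwards [hg.near ht, Ioo_mem_nhdsGT hm] with s ⟨n1, n2⟩ hs
  obtain ⟨hs0, hs1⟩ := hs
  rw [lt_div_iff₀ (by linarith), lt_min_iff, lt_min_iff] at hs1
  obtain ⟨k1, k2, k3⟩ := hs1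
  have hNs : s ≤ N * s := by nlinarith
  have hNs0 : 0 < N * s := by linarith
  rw [mul_comm s N] at k1 k2 k3
  have nh : h (N * s) ≠ x := ne_of_dist_eq (hh.2.2.dist_zero hh.1 hNs0.le k1.le) hNs0
  have eh : dist x (h (N * s)) = N * s := hh.2.2.dist_zero hh.1 hNs0.le k1.le
  have adm0 : ∀ y : ℝ, Adm 0 y := fun y h => absurd h (lt_irrefl _)
  have side : ∀ y : Y, ∀ θ : ℝ, θ ≤ Real.pi → dist x y = s → compAngleAt 0 x (h (N * s)) y < θ + ε / 4 →
      dist z y ≤ dist x z - s * (Real.cos θ - ε / 4) + s / (2 * N) := by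
    intro y θ hθ hy hlt
    apply side_bound hh hN1 hs0 k1.le hy (by linarith [Real.cos_le_one θ])
    have hm := CC_mem nh (ne_of_dist_eq hy hs0) (adm0 _)
    have nn : 0 ≤ compAngleAt 0 x (h (N * s)) y := by
      rw [compAngleAt, compAngle_eq]; exact Real.arccos_nonneg _
    have := cos_lower nn hθ (by positivity) hlt
    rw [compAngleAt, compAngle_eq, Real.cos_arccos hm.1 hm.2, eh, hy] at this
    exact this
  have b1 := side (g (t0 - s)) α (by linarith) n2 (g1 _ _ hNs0 k2 hs0 (by linarith))
  have b2 := side (g (t0 + s)) β (by linarith) n1 (g2 _ _ hNs0 k3 hs0 (by linarith))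
  have e1 : s / (2 * N) + s / (2 * N) = s * (1 / N) := by field_simp; ring
  have e2 : s * (1 / N) ≤ s * (ε / 2) := by gcongr
  have e3 : 0 ≤ s * (Real.cos α + Real.cos β) := by positivity
  rw [dist_comm z x]
  nlinarith

end first_order

open Filter Topology

section nonbranching
variable {Y : Type*} [MetricSpace Y] {κ : ℝ}

/-- regular or convex points, non-regular ones isolated -/
structure Good (κ : ℝ) (Y : Type*) [MetricSpace Y] : Prop where
  rc : ∀ y : Y, Reg κ y ∨ IsConvexPoint y
  iso : ∀ y : Y, ∃ R > 0, ∀ z, z ≠ y → dist y z < R → Reg κ z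

lemma US.continuousOn {g : ℝ → Y} {a b : ℝ} (hg : US g a b) : ContinuousOn g (Set.Icc a b) := by
  have : LipschitzOnWith 1 g (Set.Icc a b) := by
    apply LipschitzOnWith.of_dist_le_mul
    intro s hs t ht
    rw [hg s hs t ht, Real.dist_eq]; simp
  exact this.continuousOn

lemma Good.fo (hG : Good κ Y) (hgeo : IsGeodesicSpace Y) {g : ℝ → Y} {a b t0 : ℝ} (hg : US g a b)
    (ht : t0 ∈ Set.Ioo a b) {z : Y} (hz : z ≠ g t0) : FO1 (fun t => dist z (g t)) t0 := by
  rcases hG.rc (g t0) with h | h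
  · exact fo_regular hgeo hg ht hz h
  · exact fo_convex hgeo hg ht hz h

lemma Good.fo_md (hG : Good κ Y) (hgeo : IsGeodesicSpace Y) {g : ℝ → Y} {a b t0 : ℝ} (hg : US g a b)
    (ht : t0 ∈ Set.Ioo a b) {z : Y} (hz : z ≠ g t0) (ha : Adm κ (dist z (g t0))) :
    FO1 (fun t => md κ (dist z (g t))) t0 :=
  (hG.fo hgeo hg ht hz).comp (H := md κ) (hasDerivAt_md κ _) (sn_nonneg dist_nonneg ha) (hg.lip ht z)

lemma so2_linear {f : ℝ → ℝ} {t0 c σ : ℝ} (hσ : σ = 1 ∨ σ = -1)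
    (h : ∀ᶠ t in 𝓝 t0, f t = |c + σ * t|) : SO2 κ (fun t => md κ (f t)) t0 := by
  have h0 := h.self_of_nhds
  have h1 : ∀ᶠ s in 𝓝[>] (0:ℝ), f (t0 + s) = |c + σ * (t0 + s)| := by
    have : Tendsto (fun s : ℝ => t0 + s) (𝓝[>] 0) (𝓝 t0) := by
      have : Tendsto (fun s : ℝ => t0 + s) (𝓝 0) (𝓝 (t0 + 0)) := (by fun_prop : Continuous (fun s : ℝ => t0 + s)).tendsto 0
      rw [add_zero] at this
      exact this.mono_left nhdsWithin_le_nhds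
    exact this.eventually h
  have h2 : ∀ᶠ s in 𝓝[>] (0:ℝ), f (t0 - s) = |c + σ * (t0 - s)| := by
    have : Tendsto (fun s : ℝ => t0 - s) (𝓝[>] 0) (𝓝 t0) := by
      have : Tendsto (fun s : ℝ => t0 - s) (𝓝 0) (𝓝 (t0 - 0)) := (by fun_prop : Continuous (fun s : ℝ => t0 - s)).tendsto 0
      rw [sub_zero] at this
      exact this.mono_left nhdsWithin_le_nhds
    exact this.eventually h
  filter_upwards [h1, h2] with s e1 e2
  simp only [e1, e2, h0, md_abs]
  apply le_of_eq
  rcases hσ with rfl | rfl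
  · rw [show c + 1 * (t0 + s) = (c + 1 * t0) + s by ring, show c + 1 * (t0 - s) = (c + 1 * t0) - s by ring,
      md_add, md_sub]; unfold cs; ring
  · rw [show c + -1 * (t0 + s) = (c + -1 * t0) - s by ring, show c + -1 * (t0 - s) = (c + -1 * t0) + s by ring,
      md_add, md_sub]; unfold cs; ring

lemma nb_local [ProperSpace Y] (hG : Good κ Y) (hgeo : IsGeodesicSpace Y) (b : Y) :
    ∃ r > 0, ∀ (g : ℝ → Y) (t0 L : ℝ) (y : Y), US g 0 L → t0 ∈ Set.Ioo 0 L → L < r → g t0 = b →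
      (∀ t ∈ Set.Icc 0 t0, dist y (g t) = L - t) → y = g L := by
  obtain ⟨R, hR, hreg⟩ := hG.iso b
  obtain ⟨r1, hr1, har1⟩ := exists_adm κ
  refine ⟨min (R / 2) (r1 / 2), by positivity, ?_⟩
  intro g t0 L y hg ht0 hL hgb hy
  obtain ⟨hL1, hL2⟩ := lt_min_iff.1 hL
  obtain ⟨h0, h0L⟩ := ht0
  have hL0 : 0 < L := h0.trans h0L
  have yb : dist y b = L - t0 := by rw [← hgb]; exact hy t0 ⟨h0.le, le_rfl⟩
  have fbd : ∀ t ∈ Set.Icc t0 L, dist y (g t) ≤ L - t0 + (t - t0) := by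
    intro t ht
    have h1 := dist_triangle y (g t0) (g t)
    rw [hg t0 ⟨h0.le, h0L.le⟩ t ⟨by linarith [ht.1], ht.2⟩, abs_sub_comm, abs_of_nonneg (by linarith [ht.1]),
      hy t0 ⟨h0.le, le_rfl⟩] at h1
    exact h1
  have hyb : y ≠ g t0 := by
    intro h; rw [hgb] at h; rw [h, dist_self] at yb; linarith
  have hfo := hG.fo hgeo hg ⟨h0, h0L⟩ hyb
  have fstrict : ∀ t ∈ Set.Ioc t0 L, dist y (g t) < L - t0 + (t - t0) := by
    intro t ht
    have ev := hfo 1 one_pos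
    obtain ⟨s, hs, hs2⟩ := (ev.and (Ioo_mem_nhdsGT (lt_min (sub_pos.2 ht.1) h0))).exists
    obtain ⟨hs0, hs1⟩ := hs2
    obtain ⟨hs1, hs3⟩ := lt_min_iff.1 hs1
    beta_reduce at hs
    rw [hy (t0 - s) ⟨by linarith, by linarith⟩, hy t0 ⟨h0.le, le_rfl⟩] at hs
    have h1 := dist_triangle y (g (t0 + s)) (g t)
    rw [hg (t0 + s) ⟨by linarith, by linarith [ht.2]⟩ t ⟨by linarith, ht.2⟩, abs_sub_comm,
      abs_of_nonneg (by linarith)] at h1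
    linarith
  have hcont : ContinuousOn (fun t => md κ (dist y (g t))) (Set.Icc 0 L) :=
    (continuous_md κ).comp_continuousOn (continuous_dist.comp_continuousOn (continuousOn_const.prodMk hg.continuousOn))
  have key := barrier (κ := κ) (u := fun t => md κ (dist y (g t))) hL0 (har1.mono (by linarith)) hcont
    (Set.countable_singleton t0) ?_ ?_ t0 ⟨h0.le, h0L.le⟩
  · simp only [Pos, hy 0 ⟨le_rfl, h0.le⟩, hy t0 ⟨h0.le, le_rfl⟩, sub_zero] at key
    have pl := pos_line κ t0 (L - t0) (-(L - t0))
    rw [show -(L - t0) - t0 = -L by ring, show -(L - t0) + (L - t0) = 0 by ring, md_neg, md_neg, md_zero] at pl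
    have h1 : sn κ t0 * md κ (dist y (g L)) ≤ 0 := by linarith
    have st : 0 < sn κ t0 := sn_pos h0 (har1.mono (by linarith))
    by_contra hne
    have := fbd L ⟨h0L.le, le_rfl⟩
    have := md_pos (dist_pos.2 hne) (har1.mono (by linarith))
    nlinarith
  · intro t ht htE
    have htE : t ≠ t0 := htE
    rcases lt_or_gt_of_ne htE with h | h
    · apply so2_linear (c := L) (σ := -1) (Or.inr rfl)
      filter_upwards [Ioo_mem_nhds ht.1 h] with u hu
      rw [hy u ⟨hu.1.le, hu.2.le⟩, abs_of_nonneg (by linarith [hu.2])]; ring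
    · apply so2_of_posAt ht hg
      have hb := fbd t ⟨h.le, ht.2.le⟩
      have hst := fstrict t ⟨h, ht.2.le⟩
      have dbt : dist b (g t) = t - t0 := by
        rw [← hgb, hg t0 ⟨h0.le, h0L.le⟩ t ⟨ht.1.le, ht.2.le⟩, abs_sub_comm, abs_of_pos (by linarith)]
      apply second_order hgeo
      · intro e
        rw [← e, dist_comm, yb] at dbt
        linarith [ht.2]
      · rw [dist_comm]; exact har1.mono (by linarith [ht.2])
      · intro z hz
        apply hreg z
        · rintro rfl
          rw [dist_comm, dbt, dist_comm, yb, dist_comm] at hz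
          linarith
        · have t1 := dist_triangle b (g t) z
          have t2 := dist_triangle b y z
          rw [dist_comm b y, yb, dist_comm y z] at t2
          rw [dist_comm y] at hb
          linarith [ht.2]
  · intro t ht htE
    have htE : t = t0 := htE
    subst htE
    apply hG.fo_md hgeo hg ht hyb
    rw [hgb, yb]; exact har1.mono (by linarith)

lemma nb_unit [ProperSpace Y] (hG : Good κ Y) (hgeo : IsGeodesicSpace Y) {G1 G2 : ℝ → Y} {T D : ℝ}
    (h1 : US G1 0 T) (h2 : US G2 0 T) (h0 : G1 0 = G2 0) (hD : 0 < D) (hDT : D ≤ T)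
    (hGD : G1 D = G2 D) : ∀ t ∈ Set.Icc D T, G1 t = G2 t := by
  have hcl : IsClosed ({t | G1 t = G2 t} ∩ Set.Icc D T) := by
    have c1 := (h1.mono hD.le le_rfl).continuousOn
    have c2 := (h2.mono hD.le le_rfl).continuousOn
    have : ({t | G1 t = G2 t} ∩ Set.Icc D T) = {t ∈ Set.Icc D T | dist (G1 t) (G2 t) = 0} := by
      ext t; simp [and_comm]
    rw [this]
    exact (continuous_dist.comp_continuousOn (c1.prodMk c2)).preimage_isClosed_of_isClosed isClosed_Icc isClosed_singleton
  refine hcl.Icc_subset_of_forall_exists_gt hGD ?_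
  intro τ hτ v hv
  have hv : τ < v := hv
  obtain ⟨hτ1, hτ2, hτ3⟩ := hτ
  have hτ1 : G1 τ = G2 τ := hτ1
  obtain ⟨r, hr, H⟩ := nb_local hG hgeo (G1 τ)
  set η := min D (r / 3) with hη
  have η0 : 0 < η := lt_min hD (by positivity)
  have η1 : η ≤ D := min_le_left _ _
  have η2 : η ≤ r / 3 := min_le_right _ _
  set ρ := min (min (v - τ) (T - τ)) (r / 3) with hρ
  have ρ0 : 0 < ρ := lt_min (lt_min (by linarith) (by linarith)) (by positivity)
  have ρ1 : ρ ≤ v - τ := (min_le_left _ _).trans (min_le_left _ _)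
  have ρ2 : ρ ≤ T - τ := (min_le_left _ _).trans (min_le_right _ _)
  have ρ3 : ρ ≤ r / 3 := min_le_right _ _
  have := H (fun t => G1 (τ - η + t)) η (η + ρ) (G2 (τ + ρ)) ?_ ⟨η0, by linarith⟩ (by linarith)
    (by simp) ?_
  · refine ⟨τ + ρ, ?_, by linarith, by linarith⟩
    show G1 _ = G2 _
    rw [this]; congr 1; ring
  · intro s hs t ht
    rw [h1 _ ⟨by linarith [hs.1], by linarith [hs.2]⟩ _ ⟨by linarith [ht.1], by linarith [ht.2]⟩]
    congr 1; ring
  · intro t ht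
    have i0 : (0:ℝ) ∈ Set.Icc 0 T := ⟨le_rfl, by linarith⟩
    have i1 : τ ∈ Set.Icc 0 T := ⟨by linarith, by linarith⟩
    have i2 : τ + ρ ∈ Set.Icc 0 T := ⟨by linarith, by linarith⟩
    have i3 : τ - η + t ∈ Set.Icc 0 T := ⟨by linarith [ht.1], by linarith [ht.2]⟩
    have t1 := dist_triangle (G2 (τ + ρ)) (G2 τ) (G1 (τ - η + t))
    rw [h2 _ i2 _ i1, ← hτ1, h1 _ i1 _ i3, abs_of_nonneg (by linarith), abs_of_nonneg (by linarith [ht.2])] at t1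
    have t2 := dist_triangle (G2 (τ + ρ)) (G1 (τ - η + t)) (G1 0)
    rw [h1 _ i3 _ i0, h0, h2 _ i2 _ i0, abs_of_nonneg (by linarith), abs_of_nonneg (by linarith [ht.1])] at t2
    linarith

lemma us_concat (hgeo : IsGeodesicSpace Y) {p a : Y} {h : ℝ → Y} (hh : IsGeodesicFromTo p a h) (x : Y)
    (hx : dist p a + dist a x = dist p x) : ∃ G : ℝ → Y, US G 0 (dist p x) ∧
      (∀ t ∈ Set.Icc 0 (dist p a), G t = h t) ∧ G (dist p x) = x := by
  obtain ⟨g, hg⟩ := hgeo a x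
  set D := dist p a with hD
  have D0 : 0 ≤ D := dist_nonneg
  have a0 : 0 ≤ dist a x := dist_nonneg
  have hB : ∀ t, D ≤ t → (if t ≤ D then h t else g (t - D)) = g (t - D) := by
    intro t ht
    split_ifs with h1
    · have : t = D := le_antisymm h1 ht
      rw [this, sub_self, hg.1, hh.2.1]
    · rfl
  have key : ∀ s ∈ Set.Icc 0 (dist p x), ∀ t ∈ Set.Icc 0 (dist p x), s ≤ t →
      dist (if s ≤ D then h s else g (s - D)) (if t ≤ D then h t else g (t - D)) = |s - t| := by
    intro s hs t ht hst
    by_cases h1 : t ≤ D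
    · rw [if_pos h1, if_pos (hst.trans h1)]
      exact hh.2.2 s ⟨hs.1, hst.trans h1⟩ t ⟨ht.1, h1⟩
    · push Not at h1
      rw [hB t h1.le]
      by_cases h2 : s ≤ D
      · rw [if_pos h2]
        have t1 := dist_triangle (h s) a (g (t - D))
        have e1 : dist (h s) a = D - s := by
          have := hh.2.2.dist_le hs.1 h2 le_rfl
          rwa [hh.2.1] at this
        have e2 : dist a (g (t - D)) = t - D :=
          hg.2.2.dist_zero hg.1 (by linarith) (by linarith [ht.2])
        have e3 : dist p (h s) = s := hh.2.2.dist_zero hh.1 hs.1 h2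
        have e4 : dist (g (t - D)) x = dist a x - (t - D) := by
          have := hg.2.2.dist_le (s := t - D) (by linarith) (by linarith [ht.2]) le_rfl
          rwa [hg.2.1] at this
        have t2 := dist_triangle4 p (h s) (g (t - D)) x
        rw [abs_sub_comm, abs_of_nonneg (by linarith)]
        linarith
      · push Not at h2
        rw [hB s h2.le, hg.2.2 (s - D) ⟨by linarith, by linarith [hs.2]⟩ (t - D) ⟨by linarith, by linarith [ht.2]⟩]
        congr 1; ring
  refine ⟨fun t => if t ≤ D then h t else g (t - D), ?_, ?_, ?_⟩
  · intro s hs t ht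
    rcases le_total s t with h1 | h1
    · exact key s hs t ht h1
    · rw [dist_comm, abs_sub_comm]; exact key t ht s hs h1
  · intro t ht; exact if_pos ht.2
  · show (if dist p x ≤ D then _ else _) = x
    rw [hB _ (by linarith), show dist p x - D = dist a x by linarith, hg.2.1]

lemma nb_aux [ProperSpace Y] (hG : Good κ Y) (hgeo : IsGeodesicSpace Y) {p a x y : Y} (hpa : p ≠ a)
    (hx : dist p a + dist a x = dist p x) (hy : dist p a + dist a y = dist p y)
    (hxy : dist p x ≤ dist p y) : dist x y = dist p y - dist p x := by
  obtain ⟨h, hh⟩ := hgeo p a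
  obtain ⟨G1, u1, v1, w1⟩ := us_concat hgeo hh x hx
  obtain ⟨G2, u2, v2, w2⟩ := us_concat hgeo hh y hy
  have D0 := dist_pos.2 hpa
  have a0 : 0 ≤ dist a x := dist_nonneg
  have := nb_unit hG hgeo u1 (u2.mono le_rfl hxy) (by rw [v1 0 ⟨le_rfl, D0.le⟩, v2 0 ⟨le_rfl, D0.le⟩]) D0
    (by linarith) (by rw [v1 _ ⟨D0.le, le_rfl⟩, v2 _ ⟨D0.le, le_rfl⟩]) (dist p x) ⟨by linarith, le_rfl⟩
  rw [w1] at this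
  have e : dist x y = dist (G2 (dist p x)) (G2 (dist p y)) := by rw [w2, ← this]
  rw [e, u2 _ ⟨dist_nonneg, hxy⟩ _ ⟨dist_nonneg, le_rfl⟩, abs_sub_comm, abs_of_nonneg (by linarith)]

lemma nb [ProperSpace Y] (hG : Good κ Y) (hgeo : IsGeodesicSpace Y) {p a x y : Y} (hpa : p ≠ a)
    (hx : dist p a + dist a x = dist p x) (hy : dist p a + dist a y = dist p y) :
    dist x y = |dist p x - dist p y| := by
  rcases le_total (dist p x) (dist p y) with h | h
  · rw [nb_aux hG hgeo hpa hx hy h, abs_sub_comm, abs_of_nonneg (by linarith)]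
  · rw [dist_comm, nb_aux hG hgeo hpa hy hx h, abs_of_nonneg (by linarith)]

end nonbranching

open Filter Topology

section global_pos
variable {Y : Type*} [MetricSpace Y] {κ : ℝ}

lemma US.lip_dist {g : ℝ → Y} {a b : ℝ} (hg : US g a b) (p : Y) {s t : ℝ} (hs : s ∈ Set.Icc a b)
    (ht : t ∈ Set.Icc a b) : |dist p (g s) - dist p (g t)| ≤ |s - t| := by
  rw [← hg s hs t ht, dist_comm p, dist_comm p]; exact abs_dist_sub_le _ _ _

lemma pos_on_line {σ : ℝ → Y} {L : ℝ} (hσ : US σ 0 L) {t1 : ℝ} (h1 : t1 ∈ Set.Icc 0 L) {t : ℝ}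
    (ht : t ∈ Set.Icc 0 L) : Pos κ t (L - t) (md κ (dist (σ t1) (σ 0))) (md κ (dist (σ t1) (σ t)))
      (md κ (dist (σ t1) (σ L))) := by
  have hL : 0 ≤ L := ht.1.trans ht.2
  unfold Pos
  rw [hσ _ h1 _ ⟨le_rfl, hL⟩, hσ _ h1 _ ht, hσ _ h1 _ ⟨hL, le_rfl⟩, md_abs, md_abs, md_abs]
  have := pos_line κ t (L - t) (t - t1)
  rw [show t - t1 - t = -(t1 - 0) by ring, show t - t1 + (L - t) = -(t1 - L) by ring, md_neg, md_neg,
    show t - t1 = -(t1 - t) by ring, md_neg] at this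
  exact this.le

lemma global_pos1 [ProperSpace Y] (hG : Good κ Y) (hgeo : IsGeodesicSpace Y)
    (hcount : {y : Y | ¬ Reg κ y}.Countable) {p : Y} (hp : Reg κ p) {σ : ℝ → Y} {L : ℝ} (hL : 0 < L)
    (hσ : US σ 0 L) (hadm : Adm κ ((dist p (σ 0) + L + dist p (σ L)) / 2))
    (hne : ∀ t ∈ Set.Icc 0 L, p ≠ σ t) :
    ∀ t ∈ Set.Icc 0 L, Pos κ t (L - t) (md κ (dist p (σ 0))) (md κ (dist p (σ t)))
      (md κ (dist p (σ L))) := by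
  have i0 : (0:ℝ) ∈ Set.Icc 0 L := ⟨le_rfl, hL.le⟩
  have iL : L ∈ Set.Icc 0 L := ⟨hL.le, le_rfl⟩
  have hf : ∀ t ∈ Set.Icc 0 L, Adm κ (dist p (σ t)) := by
    intro t ht
    apply hadm.mono
    have h1 := hσ.lip_dist p ht i0
    have h2 := hσ.lip_dist p ht iL
    rw [sub_zero, abs_of_nonneg ht.1] at h1
    rw [abs_sub_comm t L, abs_of_nonneg (a := L - t) (by linarith [ht.2])] at h2
    have := (abs_le.1 h1).2
    have := (abs_le.1 h2).2
    linarith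
  have hLa : Adm κ L := by
    apply hadm.mono
    have h1 := hσ.lip_dist p i0 iL
    have := dist_triangle (σ 0) p (σ L)
    rw [hσ _ i0 _ iL, zero_sub, abs_neg, abs_of_pos hL, dist_comm (σ 0)] at this
    linarith
  set T : Y → Set ℝ := fun a => {t ∈ Set.Icc 0 L | dist p a + dist a (σ t) = dist p (σ t)} with hT
  set E1 : Y → Set ℝ := fun a => {t ∈ T a | ∀ u ∈ T a, t ≤ u} with hE1
  set E2 : Y → Set ℝ := fun a => {t ∈ T a | ∀ u ∈ T a, u ≤ t} with hE2
  have c1 : ∀ a, (E1 a).Countable := fun a => Set.Subsingleton.countable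
    fun s hs t ht => le_antisymm (hs.2 t ht.1) (ht.2 s hs.1)
  have c2 : ∀ a, (E2 a).Countable := fun a => Set.Subsingleton.countable
    fun s hs t ht => le_antisymm (ht.2 s hs.1) (hs.2 t ht.1)
  have hE : (⋃ a ∈ {y : Y | ¬ Reg κ y}, (E1 a ∪ E2 a)).Countable :=
    hcount.biUnion fun a _ => (c1 a).union (c2 a)
  have hcont : ContinuousOn (fun t => md κ (dist p (σ t))) (Set.Icc 0 L) :=
    (continuous_md κ).comp_continuousOn (continuous_dist.comp_continuousOn (continuousOn_const.prodMk hσ.continuousOn))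
  refine barrier hL hLa hcont hE ?_ ?_
  · intro t ht htE
    have ht' : t ∈ Set.Icc 0 L := Set.Ioo_subset_Icc_self ht
    by_cases hex : ∃ a, ¬ Reg κ a ∧ t ∈ T a
    · obtain ⟨a, ha, hta⟩ := hex
      have n1 : ¬ t ∈ E1 a := fun h => htE (Set.mem_biUnion (show a ∈ {y : Y | ¬ Reg κ y} from ha) (Or.inl h))
      have n2 : ¬ t ∈ E2 a := fun h => htE (Set.mem_biUnion (show a ∈ {y : Y | ¬ Reg κ y} from ha) (Or.inr h))
      have m1 : ∃ t1 ∈ T a, t1 < t := by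
        by_contra! hc; exact n1 ⟨hta, hc⟩
      have m2 : ∃ t2 ∈ T a, t < t2 := by
        by_contra! hc; exact n2 ⟨hta, hc⟩
      obtain ⟨t1, h1, h1t⟩ := m1
      obtain ⟨t2, h2, h2t⟩ := m2
      have hpa : p ≠ a := by rintro rfl; exact ha hp
      have key := nb hG hgeo hpa h1.2 h2.2
      rw [hσ _ h1.1 _ h2.1, abs_sub_comm t1, abs_of_pos (by linarith)] at key
      have hu : ∀ u ∈ Set.Ioo t1 t2, |dist p (σ u) - dist p (σ t1)| ≤ u - t1 ∧
          |dist p (σ u) - dist p (σ t2)| ≤ t2 - u := by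
        intro u hu
        have hu' : u ∈ Set.Icc 0 L := ⟨by linarith [hu.1, h1.1.1], by linarith [hu.2, h2.1.2]⟩
        have a1 := hσ.lip_dist p hu' h1.1
        have a2 := hσ.lip_dist p hu' h2.1
        rw [abs_of_pos (a := u - t1) (by linarith [hu.1])] at a1
        rw [abs_sub_comm u, abs_of_pos (a := t2 - u) (by linarith [hu.2])] at a2
        exact ⟨a1, a2⟩
      rcases abs_choice (dist p (σ t1) - dist p (σ t2)) with hc | hc
      · apply so2_linear (c := dist p (σ t1) + t1) (σ := -1) (Or.inr rfl)
        filter_upwards [Ioo_mem_nhds h1t h2t] with u hu'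
        obtain ⟨a1, a2⟩ := hu u hu'
        have e : dist p (σ u) = dist p (σ t1) + t1 + -1 * u := by
          have := abs_le.1 a1; have := abs_le.1 a2; linarith
        rw [← e, abs_of_nonneg dist_nonneg]
      · apply so2_linear (c := dist p (σ t1) - t1) (σ := 1) (Or.inl rfl)
        filter_upwards [Ioo_mem_nhds h1t h2t] with u hu'
        obtain ⟨a1, a2⟩ := hu u hu'
        have e : dist p (σ u) = dist p (σ t1) - t1 + 1 * u := by
          have := abs_le.1 a1; have := abs_le.1 a2; linarith
        rw [← e, abs_of_nonneg dist_nonneg]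
    · push Not at hex
      apply so2_of_posAt ht hσ
      apply second_order hgeo (hne t ht')
      · rw [dist_comm]; exact hf t ht'
      · intro z hz
        by_contra hc
        apply hex z hc
        refine ⟨ht', ?_⟩
        rw [dist_comm p z, dist_comm z (σ t), dist_comm p (σ t)]; linarith
  · intro t ht _
    have ht' : t ∈ Set.Icc 0 L := Set.Ioo_subset_Icc_self ht
    exact hG.fo_md hgeo hσ ht (hne t ht') (hf t ht')

lemma global_pos [ProperSpace Y] (hG : Good κ Y) (hgeo : IsGeodesicSpace Y)
    (hcount : {y : Y | ¬ Reg κ y}.Countable) {p : Y} {σ : ℝ → Y} {L : ℝ} (hL : 0 < L)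
    (hσ : US σ 0 L) (hadm : Adm κ ((dist p (σ 0) + L + dist p (σ L)) / 2)) :
    ∀ t ∈ Set.Icc 0 L, Pos κ t (L - t) (md κ (dist p (σ 0))) (md κ (dist p (σ t)))
      (md κ (dist p (σ L))) := by
  intro t ht
  by_cases hne : ∃ t1 ∈ Set.Icc 0 L, p = σ t1
  · obtain ⟨t1, h1, rfl⟩ := hne
    exact pos_on_line hσ h1 ht
  push Not at hne
  obtain ⟨h, hh⟩ := hgeo p (σ 0)
  have hp0 : p ≠ σ 0 := hne 0 ⟨le_rfl, hL.le⟩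
  have D0 := dist_pos.2 hp0
  have hus : US h 0 (dist p (σ 0)) := hh.2.2
  have hcl : IsClosed (σ '' Set.Icc 0 L) := (isCompact_Icc.image_of_continuousOn hσ.continuousOn).isClosed
  have hpcl : p ∉ σ '' Set.Icc 0 L := by
    rintro ⟨u, hu, rfl⟩; exact hne u hu rfl
  obtain ⟨ε, hε, hball⟩ := Metric.isOpen_iff.1 hcl.isOpen_compl p hpcl
  obtain ⟨R, hR, hreg⟩ := hG.iso p
  obtain ⟨b, hb, hab⟩ := hadm.exists_gt
  set δ := min (min ε R) (min (dist p (σ 0)) (b - (dist p (σ 0) + L + dist p (σ L)) / 2)) with hδ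
  have δ0 : 0 < δ := lt_min (lt_min hε hR) (lt_min D0 (by linarith))
  have dh : ∀ s, 0 < s → s < δ → dist p (h s) = s := fun s h1 h2 =>
    hh.2.2.dist_zero hh.1 h1.le ((h2.trans_le ((min_le_right _ _).trans (min_le_left _ _))).le)
  have ev : ∀ᶠ s in 𝓝[>] (0:ℝ), Pos κ t (L - t) (md κ (dist (h s) (σ 0))) (md κ (dist (h s) (σ t)))
      (md κ (dist (h s) (σ L))) := by
    filter_upwards [Ioo_mem_nhdsGT δ0] with s hs
    have e := dh s hs.1 hs.2
    have s1 : s < ε := hs.2.trans_le ((min_le_left _ _).trans (min_le_left _ _))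
    have s2 : s < R := hs.2.trans_le ((min_le_left _ _).trans (min_le_right _ _))
    have s3 : s < b - (dist p (σ 0) + L + dist p (σ L)) / 2 :=
      hs.2.trans_le ((min_le_right _ _).trans (min_le_right _ _))
    refine global_pos1 hG hgeo hcount (hreg (h s) ?_ (by linarith)) hL hσ (hab.mono ?_) ?_ t ht
    · intro e1; rw [e1, dist_self] at e; linarith [hs.1]
    · have t1 := dist_triangle (h s) p (σ 0)
      have t2 := dist_triangle (h s) p (σ L)
      rw [dist_comm (h s) p] at t1 t2
      linarith
    · intro u hu e1
      have : h s ∈ Metric.ball p ε := by rw [Metric.mem_ball, dist_comm]; linarith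
      exact hball this ⟨u, hu, e1.symm⟩
  have lim : ∀ z, Tendsto (fun s => md κ (dist (h s) z)) (𝓝[>] 0) (𝓝 (md κ (dist p z))) := by
    intro z
    apply ((continuous_md κ).tendsto _).comp
    have : Tendsto h (𝓝[>] 0) (𝓝 p) := by
      rw [tendsto_iff_dist_tendsto_zero]
      have t0 : Tendsto (fun s : ℝ => s) (𝓝[>] 0) (𝓝 0) := tendsto_id.mono_left nhdsWithin_le_nhds
      refine t0.congr' ?_
      filter_upwards [Ioo_mem_nhdsGT δ0] with s hs
      rw [dist_comm, dh s hs.1 hs.2]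
    exact this.dist tendsto_const_nhds
  unfold Pos at ev ⊢
  refine le_of_tendsto_of_tendsto ?_ ?_ ev
  · exact ((lim _).const_mul _).add ((lim _).const_mul _)
  · exact (((lim _).const_mul _).add_const _).add_const _

lemma global_posAt [ProperSpace Y] (hG : Good κ Y) (hgeo : IsGeodesicSpace Y)
    (hcount : {y : Y | ¬ Reg κ y}.Countable) {x m y q : Y} (hm : dist x m + dist m y = dist x y)
    (hadm : Adm κ ((dist q x + dist x y + dist q y) / 2)) : PosAt κ x m y q := by
  rcases eq_or_ne x y with rfl | hxy
  · rw [dist_self, dist_comm m x] at hm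
    have : dist x m = 0 := by linarith [dist_nonneg (x := x) (y := m)]
    have := dist_eq_zero.1 this
    subst this
    simp [PosAt, Pos]
  · obtain ⟨h, hh⟩ := hgeo x m
    obtain ⟨G, u, v, w⟩ := us_concat hgeo hh y hm
    have e0 : G 0 = x := by rw [v 0 ⟨le_rfl, dist_nonneg⟩, hh.1]
    have em : G (dist x m) = m := by rw [v _ ⟨dist_nonneg, le_rfl⟩, hh.2.1]
    have := global_pos hG hgeo hcount (p := q) (dist_pos.2 hxy) u (by rw [e0, w]; exact hadm) (dist x m)
      ⟨dist_nonneg, by linarith [dist_nonneg (x := m) (y := y)]⟩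
    rw [e0, em, w, show dist x y - dist x m = dist m y by linarith, dist_comm q x, dist_comm q m,
      dist_comm q y] at this
    exact this

end global_pos

open Filter Topology

section final_part
variable {Y : Type*} [MetricSpace Y] {κ : ℝ}

lemma lim_sn {l : Filter ℝ} (hl : l ≤ 𝓝[>] 0) {d : ℝ → ℝ} {D : ℝ}
    (hd : Tendsto (fun s => d s / s) l (𝓝 D)) : Tendsto (fun s => sn κ (d s) / s) l (𝓝 D) := by
  have hpos : ∀ᶠ s in l, (0:ℝ) < s := hl self_mem_nhdsWithin
  have hid : Tendsto (fun s : ℝ => s) l (𝓝 0) := hl.trans nhdsWithin_le_nhds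
  have hd0 : Tendsto d l (𝓝 0) := by
    have := hd.mul hid
    rw [mul_zero] at this
    refine this.congr' ?_
    filter_upwards [hpos] with s hs
    field_simp
  have hc : Tendsto (dslope (sn κ) 0) (𝓝 0) (𝓝 1) := by
    have h1 : ContinuousAt (dslope (sn κ) 0) 0 :=
      continuousAt_dslope_same.2 (hasDerivAt_sn κ 0).differentiableAt
    have h2 := h1.tendsto
    rw [dslope_same, (hasDerivAt_sn κ 0).deriv, cs_zero] at h2
    exact h2
  have := hd.mul (hc.comp hd0)
  rw [mul_one] at this
  refine this.congr ?_
  intro s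
  have := sub_smul_dslope (sn κ) 0 (d s)
  rw [sub_zero, sn_zero, sub_zero, smul_eq_mul] at this
  simp only [Function.comp]
  rw [← this]; ring

lemma md_half (κ h : ℝ) : md κ h = 2 * sn κ (h / 2) ^ 2 := by
  have h1 := md_add κ (h / 2) (h / 2)
  have h2 := sn_sq κ (h / 2)
  rw [add_halves] at h1
  rw [h1]; linarith

lemma lim_md {l : Filter ℝ} (hl : l ≤ 𝓝[>] 0) {d : ℝ → ℝ} {D : ℝ}
    (hd : Tendsto (fun s => d s / s) l (𝓝 D)) : Tendsto (fun s => md κ (d s) / s ^ 2) l (𝓝 (D ^ 2 / 2)) := by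
  have h1 : Tendsto (fun s => (d s / 2) / s) l (𝓝 (D / 2)) := by
    refine (hd.div_const 2).congr fun s => ?_
    ring
  have h2 := ((lim_sn (κ := κ) hl h1).pow 2).const_mul 2
  rw [show 2 * (D / 2) ^ 2 = D ^ 2 / 2 by ring] at h2
  refine h2.congr fun s => ?_
  rw [md_half]; ring

lemma lim_num {l : Filter ℝ} (hl : l ≤ 𝓝[>] 0) {d : ℝ → ℝ} {D : ℝ} (lam : ℝ)
    (hd : Tendsto (fun s => d s / s) l (𝓝 D)) :
    Tendsto (fun s => (md κ (lam * s) + md κ s - κ * md κ (lam * s) * md κ s - md κ (d s)) / s ^ 2) l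
      (𝓝 (lam ^ 2 / 2 + 1 / 2 - D ^ 2 / 2)) ∧
    Tendsto (fun s => sn κ (lam * s) * sn κ s / s ^ 2) l (𝓝 lam) := by
  have hpos : ∀ᶠ s in l, (0:ℝ) < s := hl self_mem_nhdsWithin
  have hid : Tendsto (fun s : ℝ => s) l (𝓝 0) := hl.trans nhdsWithin_le_nhds
  have h1 : Tendsto (fun s : ℝ => lam * s / s) l (𝓝 lam) := by
    refine tendsto_const_nhds.congr' ?_
    filter_upwards [hpos] with s hs
    field_simp
  have h2 : Tendsto (fun s : ℝ => s / s) l (𝓝 1) := by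
    refine tendsto_const_nhds.congr' ?_
    filter_upwards [hpos] with s hs
    field_simp
  have m1 := lim_md (κ := κ) hl h1
  have m2 := lim_md (κ := κ) hl h2
  have m3 := lim_md (κ := κ) hl hd
  have m4 : Tendsto (fun s : ℝ => md κ s) l (𝓝 0) := by
    have := ((continuous_md κ).tendsto 0).comp hid
    rwa [md_zero] at this
  constructor
  · have := ((m1.add m2).sub ((m1.mul m4).const_mul κ)).sub m3
    rw [show lam ^ 2 / 2 + 1 ^ 2 / 2 - κ * (lam ^ 2 / 2 * 0) - D ^ 2 / 2
      = lam ^ 2 / 2 + 1 / 2 - D ^ 2 / 2 by ring] at this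
    refine this.congr fun s => ?_
    ring
  · have := (lim_sn (κ := κ) hl h1).mul (lim_sn (κ := κ) hl h2)
    rw [mul_one] at this
    refine this.congr fun s => ?_
    rw [div_mul_div_comm]; ring

lemma ultra_lim {l : Ultrafilter ℝ} (hl : (l : Filter ℝ) ≤ 𝓝[>] 0) {d : ℝ → ℝ} {c : ℝ}
    (h : ∀ᶠ s in 𝓝[>] (0:ℝ), 0 ≤ d s ∧ d s ≤ c * s) :
    ∃ D, 0 ≤ D ∧ Tendsto (fun s => d s / s) l (𝓝 D) := by
  have hm : (fun s => d s / s) ⁻¹' (Set.Icc 0 c) ∈ (l : Filter ℝ) := by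
    apply hl
    filter_upwards [h, self_mem_nhdsWithin] with s hs h0
    have h0 : 0 < s := h0
    exact ⟨div_nonneg hs.1 h0.le, by rw [div_le_iff₀ h0]; exact hs.2⟩
  obtain ⟨D, hD, h2⟩ := isCompact_Icc.ultrafilter_le_nhds (l.map (fun s => d s / s)) (by
    rw [le_principal_iff]; exact hm)
  exact ⟨D, hD.1, h2⟩

lemma planar_id {x y u v : ℝ} (h1 : x ^ 2 + y ^ 2 = 1) (h2 : u ^ 2 + v ^ 2 = 1) (h : 0 < x + u) :
    1 + ((x * v + y * u) / (x + u)) ^ 2 - 2 * ((x * v + y * u) / (x + u)) * y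
      = (x / (x + u)) ^ 2 * (2 - 2 * (y * v - x * u)) := by
  field_simp
  linear_combination (x ^ 2) * h2 - (u ^ 2 + 2 * x * u) * h1

lemma planar {α β : ℝ} (ha : 0 ≤ α) (hb : 0 ≤ β) (hab : α + β < Real.pi) :
    ∃ lam > 0, ∀ D2 D3 : ℝ, D2 ^ 2 ≤ 1 + lam ^ 2 - 2 * lam * Real.cos α →
      D3 ^ 2 ≤ 1 + lam ^ 2 - 2 * lam * Real.cos β → 0 ≤ D2 → 0 ≤ D3 →
      (D2 + D3) ^ 2 ≤ 2 - 2 * Real.cos (α + β) := by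
  have pp := Real.pi_pos
  rcases (add_nonneg ha hb).eq_or_lt with h0 | h0
  · have ea : α = 0 := by linarith
    have eb : β = 0 := by linarith
    subst ea; subst eb
    refine ⟨1, one_pos, fun D2 D3 h2 h3 _ _ => ?_⟩
    simp only [Real.cos_zero, add_zero] at *
    have e2 : D2 = 0 := by
      have : D2 ^ 2 ≤ 0 := by linarith
      exact pow_eq_zero_iff (two_ne_zero) |>.1 (le_antisymm this (sq_nonneg _))
    have e3 : D3 = 0 := by
      have : D3 ^ 2 ≤ 0 := by linarith
      exact pow_eq_zero_iff (two_ne_zero) |>.1 (le_antisymm this (sq_nonneg _))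
    rw [e2, e3]; norm_num
  · have sa : 0 ≤ Real.sin α := Real.sin_nonneg_of_nonneg_of_le_pi ha (by linarith)
    have sb : 0 ≤ Real.sin β := Real.sin_nonneg_of_nonneg_of_le_pi hb (by linarith)
    have sab : 0 < Real.sin α + Real.sin β := by
      rcases ha.eq_or_lt with h | h
      · have := Real.sin_pos_of_pos_of_lt_pi (x := β) (by linarith) (by linarith)
        linarith
      · have := Real.sin_pos_of_pos_of_lt_pi (x := α) h (by linarith)
        linarith
    have i1 := planar_id (Real.sin_sq_add_cos_sq α) (Real.sin_sq_add_cos_sq β) sab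
    have i2 := planar_id (Real.sin_sq_add_cos_sq β) (Real.sin_sq_add_cos_sq α) (by linarith)
    have sp := Real.sin_pos_of_pos_of_lt_pi h0 hab
    rw [Real.sin_add] at sp
    have e2 : Real.sin β * Real.cos α + Real.cos β * Real.sin α
      = Real.sin α * Real.cos β + Real.cos α * Real.sin β := by ring
    rw [e2, add_comm (Real.sin β), mul_comm (Real.cos β) (Real.cos α),
      mul_comm (Real.sin β) (Real.sin α)] at i2
    refine ⟨_, div_pos sp sab, fun D2 D3 h2 h3 n2 n3 => ?_⟩
    rw [i1, ← Real.cos_add] at h2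
    rw [i2, ← Real.cos_add] at h3
    have hC : 0 ≤ 2 - 2 * Real.cos (α + β) := by linarith [Real.cos_le_one (α + β)]
    rw [← Real.sq_sqrt hC, ← mul_pow] at h2 h3
    set C := Real.sqrt (2 - 2 * Real.cos (α + β)) with hCdef
    have C0 : 0 ≤ C := Real.sqrt_nonneg _
    have k2 : D2 ≤ Real.sin α / (Real.sin α + Real.sin β) * C := le_of_sq_le_sq h2 (by positivity)
    have k3 : D3 ≤ Real.sin β / (Real.sin α + Real.sin β) * C := le_of_sq_le_sq h3 (by positivity)
    have e : Real.sin α / (Real.sin α + Real.sin β) * C + Real.sin β / (Real.sin α + Real.sin β) * C = C := by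
      field_simp
    rw [← Real.sq_sqrt hC]
    have : D2 + D3 ≤ C := by linarith
    gcongr

lemma side_ev [ProperSpace Y] (hG : Good κ Y) (hgeo : IsGeodesicSpace Y)
    (hcount : {y : Y | ¬ Reg κ y}.Countable) {x q1 q2 : Y} {γm η : ℝ → Y} {τ lam : ℝ} (hτ : 0 < τ)
    (hlam : 0 < lam) (hγ1 : ∀ t ∈ Set.Icc 0 τ, dist x (γm t) = t)
    (hγ2 : ∀ t ∈ Set.Icc 0 τ, dist (γm t) q1 = t + dist x q1) (hη : IsGeodesicFromTo x q2 η)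
    (h1 : q1 ≠ x) (h2 : q2 ≠ x) (hadm : Adm κ ((dist x q1 + dist x q2 + dist q1 q2) / 2))
    (hadm2 : Adm κ (τ + dist x q1)) :
    ∀ᶠ s in 𝓝[>] (0:ℝ), -CA κ x q1 q2 ≤ CC κ (lam * s) s (dist (γm (lam * s)) (η s)) := by
  obtain ⟨b, hb, hab⟩ := hadm2.exists_gt
  have d1 := dist_pos.2 h1.symm
  have d2 := dist_pos.2 h2.symm
  have hδ : 0 < min (min (τ / lam) (b - (τ + dist x q1))) (dist x q2) :=
    lt_min (lt_min (by positivity) (by linarith)) d2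
  filter_upwards [Ioo_mem_nhdsGT hδ] with s hs
  obtain ⟨hs0, hs⟩ := hs
  obtain ⟨hs, hs3⟩ := lt_min_iff.1 hs
  obtain ⟨hs1, hs2⟩ := lt_min_iff.1 hs
  rw [lt_div_iff₀ hlam] at hs1
  have ls0 : 0 < lam * s := by positivity
  have ls : lam * s ∈ Set.Icc 0 τ := ⟨ls0.le, by linarith⟩
  have e1 := hγ1 _ ls
  have e2 := hγ2 _ ls
  have e3 : dist x (η s) = s := hη.2.2.dist_zero hη.1 hs0.le hs3.le
  have e4 : dist (η s) q2 = dist x q2 - s := by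
    have := hη.2.2.dist_le hs0.le hs3.le le_rfl
    rwa [hη.2.1] at this
  have ne1 : γm (lam * s) ≠ x := ne_of_dist_eq e1 ls0
  have ne2 : η s ≠ x := ne_of_dist_eq e3 hs0
  have tr := dist_triangle q1 x q2
  have P1 : PosAt κ x (η s) q2 q1 := global_posAt hG hgeo hcount (by rw [e3, e4]; ring) (by
    apply hadm.mono; rw [dist_comm q1 x])
  have a1 : Adm κ (dist x q1) := hadm2.mono (by linarith)
  have a2 : Adm κ (dist x q2) := by
    have := dist_triangle x q1 q2
    exact hadm.mono (by linarith)
  rw [posAt_iff_mono (by rw [e3, e4]; ring) ne2 h1 a2 a1] at P1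
  have P2 : PosAt κ (γm (lam * s)) x q1 (η s) := global_posAt hG hgeo hcount
    (by rw [dist_comm _ x, e1, e2]) (by
      apply hab.mono
      have t1 := dist_triangle (η s) x (γm (lam * s))
      have t2 := dist_triangle (η s) x q1
      rw [dist_comm (η s) x] at t1 t2
      linarith)
  have as : Adm κ s := a2.mono hs3.le
  rw [posAt_iff_sum ne1 h1 ne2 (by rw [e1]; exact hadm2.mono (by linarith)) a1 (by rw [e3]; exact as)] at P2
  have e5 : CA κ x (γm (lam * s)) (η s) = CC κ (lam * s) s (dist (γm (lam * s)) (η s)) := by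
    unfold CA; rw [e1, e3]
  rw [e5, CA_comm x q1 (η s)] at P2
  rw [CA_comm x q1 q2]
  linarith

lemma third_ev [ProperSpace Y] (hG : Good κ Y) (hgeo : IsGeodesicSpace Y)
    (hcount : {y : Y | ¬ Reg κ y}.Countable) {x q2 q3 : Y} {η2 η3 : ℝ → Y}
    (hη2 : IsGeodesicFromTo x q2 η2) (hη3 : IsGeodesicFromTo x q3 η3)
    (h2 : q2 ≠ x) (h3 : q3 ≠ x) (hadm : Adm κ ((dist x q2 + dist x q3 + dist q2 q3) / 2)) :
    ∀ᶠ s in 𝓝[>] (0:ℝ), CC κ (1 * s) s (dist (η2 s) (η3 s)) ≤ CA κ x q2 q3 := by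
  have d2 := dist_pos.2 h2.symm
  have d3 := dist_pos.2 h3.symm
  have a2 : Adm κ (dist x q2) := by
    have := dist_triangle x q3 q2
    rw [dist_comm q3] at this
    exact hadm.mono (by linarith)
  have a3 : Adm κ (dist x q3) := by
    have := dist_triangle x q2 q3
    exact hadm.mono (by linarith)
  filter_upwards [Ioo_mem_nhdsGT (lt_min d2 d3)] with s hs
  obtain ⟨hs0, hs⟩ := hs
  obtain ⟨hs2, hs3⟩ := lt_min_iff.1 hs
  have e2 : dist x (η2 s) = s := hη2.2.2.dist_zero hη2.1 hs0.le hs2.le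
  have f2 : dist (η2 s) q2 = dist x q2 - s := by
    have := hη2.2.2.dist_le hs0.le hs2.le le_rfl
    rwa [hη2.2.1] at this
  have e3 : dist x (η3 s) = s := hη3.2.2.dist_zero hη3.1 hs0.le hs3.le
  have f3 : dist (η3 s) q3 = dist x q3 - s := by
    have := hη3.2.2.dist_le hs0.le hs3.le le_rfl
    rwa [hη3.2.1] at this
  have n2 : η2 s ≠ x := ne_of_dist_eq e2 hs0
  have n3 : η3 s ≠ x := ne_of_dist_eq e3 hs0
  have P1 : PosAt κ x (η2 s) q2 (η3 s) := global_posAt hG hgeo hcount (by rw [e2, f2]; ring) (by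
    apply hadm.mono
    have t1 := dist_triangle (η3 s) q3 q2
    rw [dist_comm (η3 s) x]
    rw [dist_comm q3 q2] at t1
    linarith)
  have P2 : PosAt κ x (η3 s) q3 q2 := global_posAt hG hgeo hcount (by rw [e3, f3]; ring) (by
    apply hadm.mono
    rw [dist_comm q2 x])
  rw [posAt_iff_mono (by rw [e2, f2]; ring) n2 n3 a2 (by rw [e3]; exact a3.mono hs3.le)] at P1
  rw [posAt_iff_mono (by rw [e3, f3]; ring) n3 h2 a3 a2] at P2
  have e5 : CA κ x (η2 s) (η3 s) = CC κ (1 * s) s (dist (η2 s) (η3 s)) := by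
    unfold CA; rw [e2, e3, one_mul]
  rw [← e5]
  rw [CA_comm x (η3 s) q2, CA_comm x q3 q2] at P2
  linarith

lemma quad_at [ProperSpace Y] (hG : Good κ Y) (hgeo : IsGeodesicSpace Y)
    (hcount : {y : Y | ¬ Reg κ y}.Countable) {x q1 q2 q3 : Y} {γm : ℝ → Y} {τ : ℝ} (hτ : 0 < τ)
    (hγ1 : ∀ t ∈ Set.Icc 0 τ, dist x (γm t) = t)
    (hγ2 : ∀ t ∈ Set.Icc 0 τ, dist (γm t) q1 = t + dist x q1)
    (h1 : q1 ≠ x) (h2 : q2 ≠ x) (h3 : q3 ≠ x)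
    (hadm12 : Adm κ ((dist x q1 + dist x q2 + dist q1 q2) / 2))
    (hadm13 : Adm κ ((dist x q1 + dist x q3 + dist q1 q3) / 2))
    (hadm23 : Adm κ ((dist x q2 + dist x q3 + dist q2 q3) / 2))
    (hadm2 : Adm κ (τ + dist x q1)) :
    Real.arccos (CA κ x q1 q2) + Real.arccos (CA κ x q1 q3) + Real.arccos (CA κ x q2 q3)
      ≤ 2 * Real.pi := by
  set α := Real.pi - Real.arccos (CA κ x q1 q2) with hα
  set β := Real.pi - Real.arccos (CA κ x q1 q3) with hβ
  have α0 : 0 ≤ α := by linarith [Real.arccos_le_pi (CA κ x q1 q2)]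
  have β0 : 0 ≤ β := by linarith [Real.arccos_le_pi (CA κ x q1 q3)]
  have cα : Real.cos α = -CA κ x q1 q2 := by
    obtain ⟨m1, m2⟩ := CC_mem h1 h2 hadm12
    rw [hα, Real.cos_pi_sub, CA, Real.cos_arccos m1 m2]
  have cβ : Real.cos β = -CA κ x q1 q3 := by
    obtain ⟨m1, m2⟩ := CC_mem h1 h3 hadm13
    rw [hβ, Real.cos_pi_sub, CA, Real.cos_arccos m1 m2]
  by_cases hab : Real.pi ≤ α + β
  · linarith [Real.arccos_le_pi (CA κ x q2 q3)]
  push Not at hab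
  obtain ⟨lam, hlam, hpl⟩ := planar α0 β0 hab
  obtain ⟨η2, hη2⟩ := hgeo x q2
  obtain ⟨η3, hη3⟩ := hgeo x q3
  have ev2 := side_ev hG hgeo hcount hτ hlam hγ1 hγ2 hη2 h1 h2 hadm12 hadm2
  have ev3 := side_ev hG hgeo hcount hτ hlam hγ1 hγ2 hη3 h1 h3 hadm13 hadm2
  have ev23 := third_ev hG hgeo hcount hη2 hη3 h2 h3 hadm23
  obtain ⟨r1, hr1, har1⟩ := exists_adm κ
  have d2 := dist_pos.2 h2.symm
  have d3 := dist_pos.2 h3.symm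
  have hδ : 0 < min (min (τ / lam) (r1 / lam)) (min r1 (min (dist x q2) (dist x q3))) := by
    have : 0 < τ / lam := by positivity
    have : 0 < r1 / lam := by positivity
    simp [*]
  have evb : ∀ᶠ s in 𝓝[>] (0:ℝ), 0 < sn κ (lam * s) ∧ 0 < sn κ s ∧
      dist (γm (lam * s)) (η2 s) ≤ (lam + 1) * s ∧ dist (γm (lam * s)) (η3 s) ≤ (lam + 1) * s ∧
      dist (η2 s) (η3 s) ≤ 2 * s := by
    filter_upwards [Ioo_mem_nhdsGT hδ] with s hs
    obtain ⟨hs0, hs⟩ := hs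
    simp only [lt_min_iff, lt_div_iff₀ hlam] at hs
    obtain ⟨⟨g1, g2⟩, g3, g4, g5⟩ := hs
    have ls : 0 < lam * s := by positivity
    have e1 := hγ1 (lam * s) ⟨ls.le, by linarith⟩
    have e2 : dist x (η2 s) = s := hη2.2.2.dist_zero hη2.1 hs0.le g4.le
    have e3 : dist x (η3 s) = s := hη3.2.2.dist_zero hη3.1 hs0.le g5.le
    refine ⟨sn_pos ls (har1.mono (by linarith)), sn_pos hs0 (har1.mono g3.le), ?_, ?_, ?_⟩
    · have := dist_triangle (γm (lam * s)) x (η2 s)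
      rw [dist_comm _ x] at this; linarith
    · have := dist_triangle (γm (lam * s)) x (η3 s)
      rw [dist_comm _ x] at this; linarith
    · have := dist_triangle (η2 s) x (η3 s)
      rw [dist_comm _ x] at this; linarith
  set l : Ultrafilter ℝ := Ultrafilter.of (𝓝[>] (0:ℝ)) with hl
  have hl0 : (l : Filter ℝ) ≤ 𝓝[>] 0 := Ultrafilter.of_le _
  obtain ⟨D2, D20, hD2⟩ := ultra_lim (l := l) hl0 (d := fun s => dist (γm (lam * s)) (η2 s))
    (c := lam + 1) (evb.mono fun s hs => ⟨dist_nonneg, hs.2.2.1⟩)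
  obtain ⟨D3, D30, hD3⟩ := ultra_lim (l := l) hl0 (d := fun s => dist (γm (lam * s)) (η3 s))
    (c := lam + 1) (evb.mono fun s hs => ⟨dist_nonneg, hs.2.2.2.1⟩)
  obtain ⟨D23, D230, hD23⟩ := ultra_lim (l := l) hl0 (d := fun s => dist (η2 s) (η3 s))
    (c := 2) (evb.mono fun s hs => ⟨dist_nonneg, hs.2.2.2.2⟩)
  have k2 : Real.cos α * lam ≤ lam ^ 2 / 2 + 1 / 2 - D2 ^ 2 / 2 := by
    obtain ⟨m1, m2⟩ := lim_num (κ := κ) hl0 lam hD2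
    refine le_of_tendsto_of_tendsto (m2.const_mul (Real.cos α)) m1 ?_
    refine hl0 ?_
    filter_upwards [ev2, evb, self_mem_nhdsWithin] with s g1 g2 g3
    have g3 : 0 < s := g3
    rw [← CC_mul g2.1 g2.2.1, cα, ← mul_div_assoc]
    have := mul_pos g2.1 g2.2.1
    gcongr
  have k3 : Real.cos β * lam ≤ lam ^ 2 / 2 + 1 / 2 - D3 ^ 2 / 2 := by
    obtain ⟨m1, m2⟩ := lim_num (κ := κ) hl0 lam hD3
    refine le_of_tendsto_of_tendsto (m2.const_mul (Real.cos β)) m1 ?_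
    refine hl0 ?_
    filter_upwards [ev3, evb, self_mem_nhdsWithin] with s g1 g2 g3
    have g3 : 0 < s := g3
    rw [← CC_mul g2.1 g2.2.1, cβ, ← mul_div_assoc]
    have := mul_pos g2.1 g2.2.1
    gcongr
  have k23 : 1 ^ 2 / 2 + 1 / 2 - D23 ^ 2 / 2 ≤ CA κ x q2 q3 * 1 := by
    obtain ⟨m1, m2⟩ := lim_num (κ := κ) hl0 1 hD23
    refine le_of_tendsto_of_tendsto m1 (m2.const_mul (CA κ x q2 q3)) ?_
    refine hl0 ?_
    filter_upwards [ev23, evb, self_mem_nhdsWithin] with s g1 g2 g3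
    have g3 : 0 < s := g3
    have s1 : 0 < sn κ (1 * s) := by rw [one_mul]; exact g2.2.1
    rw [← CC_mul s1 g2.2.1, ← mul_div_assoc]
    have := mul_pos s1 g2.2.1
    gcongr
  have ktri : D23 ≤ D2 + D3 := by
    refine le_of_tendsto_of_tendsto hD23 (hD2.add hD3) ?_
    refine hl0 ?_
    filter_upwards [self_mem_nhdsWithin] with s g3
    have g3 : 0 < s := g3
    rw [← add_div]
    have := dist_triangle_left (η2 s) (η3 s) (γm (lam * s))
    gcongr
  have kf := hpl D2 D3 (by linarith) (by linarith) D20 D30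
  have : D23 ^ 2 ≤ (D2 + D3) ^ 2 := by gcongr
  have hcos : Real.cos (α + β) ≤ CA κ x q2 q3 := by linarith
  have := Real.arccos_le_arccos hcos
  rw [Real.arccos_cos (by linarith) hab.le] at this
  linarith

lemma quad_global [ProperSpace Y] (hG : Good κ Y) (hgeo : IsGeodesicSpace Y)
    (hcount : {y : Y | ¬ Reg κ y}.Countable) {p q1 q2 q3 : Y} (h1 : q1 ≠ p) (h2 : q2 ≠ p) (h3 : q3 ≠ p)
    (hadm12 : Adm κ ((dist p q1 + dist p q2 + dist q1 q2) / 2))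
    (hadm13 : Adm κ ((dist p q1 + dist p q3 + dist q1 q3) / 2))
    (hadm23 : Adm κ ((dist p q2 + dist p q3 + dist q2 q3) / 2)) :
    Real.arccos (CA κ p q1 q2) + Real.arccos (CA κ p q1 q3) + Real.arccos (CA κ p q2 q3)
      ≤ 2 * Real.pi := by
  obtain ⟨γ, hγ⟩ := hgeo p q1
  have d1 := dist_pos.2 h1.symm
  have d2 := dist_pos.2 h2.symm
  have d3 := dist_pos.2 h3.symm
  obtain ⟨b12, hb12, a12⟩ := hadm12.exists_gt
  obtain ⟨b13, hb13, a13⟩ := hadm13.exists_gt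
  obtain ⟨b23, hb23, a23⟩ := hadm23.exists_gt
  have dγ : ∀ t, 0 < t → t < dist p q1 → dist p (γ t) = t := fun t x y =>
    hγ.2.2.dist_zero hγ.1 x.le y.le
  have ap1 : Adm κ (dist p q1) := by
    have := dist_triangle_right p q1 q2
    exact hadm12.mono (by linarith)
  have ap2 : Adm κ (dist p q2) := by
    have := dist_triangle p q1 q2
    exact hadm12.mono (by linarith)
  have ap3 : Adm κ (dist p q3) := by
    have := dist_triangle p q1 q3
    exact hadm13.mono (by linarith)
  have limγ : Tendsto γ (𝓝[>] 0) (𝓝 p) := by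
    rw [tendsto_iff_dist_tendsto_zero]
    have t0 : Tendsto (fun s : ℝ => s) (𝓝[>] 0) (𝓝 0) := tendsto_id.mono_left nhdsWithin_le_nhds
    refine t0.congr' ?_
    filter_upwards [Ioo_mem_nhdsGT d1] with s hs
    rw [dist_comm, dγ s hs.1 hs.2]
  have limCA : ∀ y z, y ≠ p → z ≠ p → Adm κ (dist p y) → Adm κ (dist p z) →
      Tendsto (fun t => Real.arccos (CA κ (γ t) y z)) (𝓝[>] 0) (𝓝 (Real.arccos (CA κ p y z))) := by
    intro y z hy hz ay az
    refine (Real.continuous_arccos.tendsto _).comp ?_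
    have ty : Tendsto (fun t => dist (γ t) y) (𝓝[>] 0) (𝓝 (dist p y)) := limγ.dist tendsto_const_nhds
    have tz : Tendsto (fun t => dist (γ t) z) (𝓝[>] 0) (𝓝 (dist p z)) := limγ.dist tendsto_const_nhds
    have my := ((continuous_md κ).tendsto _).comp ty
    have mz := ((continuous_md κ).tendsto _).comp tz
    have sy := ((continuous_sn κ).tendsto _).comp ty
    have sz := ((continuous_sn κ).tendsto _).comp tz
    have p1 := sn_pos (dist_pos.2 hy.symm) ay
    have p2 := sn_pos (dist_pos.2 hz.symm) az
    exact (((my.add mz).sub ((my.const_mul κ).mul mz)).sub_const _).div (sy.mul sz) (mul_pos p1 p2).ne'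
  refine le_of_tendsto (((limCA q1 q2 h1 h2 ap1 ap2).add (limCA q1 q3 h1 h3 ap1 ap3)).add
    (limCA q2 q3 h2 h3 ap2 ap3)) ?_
  have hδ : 0 < min (min (dist p q1) (min (dist p q2) (dist p q3)))
    (min (b12 - (dist p q1 + dist p q2 + dist q1 q2) / 2)
      (min (b13 - (dist p q1 + dist p q3 + dist q1 q3) / 2)
        (b23 - (dist p q2 + dist p q3 + dist q2 q3) / 2))) :=
    lt_min (lt_min d1 (lt_min d2 d3)) (lt_min (by linarith) (lt_min (by linarith) (by linarith)))
  filter_upwards [Ioo_mem_nhdsGT hδ] with τ hτ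
  obtain ⟨τ0, hτ⟩ := hτ
  simp only [lt_min_iff] at hτ
  obtain ⟨⟨g1, g2, g3⟩, g4, g5, g6⟩ := hτ
  have e := dγ τ τ0 g1
  have e1 : dist (γ τ) q1 = dist p q1 - τ := by
    have := hγ.2.2.dist_le τ0.le g1.le le_rfl
    rwa [hγ.2.1] at this
  have nn : ∀ q, τ < dist p q → q ≠ γ τ := by
    rintro q hq rfl; linarith
  have tr : ∀ q, dist (γ τ) q ≤ τ + dist p q := by
    intro q
    have := dist_triangle (γ τ) p q
    rw [dist_comm (γ τ) p, e] at this
    exact this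
  have t1 := tr q1
  have t2 := tr q2
  have t3 := tr q3
  refine quad_at hG hgeo hcount (γm := fun t => γ (τ - t)) τ0 ?_ ?_ (nn _ g1) (nn _ g2) (nn _ g3)
    (a12.mono (by linarith)) (a13.mono (by linarith)) (a23.mono (by linarith))
    (by rw [e1]; exact ap1.mono (by linarith))
  · intro t ht
    rw [hγ.2.2 τ ⟨τ0.le, g1.le⟩ (τ - t) ⟨by linarith [ht.2], by linarith [ht.1]⟩,
      show τ - (τ - t) = t by ring, abs_of_nonneg ht.1]
  · intro t ht
    have := hγ.2.2.dist_le (s := τ - t) (by linarith [ht.2]) (by linarith [ht.1]) le_rfl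
    rw [hγ.2.1] at this
    rw [this, e1]; ring

end final_part

open Filter Topology

lemma reg_of_domain {Y : Type*} [MetricSpace Y] {κ : ℝ} {y : Y} {U : Set Y}
    (hU : IsKappaDomain κ U) (hy : y ∈ U) : Reg κ y := by
  obtain ⟨ε, hε, hb⟩ := Metric.isOpen_iff.1 hU.1 y hy
  obtain ⟨r1, hr1, har1⟩ := exists_adm κ
  refine ⟨min ε (r1 / 3), lt_min hε (by positivity), ?_⟩
  refine hU.posDom ((Metric.ball_subset_ball (min_le_left _ _)).trans hb) (min ε (r1 / 3))
    (har1.mono (by linarith [min_le_right ε (r1 / 3)])) ?_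
  intro x hx z hz
  rw [Metric.mem_ball] at hx hz
  have := dist_triangle_right x z y
  linarith

lemma good_of_hyp {Y : Type*} [MetricSpace Y] {κ : ℝ} {A : Set Y}
    (hU : ∀ y : Y, y ∉ A → ∃ U : Set Y, IsKappaDomain κ U ∧ y ∈ U)
    (hA : ∀ a ∈ A, ∃ r > (0 : ℝ), Metric.ball a r ∩ A = {a})
    (hconv : ∀ a ∈ A, IsConvexPoint a) : Good κ Y := by
  have hreg : ∀ y, y ∉ A → Reg κ y := fun y hy => by
    obtain ⟨U, h1, h2⟩ := hU y hy
    exact reg_of_domain h1 h2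
  constructor
  · intro y
    by_cases hy : y ∈ A
    · exact Or.inr (hconv y hy)
    · exact Or.inl (hreg y hy)
  · intro y
    by_cases hy : y ∈ A
    · obtain ⟨r, hr, h⟩ := hA y hy
      refine ⟨r, hr, fun z hz hd => hreg z fun hzA => hz ?_⟩
      have : z ∈ Metric.ball y r ∩ A := ⟨by rwa [Metric.mem_ball, dist_comm], hzA⟩
      rw [h] at this
      exact this
    · obtain ⟨r, hr, h⟩ := hreg y hy
      refine ⟨r, hr, fun z _ hd => ⟨r - dist y z, by linarith, h.mono ?_⟩⟩
      intro w hw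
      rw [Metric.mem_ball] at hw ⊢
      have := dist_triangle w z y
      rw [dist_comm z y] at this
      linarith

lemma countable_of_hyp {Y : Type*} [MetricSpace Y] [ProperSpace Y] {A : Set Y}
    (hA : ∀ a ∈ A, ∃ r > (0 : ℝ), Metric.ball a r ∩ A = {a}) : A.Countable := by
  have hd : DiscreteTopology A := by
    rw [discreteTopology_iff_isOpen_singleton]
    rintro ⟨a, ha⟩
    obtain ⟨r, hr, h⟩ := hA a ha
    rw [Metric.isOpen_iff]
    rintro x hx
    have hx : x = ⟨a, ha⟩ := hx
    subst hx
    refine ⟨r, hr, ?_⟩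
    rintro ⟨z, hz⟩ hzb
    have : z ∈ Metric.ball a r ∩ A := ⟨hzb, hz⟩
    rw [h] at this
    have : z = a := this
    subst this
    rfl
  rw [← Set.countable_coe_iff]
  exact countable_of_Lindelof_of_discrete

/-- Globalization over discrete singular points: if `Y` is a complete proper geodesic
length space of Hausdorff dimension `n`, every point outside `A` admits a κ-domain
neighborhood, `A` is discrete, and every point of `A` is convex, then `Y` satisfies the
global κ-comparison condition, i.e. `Y ∈ Alex^n(κ)`. -/
theorem globalization_discrete_convex {Y : Type*} [MetricSpace Y]
    [CompleteSpace Y] [ProperSpace Y] (n : ℕ) (κ : ℝ)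
    (hgeo : IsGeodesicSpace Y) (hlen : IsLengthSpace Y)
    (hdim : dimH (Set.univ : Set Y) = n) (A : Set Y)
    (hU : ∀ y : Y, y ∉ A → ∃ U : Set Y, IsKappaDomain κ U ∧ y ∈ U)
    (hA : ∀ a ∈ A, ∃ r > (0 : ℝ), Metric.ball a r ∩ A = {a})
    (hconv : ∀ a ∈ A, IsConvexPoint a) :
    ∀ p q₁ q₂ q₃ : Y, q₁ ≠ p → q₂ ≠ p → q₃ ≠ p →
      angleDefined κ (dist p q₁) (dist p q₂) (dist q₁ q₂) →
      angleDefined κ (dist p q₂) (dist p q₃) (dist q₂ q₃) →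
      angleDefined κ (dist p q₃) (dist p q₁) (dist q₃ q₁) →
      compAngleAt κ p q₁ q₂ + compAngleAt κ p q₂ q₃ + compAngleAt κ p q₃ q₁ ≤ 2 * Real.pi := by
  have hG : Good κ Y := good_of_hyp hU hA hconv
  have hcount : {y : Y | ¬ Reg κ y}.Countable := by
    refine (countable_of_hyp hA).mono fun y hy => ?_
    by_contra hyA
    obtain ⟨U, h1, h2⟩ := hU y hyA
    exact hy (reg_of_domain h1 h2)
  intro p q₁ q₂ q₃ h1 h2 h3 a12 a23 a31
  have b12 := adm_of_angleDefined.1 a12.2.2.2.2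
  have b23 := adm_of_angleDefined.1 a23.2.2.2.2
  have b31 := adm_of_angleDefined.1 a31.2.2.2.2
  have := quad_global hG hgeo hcount h1 h2 h3 b12 (b31.mono (by rw [dist_comm q₃ q₁]; linarith)) b23
  unfold compAngleAt
  rw [compAngle_eq, compAngle_eq, compAngle_eq]
  rw [CA_comm p q₁ q₃] at this
  unfold CA at this
  linarith
end
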